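/- arXiv:2210.17243 — 2 statements merged into one kernel-verified Lean document; each statement's English description precedes it below -/
import Mathlib

section
/- Let s be a real number with -2 < s < 2 and let u > 0 with u ≠ 1. Then ∫_0^∞ J_{1+s/2}(√u · x) · J_0(x) · x^{-s/2} dx equals 0 when 0 < u < 1, and equals (1/(u^{(2+s)/4} · Γ(1 + s/2))) · ((u-1)/2)^{s/2} when u > 1. -/
open scoped Real
open MeasureTheory

noncomputable section

/-- The zeroth-order Bessel function of the first kind. -/
def besselJ0 (x : ℝ) : ℝ :=
  ∑' ℓ : ℕ, (-1) ^ ℓ / ((Nat.factorial ℓ : ℝ)) ^ 2 * (x / 2) ^ (2 * ℓ)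

/-- The Bessel function of the first kind of real order `ν`,
`J_ν(x) = ∑_{ℓ=0}^∞ ((-1)^ℓ/(ℓ!·Γ(ν+ℓ+1))) (x/2)^{2ℓ+ν}`. -/
def besselJ (ν : ℝ) (x : ℝ) : ℝ :=
  ∑' ℓ : ℕ, (-1) ^ ℓ / ((Nat.factorial ℓ : ℝ) * Real.Gamma (ν + ℓ + 1)) *
    (x / 2) ^ (2 * (ℓ : ℝ) + ν)

namespace WS

open Set Filter Topology

lemma hasDerivAt_series (c : ℕ → ℝ) (hc : ∀ n, |c n| ≤ 1 / (n.factorial : ℝ)) (z : ℝ) :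
    HasDerivAt (fun z => ∑' n, c n * z ^ n) (∑' n : ℕ, ((n : ℝ) + 1) * c (n + 1) * z ^ n) z := by
  have hr : ∃ r : ℝ, |z| < r := ⟨|z| + 1, by linarith⟩
  obtain ⟨r, hr⟩ := hr
  have hr0 : 0 < r := lt_of_le_of_lt (abs_nonneg z) hr
  have key : HasDerivAt (fun z => ∑' n, c n * z ^ n)
      (∑' n, c n * ((n : ℝ) * z ^ (n - 1))) z := by
    have hsum : Summable (fun n : ℕ => (n : ℝ) * r ^ (n - 1) / (n.factorial : ℝ)) := by
      rw [← summable_nat_add_iff 1]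
      refine (Real.summable_pow_div_factorial r).congr ?_
      intro n
      have : (n.factorial : ℝ) ≠ 0 := by positivity
      have : (n : ℝ) + 1 ≠ 0 := by positivity
      rw [Nat.factorial_succ]
      push_cast
      try simp only [Nat.add_sub_cancel]
      field_simp
    refine hasDerivAt_tsum_of_isPreconnected (t := Metric.ball (0 : ℝ) r) (y₀ := 0) hsum
      Metric.isOpen_ball (convex_ball _ _).isPreconnected
      (g := fun n z => c n * z ^ n) (g' := fun n z => c n * ((n : ℝ) * z ^ (n - 1))) ?_ ?_ ?_ ?_ ?_
    · intro n y _
      exact (hasDerivAt_pow n y).const_mul _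
    · intro n y hy
      have hy' : |y| ≤ r := by
        have := Metric.mem_ball.1 hy
        rw [Real.dist_eq, sub_zero] at this
        exact this.le
      rw [Real.norm_eq_abs, abs_mul, abs_mul, abs_pow, Nat.abs_cast]
      calc |c n| * ((n : ℝ) * |y| ^ (n - 1)) ≤ 1 / (n.factorial : ℝ) * ((n : ℝ) * r ^ (n - 1)) := by
            gcongr
            exact hc n
        _ = _ := by ring
    · simpa using hr0
    · apply summable_of_ne_finset_zero (s := {0})
      intro n hn
      have : n ≠ 0 := by simpa using hn
      simp [this]
    · simpa using hr
  refine key.congr_deriv ?_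
  symm
  have hs2 : Summable (fun n : ℕ => c n * ((n : ℝ) * z ^ (n - 1))) := by
    rw [← summable_nat_add_iff 1]
    refine Summable.of_norm_bounded (Real.summable_pow_div_factorial |z|) ?_
    intro n
    rw [Real.norm_eq_abs, abs_mul, abs_mul, abs_pow, Nat.abs_cast]
    have h1 := hc (n + 1)
    rw [Nat.factorial_succ] at h1
    push_cast at h1 ⊢
    calc |c (n+1)| * (((n : ℝ) + 1) * |z| ^ (n + 1 - 1)) ≤
        1 / (((n : ℝ) + 1) * (n.factorial : ℝ)) * (((n : ℝ) + 1) * |z| ^ (n + 1 - 1)) := by gcongr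
      _ = _ := by
        have : (n.factorial : ℝ) ≠ 0 := by positivity
        have : (n : ℝ) + 1 ≠ 0 := by positivity
        simp only [Nat.add_sub_cancel]
        field_simp
  rw [hs2.tsum_eq_zero_add]
  simp only [CharP.cast_eq_zero, zero_mul, mul_zero, zero_add, Nat.add_sub_cancel]
  refine tsum_congr fun n => ?_
  push_cast
  ring

def cc (n : ℕ) : ℝ := (-1) ^ n / ((n.factorial : ℝ)) ^ 2 / 4 ^ n

lemma cc_succ (n : ℕ) : ((n : ℝ) + 1) ^ 2 * cc (n + 1) = - cc n / 4 := by
  unfold cc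
  rw [Nat.factorial_succ]
  have : (n.factorial : ℝ) ≠ 0 := by positivity
  have : (n : ℝ) + 1 ≠ 0 := by positivity
  push_cast
  field_simp
  ring

lemma abs_cc (n : ℕ) : |cc n| = 1 / ((n.factorial : ℝ)) ^ 2 / 4 ^ n := by
  unfold cc
  rw [abs_div, abs_div, abs_pow, abs_neg, abs_one, one_pow, abs_of_nonneg, abs_of_nonneg] <;>
    positivity

lemma abs_cc_le' (n : ℕ) : |-2 * (n : ℝ) * cc n| ≤ 1 / (n.factorial : ℝ) := by
  rw [abs_mul, abs_cc, abs_mul, Nat.abs_cast]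
  have h1 : (1 : ℝ) ≤ (n.factorial : ℝ) := by exact_mod_cast Nat.one_le_iff_ne_zero.2 (Nat.factorial_ne_zero n)
  have h2 : 2 * (n : ℝ) ≤ 4 ^ n := by
    have : n < 2 ^ n := Nat.lt_two_pow_self
    have h3 : (n : ℝ) ≤ 2 ^ n := by exact_mod_cast this.le
    have h4 : n + 1 ≤ 2 ^ n := this
    have h5 : (4 : ℝ) ^ n = 2 ^ n * 2 ^ n := by rw [← mul_pow]; norm_num
    have h6 : (n : ℝ) + 1 ≤ 2 ^ n := by exact_mod_cast h4
    rw [h5]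
    nlinarith [sq_nonneg ((n : ℝ) - 1)]
  have h4 : (0 : ℝ) < 4 ^ n := by positivity
  rw [div_div, mul_one_div, div_le_div_iff₀ (by positivity) (by positivity)]
  have : |(-2 : ℝ)| = 2 := by norm_num
  rw [this]
  nlinarith [mul_nonneg (mul_nonneg (sub_nonneg.2 h1) h4.le) (by positivity : (0:ℝ) ≤ n.factorial), mul_le_mul_of_nonneg_left h2 (by positivity : (0:ℝ) ≤ n.factorial)]

lemma abs_cc_le (n : ℕ) : |cc n| ≤ 1 / (n.factorial : ℝ) := by
  rw [abs_cc]
  have h1 : (1 : ℝ) ≤ (n.factorial : ℝ) := by exact_mod_cast Nat.one_le_iff_ne_zero.2 (Nat.factorial_ne_zero n)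
  have h4 : (1 : ℝ) ≤ 4 ^ n := one_le_pow₀ (by norm_num)
  rw [div_div]
  apply one_div_le_one_div_of_le (by positivity)
  nlinarith [mul_nonneg (sub_nonneg.2 h1) (sub_nonneg.2 h4), mul_nonneg (mul_nonneg (sub_nonneg.2 h1) (sub_nonneg.2 h4)) (by positivity : (0:ℝ) ≤ n.factorial), mul_nonneg (sub_nonneg.2 h1) (sub_nonneg.2 h1)]

def F (z : ℝ) : ℝ := ∑' n, cc n * z ^ n
def F' (z : ℝ) : ℝ := ∑' n : ℕ, ((n : ℝ) + 1) * cc (n + 1) * z ^ n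

lemma hasDerivAt_F (z : ℝ) : HasDerivAt F (F' z) z := hasDerivAt_series cc abs_cc_le z

lemma summable_F (z : ℝ) : Summable (fun n => cc n * z ^ n) := by
  refine Summable.of_norm_bounded (Real.summable_pow_div_factorial |z|) ?_
  intro n
  rw [Real.norm_eq_abs, abs_mul, abs_pow]
  calc _ ≤ 1 / (n.factorial : ℝ) * |z| ^ n := by gcongr; exact abs_cc_le n
    _ = _ := by ring

lemma summable_M (z : ℝ) : Summable (fun n : ℕ => (-2 * (n : ℝ) * cc n) * z ^ n) := by
  refine Summable.of_norm_bounded (Real.summable_pow_div_factorial |z|) ?_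
  intro n
  rw [Real.norm_eq_abs, abs_mul, abs_pow]
  calc _ ≤ 1 / (n.factorial : ℝ) * |z| ^ n := by gcongr; exact abs_cc_le' n
    _ = _ := by ring

lemma M_eq (z : ℝ) : ∑' n : ℕ, (-2 * (n : ℝ) * cc n) * z ^ n = -2 * z * F' z := by
  rw [(summable_M z).tsum_eq_zero_add, F', ← tsum_mul_left]
  simp only [CharP.cast_eq_zero, zero_mul, mul_zero, zero_add]
  refine tsum_congr fun n => ?_
  push_cast
  ring

lemma hasDerivAt_M (z : ℝ) : HasDerivAt (fun z => -2 * z * F' z) (F z / 2) z := by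
  have := hasDerivAt_series (fun n : ℕ => -2 * (n : ℝ) * cc n) abs_cc_le' z
  have h2 : (fun z => -2 * z * F' z) = fun z => ∑' n : ℕ, (-2 * (n : ℝ) * cc n) * z ^ n :=
    funext fun z => (M_eq z).symm
  rw [h2]
  refine this.congr_deriv ?_
  · rw [F, ← tsum_div_const]
    refine tsum_congr fun n => ?_
    have := cc_succ n
    push_cast
    linear_combination (-2 * z ^ n) * this

def J1 (x : ℝ) : ℝ := -2 * x * F' (x ^ 2)

lemma J0_eq (x : ℝ) : besselJ0 x = F (x ^ 2) := by
  unfold besselJ0 F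
  refine tsum_congr fun n => ?_
  rw [cc, div_pow, pow_mul, pow_mul]
  norm_num
  ring

lemma hasDerivAt_J0 (x : ℝ) : HasDerivAt besselJ0 (-J1 x) x := by
  have h : HasDerivAt (fun x : ℝ => F (x ^ 2)) (F' (x ^ 2) * (2 * x)) x := by
    have := (hasDerivAt_F (x ^ 2)).comp x (hasDerivAt_pow 2 x)
    refine this.congr_deriv ?_
    simp
  have h2 : besselJ0 = fun x : ℝ => F (x ^ 2) := funext J0_eq
  rw [h2]
  refine h.congr_deriv ?_
  unfold J1; ring

lemma hasDerivAt_xJ1 (x : ℝ) : HasDerivAt (fun x => x * J1 x) (x * besselJ0 x) x := by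
  have := (hasDerivAt_M (x ^ 2)).comp x (hasDerivAt_pow 2 x)
  have h2 : (fun x => x * J1 x) = ((fun z => -2 * z * F' z) ∘ fun x => x ^ 2) := by
    funext y
    simp only [J1, Function.comp]
    ring
  rw [h2]
  refine this.congr_deriv ?_
  rw [J0_eq]; simp; ring

lemma hasDerivAt_J1 {x : ℝ} (hx : x ≠ 0) : HasDerivAt J1 (besselJ0 x - J1 x / x) x := by
  have h := (hasDerivAt_xJ1 x).div (hasDerivAt_id x) hx
  have h2 : (fun x => x * J1 x) / id =ᶠ[𝓝 x] J1 := by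
    filter_upwards [isOpen_ne.mem_nhds hx] with y hy
    have hy : y ≠ 0 := hy
    simp only [Pi.div_apply, id]
    field_simp
  have h3 := h.congr_of_eventuallyEq h2.symm
  refine h3.congr_deriv ?_
  simp only [id]
  field_simp

lemma continuous_J0 : Continuous besselJ0 :=
  continuous_iff_continuousAt.2 fun x => (hasDerivAt_J0 x).continuousAt

lemma continuous_F' : Continuous F' := by
  have hc : ∀ n : ℕ, |((n : ℝ) + 1) * cc (n + 1)| ≤ 1 / (n.factorial : ℝ) := by
    intro n
    have h := abs_cc_le (n + 1)
    rw [Nat.factorial_succ] at h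
    push_cast at h
    rw [abs_mul, abs_of_nonneg (by positivity : (0 : ℝ) ≤ (n : ℝ) + 1)]
    calc ((n : ℝ) + 1) * |cc (n + 1)| ≤ ((n : ℝ) + 1) * (1 / (((n : ℝ) + 1) * n.factorial)) := by gcongr
      _ = _ := by
        have : (n.factorial : ℝ) ≠ 0 := by positivity
        have : (n : ℝ) + 1 ≠ 0 := by positivity
        field_simp
  exact continuous_iff_continuousAt.2 fun z => (hasDerivAt_series _ hc z).continuousAt

lemma continuous_J1 : Continuous J1 := by
  unfold J1
  have := continuous_F'
  fun_prop

end WS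

namespace WS

open Set Filter Topology

def En (x : ℝ) : ℝ := x * (besselJ0 x ^ 2 + J1 x ^ 2) - besselJ0 x * J1 x + besselJ0 x ^ 2 / (2 * x)

lemma hasDerivAt_En {x : ℝ} (hx : x ≠ 0) : HasDerivAt En (-(besselJ0 x ^ 2 / (2 * x ^ 2))) x := by
  have h0 := hasDerivAt_J0 x
  have h1 := hasDerivAt_J1 hx
  have h := (((hasDerivAt_id x).mul ((h0.pow 2).add (h1.pow 2))).sub (h0.mul h1)).add
    ((h0.pow 2).div ((hasDerivAt_id x).const_mul 2) (by simpa using hx))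
  have h' : HasDerivAt En _ x := h
  refine h'.congr_deriv ?_
  simp
  field_simp
  ring

lemma exists_bound : ∃ B : ℝ, 0 < B ∧ ∀ x, 0 ≤ x → (1 + x) * (besselJ0 x ^ 2 + J1 x ^ 2) ≤ B ^ 2 := by
  have hanti : AntitoneOn En (Ici 1) := by
    apply antitoneOn_of_deriv_nonpos (convex_Ici 1)
    · intro x hx
      have : x ≠ 0 := (lt_of_lt_of_le one_pos hx).ne'
      exact (hasDerivAt_En this).continuousAt.continuousWithinAt
    · intro x hx
      rw [interior_Ici] at hx
      have : x ≠ 0 := (lt_trans one_pos hx).ne'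
      exact (hasDerivAt_En this).differentiableAt.differentiableWithinAt
    · intro x hx
      rw [interior_Ici] at hx
      have : x ≠ 0 := (lt_trans one_pos hx).ne'
      rw [(hasDerivAt_En this).deriv]
      have : 0 ≤ besselJ0 x ^ 2 / (2 * x ^ 2) := by positivity
      linarith
  have hc : Continuous (fun x => (1 + x) * (besselJ0 x ^ 2 + J1 x ^ 2)) := by
    have := continuous_J0
    have := continuous_J1
    fun_prop
  obtain ⟨C, hC⟩ := (isCompact_Icc (a := (0 : ℝ)) (b := 1)).bddAbove_image hc.continuousOn
  have hC' : ∀ x ∈ Icc (0 : ℝ) 1, (1 + x) * (besselJ0 x ^ 2 + J1 x ^ 2) ≤ C := fun x hx =>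
    hC (mem_image_of_mem _ hx)
  refine ⟨Real.sqrt (|C| + 4 * |En 1| + 1), by positivity, fun x hx => ?_⟩
  rw [Real.sq_sqrt (by positivity)]
  rcases le_total x 1 with h | h
  · have := hC' x ⟨hx, h⟩
    have := le_abs_self C
    have := abs_nonneg (En 1)
    linarith
  · have h1 : En x ≤ En 1 := hanti (mem_Ici.2 le_rfl) h h
    have h2 := le_abs_self (En 1)
    have h3 := abs_nonneg C
    have h4 : 0 ≤ besselJ0 x ^ 2 / (2 * x) := by positivity
    unfold En at h1
    have h5 : (1 + x) * (besselJ0 x ^ 2 + J1 x ^ 2) ≤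
      4 * (x * (besselJ0 x ^ 2 + J1 x ^ 2) - besselJ0 x * J1 x) := by
      nlinarith [sq_nonneg (besselJ0 x - J1 x), mul_nonneg (sub_nonneg.2 h) (sq_nonneg (besselJ0 x)), mul_nonneg (sub_nonneg.2 h) (sq_nonneg (J1 x))]
    unfold En at h2 ⊢
    linarith

def BB : ℝ := exists_bound.choose
lemma BB_pos : 0 < BB := exists_bound.choose_spec.1
lemma BB_spec {x : ℝ} (hx : 0 ≤ x) : (1 + x) * (besselJ0 x ^ 2 + J1 x ^ 2) ≤ BB ^ 2 :=
  exists_bound.choose_spec.2 x hx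

lemma abs_J0_le {x : ℝ} (hx : 0 ≤ x) : |besselJ0 x| ≤ BB := by
  apply abs_le_of_sq_le_sq _ BB_pos.le
  nlinarith [BB_spec hx, sq_nonneg (J1 x), mul_nonneg hx (sq_nonneg (J1 x)), mul_nonneg hx (sq_nonneg (besselJ0 x))]

lemma abs_J1_le {x : ℝ} (hx : 0 ≤ x) : |J1 x| ≤ BB := by
  apply abs_le_of_sq_le_sq _ BB_pos.le
  nlinarith [BB_spec hx, sq_nonneg (besselJ0 x), mul_nonneg hx (sq_nonneg (J1 x)), mul_nonneg hx (sq_nonneg (besselJ0 x))]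

def k0 (x : ℝ) : ℝ := Real.sqrt x * besselJ0 x
def k1 (x : ℝ) : ℝ := Real.sqrt x * J1 x

lemma abs_k0_le (x : ℝ) : |k0 x| ≤ BB := by
  unfold k0
  rcases le_total 0 x with hx | hx
  · apply abs_le_of_sq_le_sq _ BB_pos.le
    rw [mul_pow, Real.sq_sqrt hx]
    nlinarith [BB_spec hx, sq_nonneg (J1 x), sq_nonneg (besselJ0 x), mul_nonneg hx (sq_nonneg (J1 x))]
  · rw [Real.sqrt_eq_zero_of_nonpos hx]; simpa using BB_pos.le

lemma abs_k1_le (x : ℝ) : |k1 x| ≤ BB := by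
  unfold k1
  rcases le_total 0 x with hx | hx
  · apply abs_le_of_sq_le_sq _ BB_pos.le
    rw [mul_pow, Real.sq_sqrt hx]
    nlinarith [BB_spec hx, sq_nonneg (J1 x), sq_nonneg (besselJ0 x), mul_nonneg hx (sq_nonneg (besselJ0 x))]
  · rw [Real.sqrt_eq_zero_of_nonpos hx]; simpa using BB_pos.le

lemma continuous_k0 : Continuous k0 := Real.continuous_sqrt.mul continuous_J0
lemma continuous_k1 : Continuous k1 := Real.continuous_sqrt.mul continuous_J1

lemma intervalIntegrable_inv_sqrt (x : ℝ) :
    IntervalIntegrable (fun y => 1 / (2 * Real.sqrt y)) volume 0 x := by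
  have h := (intervalIntegral.intervalIntegrable_rpow' (a := 0) (b := x) (r := -(1/2)) (by norm_num)).const_mul (1/2)
  rcases le_total 0 x with hx | hx
  · refine h.congr ?_
    intro y hy
    rw [uIoc_of_le hx] at hy
    simp only
    rw [Real.rpow_neg hy.1.le, ← Real.sqrt_eq_rpow]
    field_simp
  · refine (intervalIntegrable_const (c := (0:ℝ))).congr ?_
    intro y hy
    rw [uIoc_of_ge hx] at hy
    simp [Real.sqrt_eq_zero_of_nonpos hy.2]

lemma integral_inv_sqrt {x : ℝ} (hx : 0 ≤ x) :
    ∫ y in (0 : ℝ)..x, 1 / (2 * Real.sqrt y) = Real.sqrt x := by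
  rw [intervalIntegral.integral_eq_sub_of_hasDerivAt_of_le hx
    (f := Real.sqrt) Real.continuous_sqrt.continuousOn ?_ (intervalIntegrable_inv_sqrt x)]
  · simp
  · intro y hy
    exact Real.hasDerivAt_sqrt hy.1.ne'

lemma div_sqrt_aux (J : ℝ → ℝ) (hJ : Continuous J) (hb : ∀ x, 0 ≤ x → |J x| ≤ BB) {x : ℝ} (hx : 0 ≤ x) :
    IntervalIntegrable (fun y => J y * (1 / (2 * Real.sqrt y))) volume 0 x ∧
    |∫ y in (0 : ℝ)..x, J y * (1 / (2 * Real.sqrt y))| ≤ BB * Real.sqrt x := by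
  constructor
  · exact (intervalIntegrable_inv_sqrt x).continuousOn_mul hJ.continuousOn
  · rw [← integral_inv_sqrt hx, ← intervalIntegral.integral_const_mul, ← Real.norm_eq_abs]
    apply intervalIntegral.norm_integral_le_of_norm_le hx
    · refine ae_of_all _ fun y hy => ?_
      rw [norm_mul, Real.norm_eq_abs, Real.norm_eq_abs, abs_of_nonneg (by positivity : 0 ≤ 1 / (2 * Real.sqrt y))]
      have := hb y hy.1.le
      gcongr
    · exact (intervalIntegrable_inv_sqrt x).const_mul _

lemma bound_int_k1 (x : ℝ) : |∫ y in (0 : ℝ)..x, k1 y| ≤ 2 * BB * Real.sqrt |x| := by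
  rcases le_total 0 x with hx | hx
  · obtain ⟨hi, hb⟩ := div_sqrt_aux besselJ0 continuous_J0 (fun x hx => abs_J0_le hx) hx
    have hk := continuous_k1.intervalIntegrable (μ := volume) 0 x
    have h := intervalIntegral.integral_eq_sub_of_hasDerivAt_of_le hx
      (f := k0) (f' := fun y => besselJ0 y * (1 / (2 * Real.sqrt y)) - k1 y) continuous_k0.continuousOn ?_ (hi.sub hk)
    · rw [intervalIntegral.integral_sub hi hk] at h
      have h2 : |k0 x| ≤ BB * Real.sqrt x := by
        unfold k0
        rw [abs_mul, abs_of_nonneg (Real.sqrt_nonneg x), mul_comm]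
        gcongr
        exact abs_J0_le hx
      have h3 : k0 0 = 0 := by simp [k0]
      rw [abs_of_nonneg hx]
      rw [abs_le] at *
      constructor <;> linarith
    · intro y hy
      have := (Real.hasDerivAt_sqrt hy.1.ne').mul (hasDerivAt_J0 y)
      have h' : HasDerivAt k0 _ y := this
      refine h'.congr_deriv ?_
      simp only [k1]
      ring
  · have : ∫ y in (0 : ℝ)..x, k1 y = 0 := by
      rw [intervalIntegral.integral_zero_ae]
      refine ae_of_all _ fun y hy => ?_
      rw [uIoc_of_ge hx] at hy
      simp [k1, Real.sqrt_eq_zero_of_nonpos hy.2]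
    rw [this]
    have := BB_pos
    simp
    positivity

lemma bound_int_k0 (x : ℝ) : |∫ y in (0 : ℝ)..x, k0 y| ≤ 2 * BB * Real.sqrt |x| := by
  rcases le_total 0 x with hx | hx
  · obtain ⟨hi, hb⟩ := div_sqrt_aux J1 continuous_J1 (fun x hx => abs_J1_le hx) hx
    have hk := continuous_k0.intervalIntegrable (μ := volume) 0 x
    have h := intervalIntegral.integral_eq_sub_of_hasDerivAt_of_le hx
      (f := k1) (f' := fun y => k0 y - J1 y * (1 / (2 * Real.sqrt y))) continuous_k1.continuousOn ?_ (hk.sub hi)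
    · rw [intervalIntegral.integral_sub hk hi] at h
      have h2 : |k1 x| ≤ BB * Real.sqrt x := by
        unfold k1
        rw [abs_mul, abs_of_nonneg (Real.sqrt_nonneg x), mul_comm]
        gcongr
        exact abs_J1_le hx
      have h3 : k1 0 = 0 := by simp [k1]
      rw [abs_of_nonneg hx]
      rw [abs_le] at *
      constructor <;> linarith
    · intro y hy
      have := (Real.hasDerivAt_sqrt hy.1.ne').mul (hasDerivAt_J1 hy.1.ne')
      have h' : HasDerivAt k1 _ y := this
      refine h'.congr_deriv ?_
      simp only [k0]
      have h0 : Real.sqrt y ≠ 0 := (Real.sqrt_pos.2 hy.1).ne'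
      have h1 : y = Real.sqrt y ^ 2 := (Real.sq_sqrt hy.1.le).symm
      have h2 : Real.sqrt y * (J1 y / y) = J1 y / Real.sqrt y := by
        have h3 : y ≠ 0 := hy.1.ne'
        rw [← mul_div_assoc, div_eq_div_iff h3 h0]
        linear_combination (-J1 y) * h1
      rw [mul_sub, h2]
      field_simp
      ring
  · have : ∫ y in (0 : ℝ)..x, k0 y = 0 := by
      rw [intervalIntegral.integral_zero_ae]
      refine ae_of_all _ fun y hy => ?_
      rw [uIoc_of_ge hx] at hy
      simp [k0, Real.sqrt_eq_zero_of_nonpos hy.2]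
    rw [this]
    have := BB_pos
    simp
    positivity

end WS

namespace WS

open Set Filter Topology

lemma riemann_lebesgue (k : ℝ → ℝ) (hk : Continuous k) (B : ℝ) (hB0 : 0 < B) (hB : ∀ x, |k x| ≤ B)
    (D : ℝ) (hK : ∀ x, |∫ y in (0 : ℝ)..x, k y| ≤ D * Real.sqrt |x|)
    (w : ℝ → ℝ) (hw : Integrable w) :
    Tendsto (fun R : ℝ => ∫ t, w t * k (t * R)) atTop (𝓝 0) := by
  rw [Metric.tendsto_atTop']
  intro ε hε
  obtain ⟨g, hgc, hgd, hg⟩ := MemLp.exist_eLpNorm_sub_le (p := 1) ENNReal.one_ne_top le_rfl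
    (memLp_one_iff_integrable.2 hw) (ε := ε / (2 * B)) (by positivity)
  have hgcont : Continuous g := hgd.continuous
  have hgi : Integrable g := hgcont.integrable_of_hasCompactSupport hgc
  have hsub : ∫ t, |w t - g t| ≤ ε / (2 * B) := by
    have h1 := integral_norm_eq_lintegral_enorm (μ := volume) (hw.sub hgi).aestronglyMeasurable
    rw [eLpNorm_one_eq_lintegral_enorm] at hg
    have h2 : ∫ t, |w t - g t| = ∫ t, ‖(w - g) t‖ := rfl
    rw [h2, h1]
    exact ENNReal.toReal_le_of_le_ofReal (by positivity) hg
  have hdc : Continuous (deriv g) := hgd.continuous_deriv (by simp)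
  have hds : HasCompactSupport (deriv g) := hgc.deriv
  have hcs : Continuous (fun t : ℝ => Real.sqrt |t|) := Real.continuous_sqrt.comp continuous_abs
  have hdi : Integrable (fun t => |deriv g t| * Real.sqrt |t|) := by
    apply Continuous.integrable_of_hasCompactSupport
    · exact hdc.abs.mul hcs
    · exact (hds.comp_left (g := fun x => |x|) abs_zero).mul_right
  set L := ∫ t, |deriv g t| * Real.sqrt |t| with hL
  have hKc : Continuous (fun x => ∫ y in (0 : ℝ)..x, k y) :=
    intervalIntegral.continuous_primitive (fun a b => hk.intervalIntegrable a b) 0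
  have hmain : ∀ R : ℝ, 0 < R → |∫ t, g t * k (t * R)| ≤ D * L / Real.sqrt R := by
    intro R hR
    have hv : ∀ t : ℝ, HasDerivAt (fun t => (∫ y in (0 : ℝ)..(t * R), k y) / R) (k (t * R)) t := by
      intro t
      have h1 : HasDerivAt (fun x => ∫ y in (0 : ℝ)..x, k y) (k (t * R)) (t * R) :=
        intervalIntegral.integral_hasDerivAt_right (hk.intervalIntegrable _ _)
          hk.aestronglyMeasurable.stronglyMeasurableAtFilter hk.continuousAt
      have h2 := (h1.comp t ((hasDerivAt_id t).mul_const R)).div_const R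
      refine h2.congr_deriv ?_
      field_simp
    have hvc : Continuous (fun t => (∫ y in (0 : ℝ)..(t * R), k y) / R) :=
      (hKc.comp (continuous_id.mul continuous_const)).div_const R
    have hkc : Continuous (fun t => k (t * R)) := by fun_prop
    have hparts := integral_mul_deriv_eq_deriv_mul_of_integrable (u := g) (u' := deriv g)
      (v := fun t => (∫ y in (0 : ℝ)..(t * R), k y) / R) (v' := fun t => k (t * R))
      (fun x _ => (hgd.differentiable (by simp) x).hasDerivAt) (fun x _ => hv x)
      ((hgcont.mul hkc).integrable_of_hasCompactSupport hgc.mul_right)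
      ((hdc.mul hvc).integrable_of_hasCompactSupport hds.mul_right)
      ((hgcont.mul hvc).integrable_of_hasCompactSupport hgc.mul_right)
    rw [hparts, abs_neg, ← Real.norm_eq_abs]
    have hbd : ∀ t, ‖deriv g t * ((∫ y in (0 : ℝ)..(t * R), k y) / R)‖ ≤
        (D / Real.sqrt R) * (|deriv g t| * Real.sqrt |t|) := by
      intro t
      rw [norm_mul, norm_div, Real.norm_eq_abs, Real.norm_eq_abs, Real.norm_eq_abs, abs_of_pos hR]
      have h1 := hK (t * R)
      rw [abs_mul, abs_of_pos hR, Real.sqrt_mul (abs_nonneg t)] at h1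
      have hs : 0 < Real.sqrt R := Real.sqrt_pos.2 hR
      have hs2 : R = Real.sqrt R * Real.sqrt R := (Real.mul_self_sqrt hR.le).symm
      calc _ ≤ |deriv g t| * ((D * (Real.sqrt |t| * Real.sqrt R)) / R) := by gcongr
        _ = |deriv g t| * ((D * (Real.sqrt |t| * Real.sqrt R)) / (Real.sqrt R * Real.sqrt R)) := by rw [← hs2]
        _ = _ := by field_simp
    refine (norm_integral_le_of_norm_le (hdi.const_mul _) (ae_of_all _ hbd)).trans (le_of_eq ?_)
    rw [integral_const_mul]
    ring
  have hlim : Tendsto (fun R => D * L / Real.sqrt R) atTop (𝓝 0) :=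
    tendsto_const_nhds.div_atTop Real.tendsto_sqrt_atTop
  obtain ⟨R0, hR0⟩ := (Metric.tendsto_atTop'.1 hlim) (ε / 2) (by positivity)
  refine ⟨max R0 0, fun R hR => ?_⟩
  have hR1 := hR0 R (lt_of_le_of_lt (le_max_left _ _) hR)
  have hRp : 0 < R := lt_of_le_of_lt (le_max_right _ _) hR
  rw [Real.dist_eq, sub_zero] at hR1 ⊢
  have h2 := hmain R hRp
  have hkc : Continuous (fun t => k (t * R)) := by fun_prop
  have hbk : ∀ v : ℝ → ℝ, Integrable v → Integrable (fun t => v t * k (t * R)) := by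
    intro v hv
    exact hv.mul_bdd (c := B) hkc.aestronglyMeasurable (ae_of_all _ fun t => hB _)
  have hsplit : ∫ t, w t * k (t * R) = (∫ t, (w t - g t) * k (t * R)) + ∫ t, g t * k (t * R) := by
    rw [← integral_add (hbk (fun t => w t - g t) (hw.sub hgi)) (hbk _ hgi)]
    congr 1
    funext t
    ring
  have h3 : |∫ t, (w t - g t) * k (t * R)| ≤ ε / 2 := by
    have : ‖∫ t, (w t - g t) * k (t * R)‖ ≤ ∫ t, |w t - g t| * B := by
      refine norm_integral_le_of_norm_le ((hw.sub hgi).abs.mul_const B) (ae_of_all _ fun t => ?_)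
      rw [norm_mul, Real.norm_eq_abs, Real.norm_eq_abs]
      have := hB (t * R)
      gcongr
    rw [integral_mul_const] at this
    calc _ ≤ _ := this
      _ ≤ ε / (2 * B) * B := by gcongr
      _ = _ := by field_simp
  rw [hsplit]
  have h4 := le_abs_self (D * L / Real.sqrt R)
  have h5 := abs_add_le (∫ t, (w t - g t) * k (t * R)) (∫ t, g t * k (t * R))
  linarith

lemma lommel (t R : ℝ) :
    (1 - t ^ 2) * ∫ x in (0 : ℝ)..R, x * besselJ0 x * besselJ0 (x * t) =
      R * (J1 R * besselJ0 (R * t) - t * besselJ0 R * J1 (R * t)) := by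
  rw [← intervalIntegral.integral_const_mul]
  have hd : ∀ x : ℝ, HasDerivAt (fun x => (x * J1 x) * besselJ0 (x * t) - besselJ0 x * ((x * t) * J1 (x * t)))
      ((1 - t ^ 2) * (x * besselJ0 x * besselJ0 (x * t))) x := by
    intro x
    have hm : HasDerivAt (fun x : ℝ => x * t) t x := by
      simpa using (hasDerivAt_id x).mul_const t
    have h1 := (hasDerivAt_J0 (x * t)).comp x hm
    have h2 := (hasDerivAt_xJ1 (x * t)).comp x hm
    have h := ((hasDerivAt_xJ1 x).mul h1).sub ((hasDerivAt_J0 x).mul h2)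
    refine HasDerivAt.congr_deriv (f := (fun x => (x * J1 x) * besselJ0 (x * t) - besselJ0 x * ((x * t) * J1 (x * t)))) h ?_
    simp only [Function.comp]
    ring
  rw [intervalIntegral.integral_eq_sub_of_hasDerivAt (fun x _ => hd x)]
  · simp
    ring
  · apply Continuous.intervalIntegrable
    have := continuous_J0
    fun_prop

lemma abs_J0_le' (x : ℝ) : |besselJ0 x| ≤ BB := by
  have : besselJ0 x = besselJ0 |x| := by rw [J0_eq, J0_eq, sq_abs]
  rw [this]
  exact abs_J0_le (abs_nonneg x)

lemma hankel_series (f : ℝ → ℝ) (hf0 : ∀ t, 0 < t → 0 ≤ f t)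
    (hi : ∀ n : ℕ, IntegrableOn (fun t => t ^ n * f t) (Ioi 0)) (m : ℕ → ℝ)
    (hm : ∀ n : ℕ, ∫ t in Ioi (0 : ℝ), t ^ (2 * n + 1) * f t = m n) (x : ℝ)
    (hs : Summable (fun n : ℕ => |cc n| * (x ^ 2) ^ n * m n)) :
    ∫ t in Ioi (0 : ℝ), besselJ0 (x * t) * (t * f t) = ∑' n, cc n * (x ^ 2) ^ n * m n := by
  have h := hasSum_integral_of_summable_integral_norm (μ := volume.restrict (Ioi (0 : ℝ)))
    (F := fun (n : ℕ) t => (cc n * (x ^ 2) ^ n) * (t ^ (2 * n + 1) * f t))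
    (fun n => (hi (2 * n + 1)).const_mul _) ?_
  · simp_rw [integral_const_mul, hm] at h
    rw [h.tsum_eq]
    refine setIntegral_congr_fun measurableSet_Ioi fun t _ => ?_
    rw [J0_eq, F, ← tsum_mul_right]
    refine tsum_congr fun n => ?_
    ring
  · refine hs.congr fun n => ?_
    rw [← hm n, ← integral_const_mul]
    refine setIntegral_congr_fun measurableSet_Ioi fun t ht => ?_
    have ht : 0 < t := ht
    have := hf0 t ht
    rw [norm_mul, norm_mul, Real.norm_eq_abs, Real.norm_eq_abs, Real.norm_eq_abs, abs_of_nonneg (by positivity : 0 ≤ (x ^ 2) ^ n),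
      abs_of_nonneg (by positivity : 0 ≤ t ^ (2 * n + 1) * f t)]

lemma gauss_int (n : ℕ) : IntegrableOn (fun t : ℝ => t ^ n * Real.exp (-(1/2) * t ^ 2)) (Ioi 0) := by
  have h := integrableOn_rpow_mul_exp_neg_mul_sq (b := 1/2) (by norm_num) (s := n) (by
    have : (0:ℝ) ≤ n := Nat.cast_nonneg n
    linarith)
  simpa only [Real.rpow_natCast] using h

lemma gauss_moment (n : ℕ) : ∫ t in Ioi (0 : ℝ), t ^ (2 * n + 1) * Real.exp (-(1/2) * t ^ 2) =
    2 ^ n * n.factorial := by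
  have h := integral_rpow_mul_exp_neg_mul_rpow (p := 2) (q := ((2 * n + 1 : ℕ) : ℝ)) (b := 1/2) (by norm_num) (by
    have : (0:ℝ) ≤ ((2 * n + 1 : ℕ) : ℝ) := Nat.cast_nonneg _
    linarith) (by norm_num)
  simp only [Real.rpow_natCast, Real.rpow_two] at h
  rw [h]
  have e1 : (((2 * n + 1 : ℕ) : ℝ) + 1) / 2 = (n : ℝ) + 1 := by push_cast; ring
  have e2 : -(((2 * n + 1 : ℕ) : ℝ) + 1) / 2 = -((n + 1 : ℕ) : ℝ) := by push_cast; ring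
  rw [e1, e2, Real.Gamma_nat_eq_factorial, Real.rpow_neg (by norm_num), Real.rpow_natCast, pow_succ]
  simp
  left
  ring

lemma gauss_hankel (x : ℝ) : ∫ t in Ioi (0 : ℝ), besselJ0 (x * t) * (t * Real.exp (-(1/2) * t ^ 2)) =
    Real.exp (-(1/2) * x ^ 2) := by
  have hid : ∀ (n : ℕ), cc n * (x ^ 2) ^ n * (2 ^ n * n.factorial) = (-(1/2) * x ^ 2) ^ n / n.factorial := by
    intro n
    unfold cc
    have : (n.factorial : ℝ) ≠ 0 := by positivity
    have h4 : (4 : ℝ) ^ n = 2 ^ n * 2 ^ n := by rw [← mul_pow]; norm_num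
    have : (2 : ℝ) ^ n ≠ 0 := by positivity
    rw [h4, mul_pow, show (-(1/2) : ℝ) = (-1) * 2⁻¹ by norm_num, mul_pow, inv_pow]
    field_simp
  rw [hankel_series _ (fun t _ => (Real.exp_pos _).le) gauss_int _ gauss_moment]
  · simp_rw [hid]
    rw [Real.exp_eq_exp_ℝ, NormedSpace.exp_eq_tsum_div]
  · have h := (Real.summable_pow_div_factorial (-(1/2) * x ^ 2)).abs
    refine h.congr fun n => ?_
    rw [← hid, abs_mul, abs_mul, abs_of_nonneg (by positivity : 0 ≤ (x ^ 2) ^ n), abs_of_nonneg (by positivity : (0:ℝ) ≤ 2 ^ n * n.factorial)]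

end WS

namespace WS

open Set Filter Topology

lemma quot_bound (H : ℝ → ℝ) (d : ℝ) (hd : HasDerivAt H d 1) (h1 : H 1 = 0) :
    ∃ C δ : ℝ, 0 < C ∧ 0 < δ ∧ ∀ t, 0 < t →
      |H t / (1 - t ^ 2)| ≤ (Ioc (0 : ℝ) 2).indicator (fun _ => C) t + |H t| / δ := by
  obtain ⟨C, hCpos, hC⟩ := hd.isBigO_sub.exists_pos
  rw [Asymptotics.isBigOWith_iff] at hC
  obtain ⟨δ, hδ, hb⟩ := Metric.eventually_nhds_iff.1 hC
  refine ⟨C, min δ 1, hCpos, by positivity, fun t ht => ?_⟩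
  by_cases hlt : |t - 1| < min δ 1
  · have h2 := hb (y := t) (by rw [Real.dist_eq]; exact lt_of_lt_of_le hlt (min_le_left _ _))
    rw [h1, sub_zero, Real.norm_eq_abs, Real.norm_eq_abs] at h2
    have ht2 : t ≤ 2 := by
      have := (abs_lt.1 (lt_of_lt_of_le hlt (min_le_right _ _))).2
      linarith
    rw [indicator_of_mem (show t ∈ Ioc (0:ℝ) 2 from ⟨ht, ht2⟩)]
    have h3 : |H t / (1 - t ^ 2)| ≤ C := by
      rw [abs_div]
      apply div_le_of_le_mul₀ (abs_nonneg _) hCpos.le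
      refine h2.trans ?_
      have : |1 - t ^ 2| = |t - 1| * (1 + t) := by
        rw [← abs_of_pos (by linarith : 0 < 1 + t), ← abs_mul, ← abs_neg]
        congr 1
        ring
      rw [this]
      have : 0 ≤ |t - 1| * t := by positivity
      nlinarith
    have : 0 ≤ |H t| / min δ 1 := by positivity
    linarith
  · have h3 : |H t / (1 - t ^ 2)| ≤ |H t| / min δ 1 := by
      rw [abs_div]
      apply div_le_div_of_nonneg_left (abs_nonneg _) (by positivity)
      have : |1 - t ^ 2| = |t - 1| * (1 + t) := by
        rw [← abs_of_pos (by linarith : 0 < 1 + t), ← abs_mul, ← abs_neg]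
        congr 1
        ring
      rw [this]
      have : 0 ≤ |t - 1| * t := by positivity
      push Not at hlt
      nlinarith
    have : 0 ≤ (Ioc (0 : ℝ) 2).indicator (fun _ => C) t := indicator_nonneg (fun _ _ => hCpos.le) t
    linarith

lemma quot_int (H : ℝ → ℝ) (hi : ∀ n : ℕ, IntegrableOn (fun t => t ^ n * H t) (Ioi 0))
    (d : ℝ) (hd : HasDerivAt H d 1) (h1 : H 1 = 0) (q : ℝ → ℝ) (hq : Measurable q)
    (hqb : ∀ t, 0 < t → |q t| ≤ 1 + t ^ 2) :
    IntegrableOn (fun t => q t * (H t / (1 - t ^ 2))) (Ioi 0) := by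
  obtain ⟨C, δ, hC, hδ, hb⟩ := quot_bound H d hd h1
  have hI0 : IntegrableOn H (Ioi 0) := by simpa using hi 0
  have hI2 := hi 2
  have hind : IntegrableOn ((Ioc (0 : ℝ) 2).indicator (fun _ => 5 * C)) (Ioi 0) :=
    ((integrable_indicator_iff measurableSet_Ioc).2 (integrableOn_const (by simp))).integrableOn
  have hdom := hind.add ((hI0.abs.add hI2.abs).div_const δ)
  refine Integrable.mono' hdom ?_ ?_
  · refine hq.aestronglyMeasurable.mul ?_
    simp_rw [div_eq_mul_inv]
    exact hI0.aestronglyMeasurable.mul (Measurable.aestronglyMeasurable (by fun_prop))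
  · rw [ae_restrict_iff' measurableSet_Ioi]
    refine ae_of_all _ fun t ht => ?_
    have ht : 0 < t := ht
    have h2 := hb t ht
    have h3 := hqb t ht
    simp only [Pi.add_apply]
    rw [norm_mul, Real.norm_eq_abs, Real.norm_eq_abs]
    have h4 : |t ^ 2 * H t| = t ^ 2 * |H t| := by rw [abs_mul, abs_of_nonneg (by positivity)]
    rw [h4]
    calc |q t| * |H t / (1 - t ^ 2)| ≤ (1 + t ^ 2) * ((Ioc (0 : ℝ) 2).indicator (fun _ => C) t + |H t| / δ) := by
          gcongr
      _ = (1 + t ^ 2) * ((Ioc (0 : ℝ) 2).indicator (fun _ => C) t) + (|H t| + t ^ 2 * |H t|) / δ := by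
          ring
      _ ≤ _ := by
          gcongr
          by_cases h : t ∈ Ioc (0 : ℝ) 2
          · rw [indicator_of_mem h, indicator_of_mem h]
            have := h.2
            have : 1 + t ^ 2 ≤ 5 := by nlinarith
            gcongr
          · rw [indicator_of_notMem h, indicator_of_notMem h]
            simp

lemma main_int (H : ℝ → ℝ) (hi : ∀ n : ℕ, IntegrableOn (fun t => t ^ n * H t) (Ioi 0)) (R : ℝ) :
    Integrable (fun z : ℝ × ℝ => z.1 * besselJ0 z.1 * (besselJ0 (z.1 * z.2) * (z.2 * H z.2)))
      ((volume.restrict (Ioc 0 R)).prod (volume.restrict (Ioi 0))) := by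
  have hc := continuous_J0
  have h1 : Integrable (fun x : ℝ => x * besselJ0 x) (volume.restrict (Ioc 0 R)) :=
    (Continuous.integrableOn_Icc (by fun_prop)).mono_set Ioc_subset_Icc_self
  have h2 : Integrable (fun t : ℝ => t * H t) (volume.restrict (Ioi 0)) := by simpa using! hi 1
  have h3 := h1.mul_prod h2
  have h4 := h3.mul_bdd (g := fun z : ℝ × ℝ => besselJ0 (z.1 * z.2)) (c := BB)
    (Continuous.aestronglyMeasurable (by fun_prop)) (ae_of_all _ fun t => abs_J0_le' _)
  refine h4.congr (ae_of_all _ fun z => ?_)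
  simp only
  ring

def hank (H : ℝ → ℝ) (x : ℝ) : ℝ := ∫ t in Ioi (0 : ℝ), besselJ0 (x * t) * (t * H t)

lemma main_ii (H : ℝ → ℝ) (hi : ∀ n : ℕ, IntegrableOn (fun t => t ^ n * H t) (Ioi 0)) {R : ℝ} (hR : 0 ≤ R) :
    IntervalIntegrable (fun x => x * besselJ0 x * hank H x) volume 0 R := by
  rw [intervalIntegrable_iff_integrableOn_Ioc_of_le hR]
  have := (main_int H hi R).integral_prod_left
  refine this.congr (ae_of_all _ fun x => ?_)
  simp only [hank]
  rw [integral_const_mul]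

lemma int_hi0 (H : ℝ → ℝ) (hi : ∀ n : ℕ, IntegrableOn (fun t => t ^ n * H t) (Ioi 0))
    (d : ℝ) (hd : HasDerivAt H d 1) (h1 : H 1 = 0) :
    IntegrableOn (fun t => Real.sqrt t * (H t / (1 - t ^ 2))) (Ioi 0) := by
  refine quot_int H hi d hd h1 _ (by fun_prop) fun t ht => ?_
  rw [abs_of_nonneg (Real.sqrt_nonneg t)]
  have := Real.sq_sqrt ht.le
  have := Real.sqrt_nonneg t
  nlinarith [sq_nonneg (Real.sqrt t - 1), sq_nonneg (t - 1)]

lemma int_hi1 (H : ℝ → ℝ) (hi : ∀ n : ℕ, IntegrableOn (fun t => t ^ n * H t) (Ioi 0))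
    (d : ℝ) (hd : HasDerivAt H d 1) (h1 : H 1 = 0) :
    IntegrableOn (fun t => (t * Real.sqrt t) * (H t / (1 - t ^ 2))) (Ioi 0) := by
  refine quot_int H hi d hd h1 _ (by fun_prop) fun t ht => ?_
  have h2 := Real.sq_sqrt ht.le
  have h3 := Real.sqrt_nonneg t
  rw [abs_of_nonneg (by positivity)]
  have h4 : t ^ 2 = Real.sqrt t ^ 4 := by
    calc t ^ 2 = (Real.sqrt t ^ 2) ^ 2 := by rw [h2]
      _ = _ := by ring
  have h5 : t * Real.sqrt t = Real.sqrt t ^ 3 := by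
    calc t * Real.sqrt t = (Real.sqrt t ^ 2) * Real.sqrt t := by rw [h2]
      _ = _ := by ring
  rw [h4, h5]
  rcases le_total (Real.sqrt t) 1 with h | h
  · have : Real.sqrt t ^ 3 ≤ 1 := pow_le_one₀ h3 h
    have : 0 ≤ Real.sqrt t ^ 4 := by positivity
    linarith
  · have : Real.sqrt t ^ 3 ≤ Real.sqrt t ^ 4 := pow_le_pow_right₀ h (by norm_num)
    linarith

lemma main_eq (H : ℝ → ℝ) (hi : ∀ n : ℕ, IntegrableOn (fun t => t ^ n * H t) (Ioi 0))
    (d : ℝ) (hd : HasDerivAt H d 1) (h1 : H 1 = 0) {R : ℝ} (hR : 0 ≤ R) :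
    ∫ x in (0 : ℝ)..R, x * besselJ0 x * hank H x =
      k1 R * (∫ t, (Ioi (0 : ℝ)).indicator (fun t => Real.sqrt t * (H t / (1 - t ^ 2))) t * k0 (t * R)) -
      k0 R * (∫ t, (Ioi (0 : ℝ)).indicator (fun t => (t * Real.sqrt t) * (H t / (1 - t ^ 2))) t * k1 (t * R)) := by
  have hi0 := int_hi0 H hi d hd h1
  have hi1 := int_hi1 H hi d hd h1
  have hk0 : IntegrableOn (fun t => Real.sqrt t * (H t / (1 - t ^ 2)) * k0 (t * R)) (Ioi 0) :=
    hi0.mul_bdd (c := BB) (continuous_k0.comp (by fun_prop)).aestronglyMeasurable (ae_of_all _ fun t => abs_k0_le _)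
  have hk1 : IntegrableOn (fun t => (t * Real.sqrt t) * (H t / (1 - t ^ 2)) * k1 (t * R)) (Ioi 0) :=
    hi1.mul_bdd (c := BB) (continuous_k1.comp (by fun_prop)).aestronglyMeasurable (ae_of_all _ fun t => abs_k1_le _)
  have hconv : ∀ (v k : ℝ → ℝ), ∫ t, (Ioi (0 : ℝ)).indicator v t * k t = ∫ t in Ioi (0:ℝ), v t * k t := by
    intro v k
    rw [← integral_indicator measurableSet_Ioi]
    congr 1
    funext t
    by_cases h : t ∈ Ioi (0:ℝ)
    · rw [indicator_of_mem h, indicator_of_mem h]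
    · rw [indicator_of_notMem h, indicator_of_notMem h, zero_mul]
  rw [hconv, hconv, ← integral_const_mul, ← integral_const_mul, ← integral_sub (hk0.const_mul _) (hk1.const_mul _)]
  have hsw := integral_integral_swap (f := fun x t => x * besselJ0 x * (besselJ0 (x * t) * (t * H t))) (main_int H hi R)
  rw [intervalIntegral.integral_of_le hR]
  have hl : ∫ x in Ioc 0 R, x * besselJ0 x * hank H x =
      ∫ x in Ioc 0 R, ∫ t in Ioi (0:ℝ), x * besselJ0 x * (besselJ0 (x * t) * (t * H t)) := by
    congr 1
    funext x
    rw [hank, integral_const_mul]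
  rw [hl, hsw]
  refine setIntegral_congr_fun measurableSet_Ioi fun t ht => ?_
  have ht : 0 < t := ht
  have hin : ∫ x in Ioc 0 R, x * besselJ0 x * (besselJ0 (x * t) * (t * H t)) =
      (t * H t) * ∫ x in (0:ℝ)..R, x * besselJ0 x * besselJ0 (x * t) := by
    rw [intervalIntegral.integral_of_le hR, ← integral_const_mul]
    congr 1
    funext x
    ring
  have hH : H t = (1 - t ^ 2) * (H t / (1 - t ^ 2)) := by
    by_cases h : t = 1
    · rw [h, h1]; simp
    · have : 1 - t ^ 2 ≠ 0 := by
        intro h0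
        have : (t - 1) * (t + 1) = 0 := by linarith
        rcases mul_eq_zero.1 this with h2 | h2
        · exact h (by linarith)
        · linarith
      field_simp
  have hlo := lommel t R
  generalize hp : H t / (1 - t ^ 2) = p at *
  simp only [hin]
  rw [hH]
  have e : t * ((1 - t ^ 2) * p) * (∫ x in (0:ℝ)..R, x * besselJ0 x * besselJ0 (x * t)) =
    t * p * ((1 - t ^ 2) * ∫ x in (0:ℝ)..R, x * besselJ0 x * besselJ0 (x * t)) := by ring
  rw [e, hlo]
  simp only [k0, k1]
  rw [Real.sqrt_mul ht.le, mul_comm R t]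
  have a1 := Real.mul_self_sqrt ht.le
  have a2 := Real.mul_self_sqrt hR
  generalize besselJ0 (t * R) = X
  generalize J1 (t * R) = Y
  generalize besselJ0 R = Z
  generalize J1 R = W
  have : t * R = Real.sqrt t * Real.sqrt t * (Real.sqrt R * Real.sqrt R) := by rw [a1, a2]
  linear_combination p * (W * X - t * Z * Y) * this

lemma main_lim (H : ℝ → ℝ) (hi : ∀ n : ℕ, IntegrableOn (fun t => t ^ n * H t) (Ioi 0))
    (d : ℝ) (hd : HasDerivAt H d 1) (h1 : H 1 = 0) :
    Tendsto (fun R : ℝ => ∫ x in (0 : ℝ)..R, x * besselJ0 x * hank H x) atTop (𝓝 0) := by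
  have hi0 := int_hi0 H hi d hd h1
  have hi1 := int_hi1 H hi d hd h1
  have l0 := riemann_lebesgue k0 continuous_k0 BB BB_pos abs_k0_le (2 * BB) bound_int_k0 _
    ((integrable_indicator_iff measurableSet_Ioi).2 hi0)
  have l1 := riemann_lebesgue k1 continuous_k1 BB BB_pos abs_k1_le (2 * BB) bound_int_k1 _
    ((integrable_indicator_iff measurableSet_Ioi).2 hi1)
  have bdd : ∀ (k : ℝ → ℝ), (∀ x, |k x| ≤ BB) → ∀ f : ℝ → ℝ, Tendsto f atTop (𝓝 0) →
      Tendsto (fun R => k R * f R) atTop (𝓝 0) := by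
    intro k hk f hf
    exact bdd_le_mul_tendsto_zero' BB (Eventually.of_forall hk) hf
  have := (bdd k1 abs_k1_le _ l0).sub (bdd k0 abs_k0_le _ l1)
  rw [sub_zero] at this
  refine this.congr' ?_
  filter_upwards [eventually_ge_atTop 0] with R hR
  exact (main_eq H hi d hd h1 hR).symm

end WS

namespace WS

open Set Filter Topology

def ff (a ν t : ℝ) : ℝ := if t ≤ a then (a ^ 2 - t ^ 2) ^ ν else 0

lemma beta_ii {a ν : ℝ} (ha : 0 < a) (hν : -1 < ν) :
    IntervalIntegrable (fun t : ℝ => (a ^ 2 - t ^ 2) ^ ν) volume 0 a := by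
  have h1 : IntervalIntegrable (fun t : ℝ => t ^ ν) volume 0 a :=
    intervalIntegral.intervalIntegrable_rpow' hν
  have h2 : IntervalIntegrable (fun t : ℝ => (a - t) ^ ν) volume 0 a := by
    simpa using (h1.comp_sub_left a).symm
  have h3 : ContinuousOn (fun t : ℝ => (a + t) ^ ν) (uIcc 0 a) := by
    rw [uIcc_of_le ha.le]
    apply ContinuousOn.rpow_const (by fun_prop)
    intro t ht
    left
    have := ht.1
    linarith
  refine (h2.mul_continuousOn h3).congr ?_
  intro t ht
  rw [uIoc_of_le ha.le] at ht
  have := ht.1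
  have := ht.2
  simp only
  rw [← Real.mul_rpow (by linarith) (by linarith)]
  congr 1
  ring

lemma beta_io {a ν : ℝ} (ha : 0 < a) (hν : -1 < ν) (φ : ℝ → ℝ) (hφ : Continuous φ) :
    IntegrableOn (fun t => φ t * ff a ν t) (Ioi 0) ∧
    ∫ t in Ioi (0:ℝ), φ t * ff a ν t = ∫ t in (0:ℝ)..a, φ t * (a ^ 2 - t ^ 2) ^ ν := by
  have h1 : IntervalIntegrable (fun t : ℝ => φ t * (a ^ 2 - t ^ 2) ^ ν) volume 0 a :=
    (beta_ii ha hν).continuousOn_mul hφ.continuousOn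
  rw [intervalIntegrable_iff_integrableOn_Ioc_of_le ha.le] at h1
  have hc1 : EqOn (fun t : ℝ => φ t * (a ^ 2 - t ^ 2) ^ ν) (fun t => φ t * ff a ν t) (Ioc 0 a) := by
    intro t ht
    simp [ff, ht.2]
  have hc2 : EqOn (fun _ : ℝ => (0:ℝ)) (fun t => φ t * ff a ν t) (Ioi a) := by
    intro t ht
    have : ¬ t ≤ a := not_le.2 ht
    simp [ff, this]
  have h2 := h1.congr_fun hc1 measurableSet_Ioc
  have h3 : IntegrableOn (fun t => φ t * ff a ν t) (Ioi a) :=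
    (integrableOn_zero (μ := volume)).congr_fun hc2 measurableSet_Ioi
  have hU : Ioc 0 a ∪ Ioi a = Ioi 0 := Ioc_union_Ioi_eq_Ioi ha.le
  constructor
  · rw [← hU]; exact h2.union h3
  · rw [← hU, setIntegral_union (Ioc_disjoint_Ioi le_rfl) measurableSet_Ioi h2 h3,
      ← setIntegral_congr_fun measurableSet_Ioi hc2, ← setIntegral_congr_fun measurableSet_Ioc hc1,
      intervalIntegral.integral_of_le ha.le]
    simp

lemma beta_deriv {a ν : ℝ} {t : ℝ} (ht : t ∈ Ioo 0 a) :
    HasDerivAt (fun t : ℝ => (a ^ 2 - t ^ 2) ^ (ν + 1)) (-2 * (ν + 1) * (t * (a ^ 2 - t ^ 2) ^ ν)) t := by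
  have hp : 0 < a ^ 2 - t ^ 2 := by have := ht.1; have := ht.2; nlinarith
  have h1 : HasDerivAt (fun t : ℝ => a ^ 2 - t ^ 2) (-(2 * t)) t := by
    simpa using (hasDerivAt_pow 2 t).const_sub (a ^ 2)
  have h2 := h1.rpow_const (p := ν + 1) (Or.inl hp.ne')
  refine h2.congr_deriv ?_
  rw [add_sub_cancel_right]
  ring

lemma beta_cont {a ν : ℝ} (hν : -1 < ν) : Continuous (fun t : ℝ => (a ^ 2 - t ^ 2) ^ (ν + 1)) := by
  apply Continuous.rpow_const (by fun_prop)
  intro t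
  right
  linarith

lemma beta_zero {a ν : ℝ} (ha : 0 < a) (hν : -1 < ν) :
    ∫ t in (0:ℝ)..a, t * (a ^ 2 - t ^ 2) ^ ν = (a ^ 2) ^ (ν + 1) / (2 * (ν + 1)) := by
  have hii := (beta_ii ha hν).continuousOn_mul (g := fun t => t) continuous_id.continuousOn
  have h := intervalIntegral.integral_eq_sub_of_hasDerivAt_of_le ha.le (beta_cont (a := a) hν).continuousOn
    (fun t ht => beta_deriv ht) (hii.const_mul _)
  rw [intervalIntegral.integral_const_mul] at h
  have h0 : ν + 1 ≠ 0 := by linarith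
  rw [sub_self, Real.zero_rpow h0] at h
  field_simp
  simp at h
  linarith

lemma beta_succ {a ν : ℝ} (ha : 0 < a) (hν : -1 < ν) (n : ℕ) :
    (n + ν + 2) * ∫ t in (0:ℝ)..a, t ^ (2 * (n + 1) + 1) * (a ^ 2 - t ^ 2) ^ ν =
     (n + 1) * a ^ 2 * ∫ t in (0:ℝ)..a, t ^ (2 * n + 1) * (a ^ 2 - t ^ 2) ^ ν := by
  have hii : ∀ k : ℕ, IntervalIntegrable (fun t : ℝ => t ^ k * (a ^ 2 - t ^ 2) ^ ν) volume 0 a := fun k =>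
    (beta_ii ha hν).continuousOn_mul (g := fun t => t ^ k) (continuous_pow k).continuousOn
  have h := intervalIntegral.integral_eq_sub_of_hasDerivAt_of_le ha.le
    (f := fun t => t ^ (2 * n + 2) * (a ^ 2 - t ^ 2) ^ (ν + 1))
    (f' := fun t => (2 * (n + 1) * a ^ 2) * (t ^ (2 * n + 1) * (a ^ 2 - t ^ 2) ^ ν) -
      (2 * (n + ν + 2)) * (t ^ (2 * (n + 1) + 1) * (a ^ 2 - t ^ 2) ^ ν))
    ((continuous_pow _).mul (beta_cont (a := a) hν)).continuousOn ?_
    (((hii _).const_mul _).sub ((hii _).const_mul _))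
  · rw [intervalIntegral.integral_sub ((hii _).const_mul _) ((hii _).const_mul _),
      intervalIntegral.integral_const_mul, intervalIntegral.integral_const_mul] at h
    have h0 : ν + 1 ≠ 0 := by linarith
    rw [sub_self, Real.zero_rpow h0] at h
    simp at h
    linarith
  · intro t ht
    have hp : 0 < a ^ 2 - t ^ 2 := by have := ht.1; have := ht.2; nlinarith
    have h2 := (hasDerivAt_pow (2 * n + 2) t).mul (beta_deriv (ν := ν) ht)
    refine HasDerivAt.congr_deriv (f := fun t => t ^ (2 * n + 2) * (a ^ 2 - t ^ 2) ^ (ν + 1)) h2 ?_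
    rw [Real.rpow_add hp, Real.rpow_one]
    have : 2 * n + 2 - 1 = 2 * n + 1 := by omega
    rw [this]
    push_cast
    ring

lemma beta_moment {a ν : ℝ} (ha : 0 < a) (hν : -1 < ν) (n : ℕ) :
    ∫ t in (0:ℝ)..a, t ^ (2 * n + 1) * (a ^ 2 - t ^ 2) ^ ν =
      (a ^ 2) ^ n * (a ^ 2) ^ (ν + 1) * n.factorial * Real.Gamma (ν + 1) / (2 * Real.Gamma (n + ν + 2)) := by
  induction n with
  | zero =>
    have h0 : ν + 1 ≠ 0 := by linarith
    have hG : Real.Gamma (ν + 1) ≠ 0 := (Real.Gamma_pos_of_pos (by linarith)).ne'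
    have h1 := Real.Gamma_add_one h0
    simp
    rw [beta_zero ha hν, show ν + 2 = ν + 1 + 1 by ring, h1]
    field_simp
  | succ n ih =>
    have h := beta_succ ha hν n
    rw [ih] at h
    have hn : (0:ℝ) ≤ n := Nat.cast_nonneg n
    have h0 : (n:ℝ) + ν + 2 ≠ 0 := by linarith
    have h1 := Real.Gamma_add_one h0
    have hG : Real.Gamma (n + ν + 2) ≠ 0 := (Real.Gamma_pos_of_pos (by linarith)).ne'
    have e : ((n + 1 : ℕ) : ℝ) + ν + 2 = n + ν + 2 + 1 := by push_cast; ring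
    rw [e, h1, Nat.factorial_succ]
    push_cast
    rw [← mul_right_inj' h0, h]
    field_simp
    ring

lemma ff_nonneg {a ν t : ℝ} (ht : 0 < t) : 0 ≤ ff a ν t := by
  unfold ff
  split_ifs with h
  · apply Real.rpow_nonneg
    nlinarith
  · exact le_rfl

lemma beta_moment_le {a ν : ℝ} (ha : 0 < a) (hν : -1 < ν) (n : ℕ) :
    ∫ t in (0:ℝ)..a, t ^ (2 * n + 1) * (a ^ 2 - t ^ 2) ^ ν ≤
      (a ^ 2) ^ n * ∫ t in (0:ℝ)..a, t * (a ^ 2 - t ^ 2) ^ ν := by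
  rw [← intervalIntegral.integral_const_mul]
  have hii : ∀ k : ℕ, IntervalIntegrable (fun t : ℝ => t ^ k * (a ^ 2 - t ^ 2) ^ ν) volume 0 a := fun k =>
    (beta_ii ha hν).continuousOn_mul (g := fun t => t ^ k) (continuous_pow k).continuousOn
  apply intervalIntegral.integral_mono_on ha.le (hii _)
  · simpa using (hii 1).const_mul ((a ^ 2) ^ n)
  · intro t ht
    have h0 : 0 ≤ (a ^ 2 - t ^ 2) ^ ν := by
      apply Real.rpow_nonneg
      have := ht.1; have := ht.2; nlinarith
    have h1 : (t ^ 2) ^ n ≤ (a ^ 2) ^ n := by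
      have := ht.1; have := ht.2
      gcongr
    have h2 := ht.1
    calc t ^ (2 * n + 1) * (a ^ 2 - t ^ 2) ^ ν = (t ^ 2) ^ n * (t * (a ^ 2 - t ^ 2) ^ ν) := by ring
      _ ≤ _ := by gcongr

lemma hank_ff {a ν : ℝ} (ha : 0 < a) (hν : -1 < ν) (x : ℝ) :
    hank (ff a ν) x = ∑' n : ℕ, cc n * (x ^ 2) ^ n *
      ((a ^ 2) ^ n * (a ^ 2) ^ (ν + 1) * n.factorial * Real.Gamma (ν + 1) / (2 * Real.Gamma (n + ν + 2))) := by
  unfold hank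
  refine hankel_series _ (fun t ht => ff_nonneg ht)
    (fun n => (beta_io ha hν (fun t => t ^ n) (continuous_pow n)).1) _
    (fun n => ((beta_io ha hν (fun t => t ^ (2 * n + 1)) (continuous_pow _)).2.trans (beta_moment ha hν n))) x ?_
  have hs := (Real.summable_pow_div_factorial (x ^ 2 * a ^ 2)).mul_right (∫ t in (0:ℝ)..a, t * (a ^ 2 - t ^ 2) ^ ν)
  have hG : ∀ n : ℕ, 0 < Real.Gamma (n + ν + 2) := fun n =>
    Real.Gamma_pos_of_pos (by have : (0:ℝ) ≤ n := Nat.cast_nonneg n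
                              linarith)
  have hG1 : 0 < Real.Gamma (ν + 1) := Real.Gamma_pos_of_pos (by linarith)
  refine Summable.of_nonneg_of_le (fun n => ?_) (fun n => ?_) hs
  · have := hG n
    positivity
  · rw [← beta_moment ha hν n]
    have h1 := beta_moment_le ha hν n
    have h2 := abs_cc_le n
    have h3 : 0 ≤ ∫ t in (0:ℝ)..a, t ^ (2 * n + 1) * (a ^ 2 - t ^ 2) ^ ν := by
      rw [beta_moment ha hν n]
      have := hG n
      positivity
    calc _ ≤ 1 / (n.factorial : ℝ) * (x ^ 2) ^ n * ((a ^ 2) ^ n * ∫ t in (0:ℝ)..a, t * (a ^ 2 - t ^ 2) ^ ν) := by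
          gcongr
      _ = _ := by rw [mul_pow]; ring

lemma integrand_eq {a ν : ℝ} (ha : 0 < a) (hν : -1 < ν) {x : ℝ} (hx : 0 < x) :
    besselJ (1 + ν) (a * x) * besselJ0 x * x ^ (-ν) =
      ((a / 2) ^ (1 + ν) * 2 / ((a ^ 2) ^ (ν + 1) * Real.Gamma (ν + 1))) * (x * besselJ0 x * hank (ff a ν) x) := by
  rw [hank_ff ha hν, besselJ]
  have hG1 : 0 < Real.Gamma (ν + 1) := Real.Gamma_pos_of_pos (by linarith)
  have hA : 0 < (a ^ 2) ^ (ν + 1) := by positivity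
  have hterm : ∀ n : ℕ, (-1) ^ n / ((Nat.factorial n : ℝ) * Real.Gamma (1 + ν + n + 1)) *
      (a * x / 2) ^ (2 * (n : ℝ) + (1 + ν)) =
      ((a * x / 2) ^ (1 + ν) * 2 / ((a ^ 2) ^ (ν + 1) * Real.Gamma (ν + 1))) * (cc n * (x ^ 2) ^ n *
      ((a ^ 2) ^ n * (a ^ 2) ^ (ν + 1) * n.factorial * Real.Gamma (ν + 1) / (2 * Real.Gamma (n + ν + 2)))) := by
    intro n
    have hG : 0 < Real.Gamma (n + ν + 2) :=
      Real.Gamma_pos_of_pos (by have : (0:ℝ) ≤ n := Nat.cast_nonneg n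
                                linarith)
    have e : 1 + ν + n + 1 = n + ν + 2 := by ring
    rw [e, Real.rpow_add (by positivity), Real.rpow_mul (by positivity), Real.rpow_natCast, Real.rpow_two,
      show (a * x / 2) ^ 2 = a ^ 2 * x ^ 2 / 4 by ring, div_pow, mul_pow, cc]
    have : (n.factorial : ℝ) ≠ 0 := by positivity
    field_simp
  rw [tsum_congr hterm, tsum_mul_left]
  have h1 : (a * x / 2) ^ (1 + ν) = (a / 2) ^ (1 + ν) * (x * x ^ ν) := by
    rw [show a * x / 2 = (a / 2) * x by ring, Real.mul_rpow (by positivity) hx.le, Real.rpow_add hx, Real.rpow_one]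
  have h2 : x ^ (-ν) * x ^ ν = 1 := by rw [← Real.rpow_add hx]; simp
  rw [h1]
  generalize (∑' n : ℕ, cc n * (x ^ 2) ^ n *
      ((a ^ 2) ^ n * (a ^ 2) ^ (ν + 1) * n.factorial * Real.Gamma (ν + 1) / (2 * Real.Gamma (n + ν + 2)))) = S
  have : ∀ A : ℝ, A ≠ 0 → (a / 2) ^ (1 + ν) * (x * x ^ ν) * 2 / A * S * besselJ0 x * x ^ (-ν) =
      (a / 2) ^ (1 + ν) * 2 / A * (x * besselJ0 x * S) := by
    intro A hA
    field_simp
    linear_combination (S * besselJ0 x) * h2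
  exact this _ (by positivity)

lemma ff_deriv {a ν : ℝ} (ha : 0 < a) (ha1 : a ≠ 1) : ∃ d, HasDerivAt (ff a ν) d 1 := by
  rcases lt_or_gt_of_ne ha1 with h | h
  · refine ⟨0, (hasDerivAt_const (1:ℝ) (0:ℝ)).congr_of_eventuallyEq ?_⟩
    filter_upwards [lt_mem_nhds h] with t ht
    simp [ff, not_le.2 ht]
  · have hp : 0 < a ^ 2 - 1 ^ 2 := by nlinarith
    have h1 : HasDerivAt (fun t : ℝ => a ^ 2 - t ^ 2) _ 1 := (hasDerivAt_pow 2 (1:ℝ)).const_sub (a ^ 2)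
    refine ⟨_, (h1.rpow_const (p := ν) (Or.inl hp.ne')).congr_of_eventuallyEq ?_⟩
    filter_upwards [gt_mem_nhds h] with t ht
    simp [ff, ht.le]

lemma hank_lim {a ν : ℝ} (ha : 0 < a) (ha1 : a ≠ 1) (hν : -1 < ν) :
    Tendsto (fun R : ℝ => ∫ x in (0 : ℝ)..R, x * besselJ0 x * hank (ff a ν) x) atTop (𝓝 (ff a ν 1)) := by
  obtain ⟨d, hd⟩ := ff_deriv (ν := ν) ha ha1
  set c := ff a ν 1 * Real.exp (1/2) with hc
  have hfi : ∀ n : ℕ, IntegrableOn (fun t => t ^ n * ff a ν t) (Ioi 0) :=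
    fun n => (beta_io ha hν (fun t => t ^ n) (continuous_pow n)).1
  let H : ℝ → ℝ := fun t => ff a ν t - c * Real.exp (-(1/2) * t ^ 2)
  have hHi : ∀ n : ℕ, IntegrableOn (fun t => t ^ n * H t) (Ioi 0) := by
    intro n
    refine ((hfi n).sub ((gauss_int n).const_mul c)).congr (ae_of_all _ fun t => ?_)
    simp only [Pi.sub_apply, H]
    ring
  have hgd : DifferentiableAt ℝ (fun t : ℝ => c * Real.exp (-(1/2) * t ^ 2)) 1 := by fun_prop
  have hHd : HasDerivAt H _ 1 := hd.sub hgd.hasDerivAt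
  have hH1 : H 1 = 0 := by
    simp only [H, hc]
    rw [mul_assoc, ← Real.exp_add]
    norm_num
  have hlim := main_lim H hHi _ hHd hH1
  have hg1 := gauss_int 1
  have hc0 := continuous_J0
  have hgi : IntegrableOn (fun t : ℝ => besselJ0 (1 * t) * (t * Real.exp (-(1/2) * t ^ 2))) (Ioi 0) := by
    simp only [pow_one] at hg1
    exact hg1.bdd_mul (c := BB) (Continuous.aestronglyMeasurable (by fun_prop)) (ae_of_all _ fun t => abs_J0_le' _)
  have hglim := intervalIntegral_tendsto_integral_Ioi (0:ℝ) hgi tendsto_id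
  rw [gauss_hankel 1] at hglim
  have hsum := hlim.add (hglim.const_mul c)
  have e : 0 + c * Real.exp (-(1/2) * 1 ^ 2) = ff a ν 1 := by
    rw [hc, zero_add, mul_assoc, ← Real.exp_add]
    norm_num
  rw [e] at hsum
  refine hsum.congr' ?_
  filter_upwards [eventually_ge_atTop 0] with R hR
  rw [id, ← intervalIntegral.integral_const_mul, ← intervalIntegral.integral_add (main_ii H hHi hR)]
  · refine intervalIntegral.integral_congr fun x _ => ?_
    have hx : hank H x = hank (ff a ν) x - c * Real.exp (-(1/2) * x ^ 2) := by
      rw [← gauss_hankel x, hank, hank, ← integral_const_mul, ← integral_sub]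
      · congr 1
        funext t
        simp only [H]
        ring
      · have := hfi 1
        simp only [pow_one] at this
        exact this.bdd_mul (c := BB) (Continuous.aestronglyMeasurable (by fun_prop)) (ae_of_all _ fun t => abs_J0_le' _)
      · simp only [pow_one] at hg1
        exact (hg1.bdd_mul (c := BB) (Continuous.aestronglyMeasurable (by fun_prop)) (ae_of_all _ fun t => abs_J0_le' _)).const_mul c
    simp only [hx, one_mul]
    ring
  · apply Continuous.intervalIntegrable
    fun_prop

end WS

/-- The Weber–Schafheitlin integral: for `-2 < s < 2` and `u > 0`, `u ≠ 1`,
`∫_0^∞ J_{1+s/2}(√u x) J₀(x) x^{-s/2} dx` equals `0` if `0 < u < 1` and equals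
`(1/(u^{(2+s)/4} Γ(1+s/2))) ((u-1)/2)^{s/2}` if `u > 1`
(as an improper integral, i.e. a limit of `∫_0^R`). -/
theorem weber_schafheitlin (s : ℝ) (hs₁ : -2 < s) (hs₂ : s < 2)
    (u : ℝ) (hu : 0 < u) (hu' : u ≠ 1) :
    Filter.Tendsto
      (fun R : ℝ => ∫ x in (0 : ℝ)..R,
        besselJ (1 + s / 2) (Real.sqrt u * x) * besselJ0 x * x ^ (-s / 2))
      Filter.atTop
      (nhds (if u < 1 then 0
        else 1 / (u ^ ((2 + s) / 4) * Real.Gamma (1 + s / 2)) * ((u - 1) / 2) ^ (s / 2))) := by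
  have ha : 0 < Real.sqrt u := Real.sqrt_pos.2 hu
  have hsq : Real.sqrt u ^ 2 = u := Real.sq_sqrt hu.le
  have ha1 : Real.sqrt u ≠ 1 := by
    intro h
    rw [h] at hsq
    exact hu' (by linarith)
  have hν : -1 < s / 2 := by linarith
  have h := (WS.hank_lim ha ha1 hν).const_mul
    ((Real.sqrt u / 2) ^ (1 + s / 2) * 2 / ((Real.sqrt u ^ 2) ^ (s / 2 + 1) * Real.Gamma (s / 2 + 1)))
  have hval : ((Real.sqrt u / 2) ^ (1 + s / 2) * 2 /
      ((Real.sqrt u ^ 2) ^ (s / 2 + 1) * Real.Gamma (s / 2 + 1))) * WS.ff (Real.sqrt u) (s / 2) 1 =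
      (if u < 1 then 0
        else 1 / (u ^ ((2 + s) / 4) * Real.Gamma (1 + s / 2)) * ((u - 1) / 2) ^ (s / 2)) := by
    have hG : 0 < Real.Gamma (1 + s / 2) := Real.Gamma_pos_of_pos (by linarith)
    split_ifs with h1
    · have : ¬ (1 ≤ Real.sqrt u) := by
        rw [not_le, Real.sqrt_lt' one_pos]
        simpa using h1
      simp [WS.ff, this]
    · have h2 : 1 ≤ Real.sqrt u := Real.one_le_sqrt.2 (not_lt.1 h1)
      rw [WS.ff, if_pos h2, hsq, Real.div_rpow ha.le (by norm_num), Real.sqrt_eq_rpow,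
        ← Real.rpow_mul hu.le, one_pow, Real.div_rpow (by linarith [not_lt.1 h1]) (by norm_num),
        show (1 / 2 * (1 + s / 2)) = (2 + s) / 4 by ring,
        show s / 2 + 1 = (2 + s) / 4 + (2 + s) / 4 by ring, Real.rpow_add hu,
        show (2 + s) / 4 + (2 + s) / 4 = 1 + s / 2 by ring, Real.rpow_add two_pos, Real.rpow_one]
      have : 0 < u ^ ((2 + s) / 4) := by positivity
      have : (0:ℝ) < 2 ^ (s / 2) := by positivity
      field_simp
  rw [hval] at h
  refine h.congr' ?_
  filter_upwards [Filter.eventually_ge_atTop 0] with R hR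
  rw [← intervalIntegral.integral_const_mul, intervalIntegral.integral_of_le hR,
    intervalIntegral.integral_of_le hR]
  refine setIntegral_congr_fun measurableSet_Ioc fun x hx => ?_
  rw [← WS.integrand_eq ha hν hx.1, neg_div]
end
end

section
/- Let s be a real number with -2 < s < 2 and let u > 0 with u ≠ 4. Then ∫_0^∞ J_{1+s/2}(√u · x) · J_0(x)^2 · x^{-s/2} dx equals ∫_0^{2 arcsin(√u/2)} (u - 4 sin²(φ/2))^{s/2} / (2^{s/2} · π · u^{(2+s)/4} · Γ(1 + s/2)) dφ when 0 < u < 4, and equals ∫_0^π (u - 4 sin²(φ/2))^{s/2} / (2^{s/2} · π · u^{(2+s)/4} · Γ(1 + s/2)) dφ when u > 4. -/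
open scoped Real
open MeasureTheory

noncomputable section

namespace WS
open Filter Topology Set

def gc (n ℓ : ℕ) : ℝ := (-1) ^ ℓ / ((Nat.factorial ℓ : ℝ) * (Nat.factorial (ℓ + n) : ℝ))

def G (n : ℕ) (z : ℝ) : ℝ := ∑' ℓ : ℕ, gc n ℓ * z ^ ℓ

lemma gc_abs_le (n ℓ : ℕ) : |gc n ℓ| ≤ 1 / (Nat.factorial ℓ : ℝ) := by
  unfold gc
  rw [abs_div, abs_pow, abs_neg, abs_one, one_pow, abs_of_pos (by positivity)]
  apply one_div_le_one_div_of_le (by positivity)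
  have : (1:ℝ) ≤ (Nat.factorial (ℓ + n) : ℝ) := by exact_mod_cast Nat.factorial_pos _
  nlinarith [show (0:ℝ) < (Nat.factorial ℓ : ℝ) by positivity]

lemma gc_term_le (n ℓ : ℕ) (z : ℝ) : ‖gc n ℓ * z ^ ℓ‖ ≤ |z| ^ ℓ / (Nat.factorial ℓ : ℝ) := by
  rw [norm_mul, norm_pow, Real.norm_eq_abs, Real.norm_eq_abs]
  calc |gc n ℓ| * |z| ^ ℓ ≤ 1 / (Nat.factorial ℓ : ℝ) * |z| ^ ℓ := by
        gcongr; exact gc_abs_le n ℓ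
    _ = _ := by ring

lemma summable_G_norm (n : ℕ) (z : ℝ) : Summable (fun ℓ => ‖gc n ℓ * z ^ ℓ‖) :=
  Summable.of_nonneg_of_le (fun _ => norm_nonneg _) (fun ℓ => gc_term_le n ℓ z)
    (Real.summable_pow_div_factorial |z|)

lemma summable_G (n : ℕ) (z : ℝ) : Summable (fun ℓ => gc n ℓ * z ^ ℓ) :=
  (summable_G_norm n z).of_norm

lemma gc_succ (n ℓ : ℕ) : gc n (ℓ + 1) * ((ℓ + 1 : ℕ) : ℝ) = - gc (n + 1) ℓ := by
  unfold gc
  rw [Nat.factorial_succ ℓ, show ℓ + 1 + n = ℓ + (n + 1) by ring]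
  push_cast
  have h1 : (ℓ:ℝ) + 1 ≠ 0 := by positivity
  field_simp
  ring

lemma G_hasDerivAt (n : ℕ) (z : ℝ) : HasDerivAt (G n) (- G (n + 1) z) z := by
  have hb : ∀ (ℓ : ℕ) (y : ℝ), HasDerivAt (fun z => gc n ℓ * z ^ ℓ) (gc n ℓ * (ℓ * y ^ (ℓ - 1))) y :=
    fun ℓ y => (hasDerivAt_pow ℓ y).const_mul _
  set r : ℝ := |z| + 1
  have hr : 0 ≤ r := by positivity
  have key := hasDerivAt_tsum_of_isPreconnected (t := Metric.ball (0:ℝ) r)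
    (u := fun ℓ : ℕ => (ℓ : ℝ) * r ^ (ℓ - 1) / (Nat.factorial ℓ : ℝ))
    (g := fun ℓ z => gc n ℓ * z ^ ℓ) (g' := fun ℓ y => gc n ℓ * (ℓ * y ^ (ℓ - 1)))
    (y₀ := 0) (y := z) ?_ Metric.isOpen_ball (convex_ball _ _).isPreconnected
    (fun ℓ y _ => hb ℓ y) ?_ ?_ (summable_G n 0) ?_
  · have : (∑' ℓ : ℕ, gc n ℓ * (ℓ * z ^ (ℓ - 1))) = - G (n + 1) z := by
      have hs : Summable (fun ℓ : ℕ => gc n (ℓ + 1) * (((ℓ + 1 : ℕ) : ℝ) * z ^ (ℓ + 1 - 1))) := by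
        have : (fun ℓ : ℕ => gc n (ℓ + 1) * (((ℓ + 1 : ℕ) : ℝ) * z ^ (ℓ + 1 - 1))) =
            fun ℓ => -(gc (n + 1) ℓ * z ^ ℓ) := by
          ext ℓ
          rw [← mul_assoc, gc_succ]; simp
        rw [this]; exact (summable_G _ z).neg
      have hs' : Summable (fun ℓ : ℕ => gc n ℓ * ((ℓ : ℝ) * z ^ (ℓ - 1))) :=
        (summable_nat_add_iff (f := fun ℓ : ℕ => gc n ℓ * ((ℓ : ℝ) * z ^ (ℓ - 1))) 1).1 hs
      rw [hs'.tsum_eq_zero_add]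
      simp only [Nat.cast_zero, zero_mul, mul_zero, zero_add]
      unfold G
      rw [← tsum_neg]
      congr 1; ext ℓ
      rw [← mul_assoc, gc_succ]; simp
    rw [← this]; exact key
  · rw [← summable_nat_add_iff 1]
    refine (Real.summable_pow_div_factorial r).congr fun ℓ => ?_
    rw [Nat.factorial_succ]; push_cast
    have h1 : (ℓ:ℝ) + 1 ≠ 0 := by positivity
    field_simp
  · intro ℓ y hy
    have hy' : |y| ≤ r := by simpa using (Metric.mem_ball.1 hy).le
    rw [norm_mul, norm_mul, norm_pow, Real.norm_eq_abs, Real.norm_eq_abs, Real.norm_eq_abs, Nat.abs_cast]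
    calc _ ≤ 1 / (Nat.factorial ℓ : ℝ) * ((ℓ : ℝ) * r ^ (ℓ - 1)) := by
          gcongr; exact gc_abs_le n ℓ
      _ = _ := by ring
  · simp; positivity
  · simp [r]

lemma G_continuous (n : ℕ) : Continuous (G n) :=
  continuous_iff_continuousAt.2 fun z => (G_hasDerivAt n z).continuousAt

lemma G_rec (z : ℝ) : z * G 2 z = G 1 z - G 0 z := by
  unfold G
  rw [← (summable_G 1 z).tsum_sub (summable_G 0 z), ← tsum_mul_left]
  have h : ∀ ℓ, gc 1 (ℓ+1) * z ^ (ℓ+1) - gc 0 (ℓ+1) * z ^ (ℓ+1) = z * (gc 2 ℓ * z ^ ℓ) := by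
    intro ℓ
    have : gc 1 (ℓ+1) - gc 0 (ℓ+1) = gc 2 ℓ := by
      unfold gc
      rw [show ℓ + 1 + 1 = (ℓ + 1) + 1 by ring, show ℓ + 2 = (ℓ + 1) + 1 by ring,
        Nat.factorial_succ (ℓ+1), Nat.add_zero, Nat.factorial_succ ℓ]
      push_cast
      have h1 : (ℓ:ℝ) + 1 ≠ 0 := by positivity
      have h2 : (ℓ:ℝ) + 1 + 1 ≠ 0 := by positivity
      field_simp
      ring
    rw [← this]; ring
  rw [((summable_G 1 z).sub (summable_G 0 z)).tsum_eq_zero_add]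
  simp only [h]
  simp [gc]

lemma besselJ0_eq (x : ℝ) : besselJ0 x = G 0 (x ^ 2 / 4) := by
  unfold besselJ0 G gc
  congr 1; ext ℓ
  rw [pow_mul, Nat.add_zero, ← sq]
  congr 2; ring

def P (x : ℝ) : ℝ := G 0 (x ^ 2 / 4)
def Q (x : ℝ) : ℝ := x / 2 * G 1 (x ^ 2 / 4)

lemma P_deriv (x : ℝ) : HasDerivAt P (-Q x) x := by
  have h : HasDerivAt (fun x : ℝ => x ^ 2 / 4) (x / 2) x := by
    refine ((hasDerivAt_pow 2 x).div_const 4).congr_deriv ?_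
    push_cast; ring
  refine ((G_hasDerivAt 0 (x^2/4)).comp x h).congr_deriv ?_
  unfold Q; ring

lemma Q_deriv (x : ℝ) (hx : x ≠ 0) : HasDerivAt Q (P x - Q x / x) x := by
  have h : HasDerivAt (fun x : ℝ => x ^ 2 / 4) (x / 2) x := by
    refine ((hasDerivAt_pow 2 x).div_const 4).congr_deriv ?_
    push_cast; ring
  have h2 := ((hasDerivAt_id x).div_const 2).mul ((G_hasDerivAt 1 (x^2/4)).comp x h)
  refine h2.congr_deriv ?_
  simp only [id, Function.comp]
  unfold P Q
  have := G_rec (x^2/4)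
  have e : x / 2 * (-G (1 + 1) (x ^ 2 / 4) * (x / 2)) = - (x^2/4 * G 2 (x^2/4)) := by ring_nf
  rw [e, this]
  field_simp
  ring

def w (x : ℝ) : ℝ := √x * P x
def w1 (x : ℝ) : ℝ := P x / (2 * √x) - √x * Q x

lemma w_deriv (x : ℝ) (hx : 0 < x) : HasDerivAt w (w1 x) x := by
  refine ((Real.hasDerivAt_sqrt hx.ne').mul (P_deriv x)).congr_deriv ?_
  unfold w1; ring

lemma w1_deriv (x : ℝ) (hx : 0 < x) : HasDerivAt w1 (-(w x) - w x / (4 * x ^ 2)) x := by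
  have hs : √x ≠ 0 := by positivity
  have h1 := (P_deriv x).div ((Real.hasDerivAt_sqrt hx.ne').const_mul 2) (by positivity)
  have h2 := (Real.hasDerivAt_sqrt hx.ne').mul (Q_deriv x hx.ne')
  refine (h1.sub h2).congr_deriv ?_
  unfold w
  have e : x = √x ^ 2 := (Real.sq_sqrt hx.le).symm
  generalize √x = r at *
  generalize P x = p at *
  generalize Q x = q at *
  subst e
  field_simp
  ring

lemma w_bound : ∃ C, 0 < C ∧ ∀ x, 1 ≤ x → |w x| ≤ C ∧ |w1 x| ≤ C := by
  set E : ℝ → ℝ := fun x => (w x ^ 2 + w1 x ^ 2) * Real.exp (1 / (4 * x)) with hE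
  have hd : ∀ x, 0 < x → HasDerivAt E ((2 * w x * w1 x + 2 * w1 x * (-(w x) - w x / (4 * x ^ 2))) *
      Real.exp (1 / (4 * x)) + (w x ^ 2 + w1 x ^ 2) * (Real.exp (1 / (4 * x)) * (-1 / (4 * x ^ 2)))) x := by
    intro x hx
    have h3 : HasDerivAt (fun x : ℝ => 1 / (4 * x)) (-1 / (4 * x ^ 2)) x := by
      have := (hasDerivAt_inv hx.ne').const_mul (1/4)
      refine (this.congr_deriv ?_).congr_of_eventuallyEq (Eventually.of_forall fun y => ?_)
      · field_simp
      · simp; ring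
    refine ((((w_deriv x hx).pow 2).add ((w1_deriv x hx).pow 2)).mul h3.exp).congr_deriv ?_
    simp
  have hanti : AntitoneOn E (Ici 1) := by
    apply antitoneOn_of_deriv_nonpos (convex_Ici 1)
    · intro x hx
      exact (hd x (lt_of_lt_of_le one_pos hx)).continuousAt.continuousWithinAt
    · intro x hx
      rw [interior_Ici] at hx
      exact (hd x (lt_trans one_pos hx)).differentiableAt.differentiableWithinAt
    · intro x hx
      rw [interior_Ici] at hx
      have hx0 : 0 < x := lt_trans one_pos hx
      rw [(hd x hx0).deriv]
      have : (2 * w x * w1 x + 2 * w1 x * (-(w x) - w x / (4 * x ^ 2))) *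
        Real.exp (1 / (4 * x)) + (w x ^ 2 + w1 x ^ 2) * (Real.exp (1 / (4 * x)) * (-1 / (4 * x ^ 2)))
        = - ((w x + w1 x) ^ 2 / (4 * x ^ 2) * Real.exp (1 / (4 * x))) := by
        field_simp; ring
      rw [this]
      have : 0 ≤ (w x + w1 x) ^ 2 / (4 * x ^ 2) * Real.exp (1 / (4 * x)) := by positivity
      linarith
  have hE0 : 0 ≤ E 1 := by simp only [hE]; positivity
  refine ⟨E 1 + 1, by positivity, fun x hx => ?_⟩
  have h1 := hanti (mem_Ici.2 le_rfl) (mem_Ici.2 hx) hx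
  have h2 : w x ^ 2 + w1 x ^ 2 ≤ E x := by
    simp only [hE]
    have : 1 ≤ Real.exp (1 / (4 * x)) := Real.one_le_exp (by positivity)
    nlinarith [sq_nonneg (w x), sq_nonneg (w1 x)]
  constructor <;> apply abs_le_of_sq_le_sq _ (by positivity) <;>
    nlinarith [sq_nonneg (w x), sq_nonneg (w1 x)]

/-- a function with derivative bounded by C/x² has a limit with rate -/
lemma lim_rate (f f' : ℝ → ℝ) (C : ℝ) (hf : ∀ x, 1 ≤ x → HasDerivAt f (f' x) x)
    (hb : ∀ x, 1 ≤ x → |f' x| ≤ C / x ^ 2) : ∃ a, ∀ x, 1 ≤ x → |f x - a| ≤ C / x := by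
  have hd : ∀ x : ℝ, 1 ≤ x → HasDerivAt (fun x : ℝ => C / x) (- C / x ^ 2) x := by
    intro x hx
    have hx0 : x ≠ 0 := by positivity
    refine ((hasDerivAt_inv hx0).const_mul C).congr_deriv ?_
    field_simp
  have hanti : AntitoneOn (fun x => f x + C / x) (Ici 1) := by
    apply antitoneOn_of_deriv_nonpos (convex_Ici 1)
    · intro x hx
      exact ((hf x hx).add (hd x hx)).continuousAt.continuousWithinAt
    · intro x hx
      rw [interior_Ici] at hx
      exact ((hf x hx.le).add (hd x hx.le)).differentiableAt.differentiableWithinAt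
    · intro x hx
      rw [interior_Ici] at hx
      have := ((hf x hx.le).add (hd x hx.le)).deriv
      erw [this]
      have := (abs_le.1 (hb x hx.le)).2
      rw [neg_div]; linarith
  have hmono : MonotoneOn (fun x => f x - C / x) (Ici 1) := by
    apply monotoneOn_of_deriv_nonneg (convex_Ici 1)
    · intro x hx
      exact ((hf x hx).sub (hd x hx)).continuousAt.continuousWithinAt
    · intro x hx
      rw [interior_Ici] at hx
      exact ((hf x hx.le).sub (hd x hx.le)).differentiableAt.differentiableWithinAt
    · intro x hx
      rw [interior_Ici] at hx
      have := ((hf x hx.le).sub (hd x hx.le)).deriv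
      erw [this]
      have := (abs_le.1 (hb x hx.le)).1
      rw [neg_div]; linarith
  have hC : 0 ≤ C := by
    have := (abs_nonneg _).trans (hb 1 le_rfl); simpa using this
  -- a = sup of f - C/x
  have hle : ∀ x y : ℝ, 1 ≤ x → 1 ≤ y → f x - C / x ≤ f y + C / y := by
    intro x y hx hy
    have hm : 1 ≤ max x y := le_max_of_le_left hx
    have a1 := hmono (mem_Ici.2 hx) (mem_Ici.2 hm) (le_max_left x y)
    have a2 := hanti (mem_Ici.2 hy) (mem_Ici.2 hm) (le_max_right x y)
    have : 0 ≤ C / max x y := by positivity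
    simp only at a1 a2
    linarith
  set S : Set ℝ := (fun x => f x - C / x) '' Ici 1
  have hne : S.Nonempty := Set.Nonempty.image _ ⟨1, mem_Ici.2 le_rfl⟩
  refine ⟨sSup S, fun x hx => ?_⟩
  rw [abs_le]
  have b1 : sSup S ≤ f x + C / x := by
    apply csSup_le hne
    rintro _ ⟨y, hy, rfl⟩
    exact hle y x hy hx
  have b2 : f x - C / x ≤ sSup S := by
    refine le_csSup ?_ (mem_image_of_mem _ (mem_Ici.2 hx))
    refine ⟨f 1 + C / 1, ?_⟩
    rintro _ ⟨y, hy, rfl⟩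
    exact hle y 1 hy le_rfl
  constructor <;> linarith

lemma w_asymp : ∃ A B C, 0 < C ∧ ∀ x, 1 ≤ x → |w x - (A * Real.cos x + B * Real.sin x)| ≤ C / x := by
  obtain ⟨C, hC, hw⟩ := w_bound
  have hbd : ∀ (x t : ℝ), 1 ≤ x → |t| ≤ 1 → |w x / (4 * x ^ 2) * t| ≤ C / x ^ 2 := by
    intro x t hx ht
    rw [abs_mul, abs_div, abs_of_pos (by positivity : (0:ℝ) < 4 * x ^ 2)]
    calc |w x| / (4 * x ^ 2) * |t| ≤ C / (4 * x ^ 2) * 1 := by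
          gcongr; exact (hw x hx).1
      _ ≤ C / x ^ 2 := by
          rw [mul_one]; gcongr; nlinarith [sq_nonneg x]
  obtain ⟨A, hA⟩ := lim_rate (fun x => w x * Real.cos x - w1 x * Real.sin x)
    (fun x => w x / (4 * x ^ 2) * Real.sin x) C (fun x hx => by
      have hx0 : 0 < x := by linarith
      refine (((w_deriv x hx0).mul (Real.hasDerivAt_cos x)).sub
        ((w1_deriv x hx0).mul (Real.hasDerivAt_sin x))).congr_deriv ?_
      ring) (fun x hx => hbd x _ hx (Real.abs_sin_le_one x))
  obtain ⟨B, hB⟩ := lim_rate (fun x => w x * Real.sin x + w1 x * Real.cos x)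
    (fun x => w x / (4 * x ^ 2) * (-Real.cos x)) C (fun x hx => by
      have hx0 : 0 < x := by linarith
      refine (((w_deriv x hx0).mul (Real.hasDerivAt_sin x)).add
        ((w1_deriv x hx0).mul (Real.hasDerivAt_cos x))).congr_deriv ?_
      ring) (fun x hx => hbd x _ hx (by rw [abs_neg]; exact Real.abs_cos_le_one x))
  refine ⟨A, B, 2 * C, by positivity, fun x hx => ?_⟩
  have e : w x - (A * Real.cos x + B * Real.sin x) =
      ((w x * Real.cos x - w1 x * Real.sin x) - A) * Real.cos x +
      ((w x * Real.sin x + w1 x * Real.cos x) - B) * Real.sin x := by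
    have := Real.sin_sq_add_cos_sq x
    linear_combination (-w x) * this
  rw [e]
  refine (abs_add_le _ _).trans ?_
  rw [abs_mul, abs_mul]
  have h1 := mul_le_mul (hA x hx) (Real.abs_cos_le_one x) (abs_nonneg _) (by positivity)
  have h2 := mul_le_mul (hB x hx) (Real.abs_sin_le_one x) (abs_nonneg _) (by positivity)
  calc _ ≤ C / x * 1 + C / x * 1 := add_le_add h1 h2
    _ = _ := by ring

lemma P_continuous : Continuous P := (G_continuous 0).comp (by fun_prop)

/-- global asymptotics -/
lemma P_asymp : ∃ A B C, 0 < C ∧ (∀ x, 0 ≤ x → |P x| ≤ C) ∧ (∀ x, 0 < x → |P x| ≤ C / √x) ∧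
    (∀ x, 0 < x → |P x - (A * Real.cos x + B * Real.sin x) / √x| ≤ C / √x) ∧
    (∀ x, 0 < x → |P x - (A * Real.cos x + B * Real.sin x) / √x| ≤ C / (x * √x)) := by
  obtain ⟨A, B, C, hC, h⟩ := w_asymp
  obtain ⟨D, hD⟩ := (isCompact_Icc (a := (0:ℝ)) (b := 1)).exists_bound_of_continuousOn
    P_continuous.continuousOn
  have hD0 : 0 ≤ D := (norm_nonneg _).trans (hD 0 (by simp))
  set S := |A| + |B| with hS
  have hS0 : 0 ≤ S := by positivity
  have htr : ∀ x, |A * Real.cos x + B * Real.sin x| ≤ S := fun x => by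
    refine (abs_add_le _ _).trans ?_
    rw [abs_mul, abs_mul]
    have := mul_le_mul_of_nonneg_left (Real.abs_cos_le_one x) (abs_nonneg A)
    have := mul_le_mul_of_nonneg_left (Real.abs_sin_le_one x) (abs_nonneg B)
    linarith
  have hP : ∀ x, 0 < x → P x - (A * Real.cos x + B * Real.sin x) / √x =
      (w x - (A * Real.cos x + B * Real.sin x)) / √x := by
    intro x hx
    have : √x ≠ 0 := by positivity
    unfold w; field_simp
  -- bound on w for all x > 0
  have hw : ∀ x, 0 < x → |w x| ≤ D + S + C := by
    intro x hx
    rcases le_total x 1 with h1 | h1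
    · have := hD x ⟨hx.le, h1⟩
      unfold w
      rw [abs_mul, abs_of_nonneg (Real.sqrt_nonneg x)]
      have h2 : √x ≤ 1 := Real.sqrt_le_one.2 h1
      rw [Real.norm_eq_abs] at this
      nlinarith [Real.sqrt_nonneg x, abs_nonneg (P x)]
    · have h2 := h x h1
      have h3 : C / x ≤ C := div_le_self hC.le h1
      have h4 := htr x
      have : |w x| ≤ |w x - (A * Real.cos x + B * Real.sin x)| + |A * Real.cos x + B * Real.sin x| := by
        have := abs_add_le (w x - (A * Real.cos x + B * Real.sin x)) (A * Real.cos x + B * Real.sin x)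
        simpa using this
      linarith
  have hwP : ∀ x, 0 < x → P x = w x / √x := by
    intro x hx
    have : √x ≠ 0 := by positivity
    unfold w; field_simp
  have hdiff : ∀ x, 0 < x → |w x - (A * Real.cos x + B * Real.sin x)| ≤ D + S + C + S := by
    intro x hx
    exact (abs_sub _ _).trans (add_le_add (hw x hx) (htr x))
  refine ⟨A, B, D + S + C + S, by positivity, ?_, ?_, ?_, ?_⟩
  · intro x hx
    rcases le_total x 1 with h1 | h1
    · have := hD x ⟨hx, h1⟩
      rw [Real.norm_eq_abs] at this; linarith
    · have hx0 : 0 < x := by linarith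
      rw [hwP x hx0, abs_div, abs_of_nonneg (Real.sqrt_nonneg x)]
      refine (div_le_self (abs_nonneg _) (Real.one_le_sqrt.2 h1)).trans ?_
      linarith [hw x hx0]
  · intro x hx
    rw [hwP x hx, abs_div, abs_of_nonneg (Real.sqrt_nonneg x)]
    gcongr; linarith [hw x hx]
  · intro x hx
    rw [hP x hx, abs_div, abs_of_nonneg (Real.sqrt_nonneg x)]
    gcongr; exact hdiff x hx
  · intro x hx
    rw [hP x hx, abs_div, abs_of_nonneg (Real.sqrt_nonneg x), ← div_div]
    gcongr
    rcases le_total x 1 with h1 | h1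
    · refine (hdiff x hx).trans ?_
      rw [le_div_iff₀ hx]
      nlinarith [show 0 ≤ D + S + C + S by positivity]
    · refine (h x h1).trans ?_
      gcongr; linarith

end WS

namespace WS
open Filter Topology Set

lemma int_inv_sqrt {a b : ℝ} (ha : 0 < a) (hab : a ≤ b) :
    ∫ x in a..b, 1 / √x = 2 * √b - 2 * √a := by
  apply intervalIntegral.integral_eq_sub_of_hasDerivAt (f := fun x => 2 * √x)
  · intro x hx
    rw [uIcc_of_le hab] at hx
    have hx0 : 0 < x := lt_of_lt_of_le ha hx.1
    refine ((Real.hasDerivAt_sqrt hx0.ne').const_mul 2).congr_deriv ?_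
    field_simp
  · apply ContinuousOn.intervalIntegrable
    intro x hx
    rw [uIcc_of_le hab] at hx
    have hx0 : 0 < x := lt_of_lt_of_le ha hx.1
    exact ContinuousAt.continuousWithinAt (by
      have : √x ≠ 0 := by positivity
      fun_prop (disch := assumption))

lemma contOn_of {a b : ℝ} (ha : 0 < a) (hab : a ≤ b) (f : ℝ → ℝ)
    (hf : ∀ x, 0 < x → ContinuousAt f x) : IntervalIntegrable f volume a b := by
  apply ContinuousOn.intervalIntegrable
  intro x hx
  rw [uIcc_of_le hab] at hx
  exact (hf x (lt_of_lt_of_le ha hx.1)).continuousWithinAt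

lemma int_inv_32 {a b : ℝ} (ha : 0 < a) (hab : a ≤ b) :
    ∫ x in a..b, 1 / (x * √x) = 2 / √a - 2 / √b := by
  have : ∫ x in a..b, 1 / (x * √x) = -2 / √b - (-2 / √a) := by
    apply intervalIntegral.integral_eq_sub_of_hasDerivAt (f := fun x => -2 / √x)
    · intro x hx
      rw [uIcc_of_le hab] at hx
      have hx0 : 0 < x := lt_of_lt_of_le ha hx.1
      have hs : √x ≠ 0 := by positivity
      refine ((hasDerivAt_const x (-2:ℝ)).div (Real.hasDerivAt_sqrt hx0.ne') hs).congr_deriv ?_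
      have e : x = √x ^ 2 := (Real.sq_sqrt hx0.le).symm
      generalize √x = r at *
      subst e
      field_simp
      ring
    · apply contOn_of ha hab
      intro x hx
      have h1 : √x ≠ 0 := by positivity
      have h2 : x * √x ≠ 0 := by positivity
      fun_prop (disch := assumption)
  rw [this]; ring

/-- generic bound -/
lemma abs_int_le {a b : ℝ} (ha : 0 < a) (hab : a ≤ b) (f g : ℝ → ℝ)
    (hg : ∀ x, 0 < x → ContinuousAt g x) (h : ∀ x, a ≤ x → |f x| ≤ g x) :
    |∫ x in a..b, f x| ≤ ∫ x in a..b, g x := by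
  have := intervalIntegral.norm_integral_le_of_norm_le (μ := volume) (f := f) (g := g) hab
    (Eventually.of_forall fun x hx => h x hx.1.le) (contOn_of ha hab g hg)
  exact this

lemma osc_aux (φ ψ : ℝ → ℝ) (hφ : ∀ x, |φ x| ≤ 1) (hψ : ∀ x, |ψ x| ≤ 1)
    (hc : Continuous φ) (hd : ∀ x, HasDerivAt ψ (φ x) x) {a b : ℝ} (ha : 0 < a) (hab : a ≤ b) :
    |∫ x in a..b, φ x / √x| ≤ 5 := by
  have hcψ : Continuous ψ := continuous_iff_continuousAt.2 fun x => (hd x).continuousAt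
  have hcφ : ∀ x, 0 < x → ContinuousAt (fun x => φ x / √x) x := fun x hx => by
    have h1 : √x ≠ 0 := by positivity
    fun_prop (disch := assumption)
  have hcψ2 : ∀ x, 0 < x → ContinuousAt (fun x => ψ x / (2 * (x * √x))) x := fun x hx => by
    have h1 : 2 * (x * √x) ≠ 0 := by positivity
    fun_prop (disch := assumption)
  have small : ∀ a b : ℝ, 0 < a → a ≤ b → b ≤ 1 → |∫ x in a..b, φ x / √x| ≤ 2 := by
    intro a b ha hab hb
    refine (abs_int_le ha hab _ (fun x => 1 / √x) ?_ ?_).trans ?_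
    · intro x hx
      have h1 : √x ≠ 0 := by positivity
      fun_prop (disch := assumption)
    · intro x hx
      rw [abs_div, abs_of_nonneg (Real.sqrt_nonneg x)]
      gcongr; exact hφ x
    · rw [int_inv_sqrt ha hab]
      have : √b ≤ 1 := Real.sqrt_le_one.2 hb
      linarith [Real.sqrt_nonneg a]
  have large : ∀ a b : ℝ, 1 ≤ a → a ≤ b → |∫ x in a..b, φ x / √x| ≤ 3 := by
    intro a b ha1 hab
    have ha : 0 < a := by linarith
    have e1 : ∫ x in a..b, (φ x / √x - ψ x / (2 * (x * √x))) = ψ b / √b - ψ a / √a := by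
      apply intervalIntegral.integral_eq_sub_of_hasDerivAt (f := fun x => ψ x / √x)
      · intro x hx
        rw [uIcc_of_le hab] at hx
        have hx0 : 0 < x := lt_of_lt_of_le ha hx.1
        have hs : √x ≠ 0 := by positivity
        refine ((hd x).div (Real.hasDerivAt_sqrt hx0.ne') hs).congr_deriv ?_
        have e : x = √x ^ 2 := (Real.sq_sqrt hx0.le).symm
        generalize φ x = p at *
        generalize ψ x = q at *
        generalize √x = r at *
        subst e
        field_simp
      · exact contOn_of ha hab _ fun x hx => (hcφ x hx).sub (hcψ2 x hx)
    rw [intervalIntegral.integral_sub (contOn_of ha hab _ hcφ) (contOn_of ha hab _ hcψ2)] at e1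
    have e2 : |∫ x in a..b, ψ x / (2 * (x * √x))| ≤ 1 := by
      refine (abs_int_le ha hab _ (fun x => 1 / 2 * (1 / (x * √x))) ?_ ?_).trans ?_
      · intro x hx
        have h1 : x * √x ≠ 0 := by positivity
        fun_prop (disch := assumption)
      · intro x hx
        have hx0 : 0 < x := by linarith
        rw [abs_div, abs_of_pos (show 0 < 2 * (x * √x) by positivity)]
        calc |ψ x| / (2 * (x * √x)) ≤ 1 / (2 * (x * √x)) := by gcongr; exact hψ x
          _ = _ := by field_simp
      · rw [intervalIntegral.integral_const_mul, int_inv_32 ha hab]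
        have h1 : 2 / √a ≤ 2 := div_le_self (by norm_num) (Real.one_le_sqrt.2 ha1)
        have h2 : 0 ≤ 2 / √b := by positivity
        linarith
    have e3 : ∀ x, 1 ≤ x → |ψ x / √x| ≤ 1 := by
      intro x hx
      rw [abs_div, abs_of_nonneg (Real.sqrt_nonneg x)]
      exact (div_le_self (abs_nonneg _) (Real.one_le_sqrt.2 hx)).trans (hψ x)
    have e4 := abs_le.1 (e3 a ha1)
    have e5 := abs_le.1 (e3 b (ha1.trans hab))
    have e6 := abs_le.1 e2
    rw [abs_le]; constructor <;> linarith [e4.1, e4.2, e5.1, e5.2, e6.1, e6.2]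
  rcases le_total b 1 with hb | hb
  · linarith [small a b ha hab hb]
  rcases le_total a 1 with h1 | h1
  · rw [← intervalIntegral.integral_add_adjacent_intervals (contOn_of ha h1 _ hcφ)
      (contOn_of one_pos hb _ hcφ)]
    refine (abs_add_le _ _).trans ?_
    linarith [small a 1 ha h1 le_rfl, large 1 b le_rfl hb]
  · linarith [large a b h1 hab]

lemma osc_scale (φ ψ : ℝ → ℝ) (hφ : ∀ x, |φ x| ≤ 1) (hψ : ∀ x, |ψ x| ≤ 1)
    (hc : Continuous φ) (hd : ∀ x, HasDerivAt ψ (φ x) x) {m R : ℝ} (hm : 0 < m) (hR : 1 ≤ R) :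
    |∫ x in (1:ℝ)..R, φ (m * x) / √x| ≤ 5 / √m := by
  have e : ∫ x in (1:ℝ)..R, φ (m * x) / √x = √m * ∫ x in (1:ℝ)..R, (fun y => φ y / √y) (m * x) := by
    rw [← intervalIntegral.integral_const_mul]
    apply intervalIntegral.integral_congr
    intro x hx
    rw [uIcc_of_le hR] at hx
    have hx0 : 0 < x := by linarith [hx.1]
    simp only
    rw [Real.sqrt_mul hm.le]
    have : √m ≠ 0 := by positivity
    have : √x ≠ 0 := by positivity
    field_simp
  rw [e, intervalIntegral.integral_comp_mul_left (fun y => φ y / √y) hm.ne', abs_mul, smul_eq_mul, abs_mul,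
    abs_of_nonneg (Real.sqrt_nonneg m), abs_inv, abs_of_pos hm]
  have := osc_aux φ ψ hφ hψ hc hd (a := m * 1) (b := m * R) (by linarith) (by gcongr)
  calc √m * (m⁻¹ * |∫ x in m * 1..m * R, φ x / √x|) ≤ √m * (m⁻¹ * 5) := by gcongr
    _ = _ := by
      have e : m = √m ^ 2 := (Real.sq_sqrt hm.le).symm
      have h0 : √m ≠ 0 := by positivity
      generalize √m = r at *
      subst e
      field_simp

lemma osc_cos {m R : ℝ} (hm : m ≠ 0) (hR : 1 ≤ R) :
    |∫ x in (1:ℝ)..R, Real.cos (m * x) / √x| ≤ 5 / √|m| := by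
  have h := osc_scale Real.cos Real.sin Real.abs_cos_le_one Real.abs_sin_le_one Real.continuous_cos
    Real.hasDerivAt_sin (abs_pos.2 hm) hR
  rcases abs_choice m with h1 | h1
  · rw [h1] at h ⊢; exact h
  · rw [h1] at h ⊢; simpa using h

lemma osc_sin {m R : ℝ} (hm : m ≠ 0) (hR : 1 ≤ R) :
    |∫ x in (1:ℝ)..R, Real.sin (m * x) / √x| ≤ 5 / √|m| := by
  have h := osc_scale Real.sin (fun x => -Real.cos x) Real.abs_sin_le_one
    (fun x => by rw [abs_neg]; exact Real.abs_cos_le_one x) Real.continuous_sin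
    (fun x => (Real.hasDerivAt_cos x).neg.congr_deriv (by simp)) (abs_pos.2 hm) hR
  rcases abs_choice m with h1 | h1
  · rw [h1] at h ⊢; exact h
  · rw [h1] at h ⊢; simpa [neg_div] using h

lemma osc_comb (D a b : ℝ) (ha : |a| ≤ D) (hb : |b| ≤ D) {m R : ℝ} (hm : m ≠ 0) (hR : 1 ≤ R) :
    |∫ x in (1:ℝ)..R, (a * (Real.cos (m * x) / √x) + b * (Real.sin (m * x) / √x))| ≤
      10 * D / √|m| := by
  have hi1 : IntervalIntegrable (fun x => a * (Real.cos (m * x) / √x)) volume 1 R :=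
    contOn_of one_pos hR _ fun x hx => by
      have h1 : √x ≠ 0 := by positivity
      fun_prop (disch := assumption)
  have hi2 : IntervalIntegrable (fun x => b * (Real.sin (m * x) / √x)) volume 1 R :=
    contOn_of one_pos hR _ fun x hx => by
      have h1 : √x ≠ 0 := by positivity
      fun_prop (disch := assumption)
  rw [intervalIntegral.integral_add hi1 hi2, intervalIntegral.integral_const_mul,
    intervalIntegral.integral_const_mul]
  refine (abs_add_le _ _).trans ?_
  rw [abs_mul, abs_mul]
  have h1 := mul_le_mul ha (osc_cos hm hR) (abs_nonneg _) ((abs_nonneg _).trans ha)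
  have h2 := mul_le_mul hb (osc_sin hm hR) (abs_nonneg _) ((abs_nonneg _).trans ha)
  calc _ ≤ _ := add_le_add h1 h2
    _ = _ := by ring

lemma int_arctan {c R : ℝ} (hc : 0 < c) (hR : 1 ≤ R) :
    ∫ x in (1:ℝ)..R, 1 / (√(c * x) * (1 + c * x)) ≤ 4 / c := by
  have : ∫ x in (1:ℝ)..R, 1 / (√(c * x) * (1 + c * x)) =
      2 / c * Real.arctan √(c * R) - 2 / c * Real.arctan √(c * 1) := by
    apply intervalIntegral.integral_eq_sub_of_hasDerivAt (f := fun x => 2 / c * Real.arctan √(c * x))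
    · intro x hx
      rw [uIcc_of_le hR] at hx
      have hx0 : 0 < c * x := by have := hx.1; positivity
      have h1 : HasDerivAt (fun x => c * x) c x := by simpa using (hasDerivAt_id x).const_mul c
      refine ((h1.sqrt hx0.ne').arctan.const_mul (2 / c)).congr_deriv ?_
      rw [Real.sq_sqrt hx0.le]
      have : √(c * x) ≠ 0 := by positivity
      field_simp
    · apply contOn_of one_pos hR
      intro x hx
      have h1 : √(c * x) * (1 + c * x) ≠ 0 := by positivity
      fun_prop (disch := assumption)
  rw [this]
  have h1 : Real.arctan √(c * R) ≤ 2 := by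
    linarith [Real.arctan_lt_pi_div_two √(c * R), Real.pi_le_four]
  have h2 : 0 ≤ Real.arctan √(c * 1) := Real.arctan_nonneg.2 (Real.sqrt_nonneg _)
  calc _ ≤ 2 / c * 2 - 0 := by gcongr; positivity
    _ = _ := by ring

/-- the kernel -/
def kap (R y : ℝ) : ℝ := ∫ x in (0:ℝ)..R, x * G 0 (y * x ^ 2 / 4) * P x ^ 2

lemma kap_sq (R c : ℝ) : kap R (c ^ 2) = ∫ x in (0:ℝ)..R, x * P (c * x) * P x ^ 2 := by
  unfold kap P
  congr 1; ext x
  rw [mul_pow]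

lemma kap_bound_c : ∃ C, 0 < C ∧ ∀ R c : ℝ, 1 ≤ R → 0 < c → c ≠ 2 →
    |kap R (c ^ 2)| ≤ C * (1 + 1 / √c + 1 / c + 1 / √c * (1 / √c + 1 / √(c + 2) + 1 / √|c - 2|)) := by
  obtain ⟨A, B, C, hC, hP0, hP1, hr1, hr2⟩ := P_asymp
  set T : ℝ → ℝ := fun x => A * Real.cos x + B * Real.sin x with hT
  set S := |A| + |B| with hS
  have hS0 : 0 ≤ S := by positivity
  have hTS : ∀ x, |T x| ≤ S := fun x => by
    refine (abs_add_le _ _).trans ?_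
    rw [abs_mul, abs_mul]
    have := mul_le_mul_of_nonneg_left (Real.abs_cos_le_one x) (abs_nonneg A)
    have := mul_le_mul_of_nonneg_left (Real.abs_sin_le_one x) (abs_nonneg B)
    linarith
  have hTc : Continuous T := by fun_prop
  set α := (A ^ 2 + B ^ 2) / 2
  set β := (A ^ 2 - B ^ 2) / 2
  set γ := A * B
  obtain ⟨D, hD0, h1, h2, h3, h4, h5, h6⟩ : ∃ D : ℝ, 0 ≤ D ∧ |α * A| ≤ D ∧ |α * B| ≤ D ∧
      |(β * A - γ * B) / 2| ≤ D ∧ |(β * B + γ * A) / 2| ≤ D ∧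
      |(β * A + γ * B) / 2| ≤ D ∧ |(β * B - γ * A) / 2| ≤ D := by
    refine ⟨|α * A| + |α * B| + |(β * A - γ * B) / 2| + |(β * B + γ * A) / 2| +
      |(β * A + γ * B) / 2| + |(β * B - γ * A) / 2|, by positivity, ?_, ?_, ?_, ?_, ?_, ?_⟩ <;>
    linarith [abs_nonneg (α * A), abs_nonneg (α * B), abs_nonneg ((β * A - γ * B) / 2),
      abs_nonneg ((β * B + γ * A) / 2), abs_nonneg ((β * A + γ * B) / 2),
      abs_nonneg ((β * B - γ * A) / 2)]
  -- error for the square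
  have he : ∀ x, 0 < x → |x * P x ^ 2 - T x ^ 2| ≤ C * (C + S) / x := by
    intro x hx
    have hs : √x ≠ 0 := by positivity
    have e : x * P x ^ 2 - T x ^ 2 = x * ((P x - T x / √x) * (P x + T x / √x)) := by
      have e : x = √x ^ 2 := (Real.sq_sqrt hx.le).symm
      generalize P x = p at *
      generalize T x = q at *
      generalize √x = r at *
      subst e
      field_simp
      ring
    rw [e, abs_mul, abs_mul, abs_of_pos hx]
    have b1 := hr2 x hx
    have b2 : |P x + T x / √x| ≤ (C + S) / √x := by
      refine (abs_add_le _ _).trans ?_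
      rw [add_div C S]
      apply add_le_add (hP1 x hx)
      rw [abs_div, abs_of_nonneg (Real.sqrt_nonneg x)]
      gcongr; exact hTS x
    calc x * (|P x - T x / √x| * |P x + T x / √x|) ≤ x * (C / (x * √x) * ((C + S) / √x)) := by
          gcongr
      _ = _ := by
          have e : x = √x ^ 2 := (Real.sq_sqrt hx.le).symm
          generalize √x = r at *
          subst e
          field_simp
  have hrr : ∀ x, 0 < x → |P x - T x / √x| ≤ 2 * C * (1 / (√x * (1 + x))) := by
    intro x hx
    have b1 := hr1 x hx
    have b2 := hr2 x hx
    have hs : 0 < √x := by positivity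
    rw [le_div_iff₀ hs] at b1
    rw [le_div_iff₀ (by positivity)] at b2
    rw [mul_one_div, le_div_iff₀ (by positivity)]
    simp only [hT] at *
    nlinarith
  refine ⟨C ^ 3 + 2 * (C * (C * (C + S))) + 8 * (S ^ 2 * C) + 10 * D, by positivity, ?_⟩
  intro R c hR hc hc2
  have hsc : √c ≠ 0 := by positivity
  have hcont : Continuous (fun x : ℝ => x * P (c * x) * P x ^ 2) := by
    have := P_continuous; fun_prop
  rw [kap_sq, ← intervalIntegral.integral_add_adjacent_intervals
    (hcont.intervalIntegrable 0 1) (hcont.intervalIntegrable 1 R)]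
  -- head
  have t0 : |∫ x in (0:ℝ)..1, x * P (c * x) * P x ^ 2| ≤ C ^ 3 := by
    have := intervalIntegral.norm_integral_le_of_norm_le_const (a := (0:ℝ)) (b := 1) (C := C ^ 3)
      (f := fun x => x * P (c * x) * P x ^ 2) (fun x hx => by
        rw [uIoc_of_le zero_le_one] at hx
        rw [Real.norm_eq_abs, abs_mul, abs_mul, abs_pow, abs_of_pos hx.1]
        have b1 := hP0 (c * x) (by have := hx.1; positivity)
        have b2 := hP0 x hx.1.le
        calc x * |P (c * x)| * |P x| ^ 2 ≤ 1 * C * C ^ 2 := by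
              gcongr; exact hx.2
          _ = _ := by ring)
    simpa using this
  -- decomposition
  have hPc := P_continuous
  have dec : ∀ x, 0 < x → x * P (c * x) * P x ^ 2 = P (c * x) * (x * P x ^ 2 - T x ^ 2) +
      ((P (c * x) - T (c * x) / √(c * x)) * T x ^ 2 +
      1 / √c * ((α * A * (Real.cos (c * x) / √x) + α * B * (Real.sin (c * x) / √x)) +
      (((β * A - γ * B) / 2 * (Real.cos ((c + 2) * x) / √x) +
        (β * B + γ * A) / 2 * (Real.sin ((c + 2) * x) / √x)) +
      ((β * A + γ * B) / 2 * (Real.cos ((c - 2) * x) / √x) +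
        (β * B - γ * A) / 2 * (Real.sin ((c - 2) * x) / √x))))) := by
    intro x hx
    have hs : √x ≠ 0 := by positivity
    have key : T (c * x) * T x ^ 2 =
      ((α * A * (Real.cos (c * x)) + α * B * (Real.sin (c * x))) +
      (((β * A - γ * B) / 2 * (Real.cos ((c + 2) * x)) +
        (β * B + γ * A) / 2 * (Real.sin ((c + 2) * x))) +
      ((β * A + γ * B) / 2 * (Real.cos ((c - 2) * x)) +
        (β * B - γ * A) / 2 * (Real.sin ((c - 2) * x))))) := by
      have e1 : (c + 2) * x = c * x + 2 * x := by ring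
      have e2 : (c - 2) * x = c * x - 2 * x := by ring
      rw [e1, e2, Real.cos_add, Real.sin_add, Real.cos_sub, Real.sin_sub, Real.cos_two_mul,
        Real.sin_two_mul]
      simp only [hT, α, β, γ]
      have := Real.sin_sq_add_cos_sq x
      have e3 : Real.sin x ^ 2 = 1 - Real.cos x ^ 2 := by linarith
      ring_nf
      rw [e3]
      ring
    have e4 : (1:ℝ) / √c * ((α * A * (Real.cos (c * x) / √x) + α * B * (Real.sin (c * x) / √x)) +
      (((β * A - γ * B) / 2 * (Real.cos ((c + 2) * x) / √x) +
        (β * B + γ * A) / 2 * (Real.sin ((c + 2) * x) / √x)) +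
      ((β * A + γ * B) / 2 * (Real.cos ((c - 2) * x) / √x) +
        (β * B - γ * A) / 2 * (Real.sin ((c - 2) * x) / √x)))) = T (c * x) * T x ^ 2 / √(c * x) := by
      rw [key, Real.sqrt_mul hc.le]
      field_simp
    rw [e4]
    have : √(c * x) ≠ 0 := by positivity
    field_simp
    ring
  have i1 : IntervalIntegrable (fun x => P (c * x) * (x * P x ^ 2 - T x ^ 2)) volume 1 R :=
    Continuous.intervalIntegrable (by fun_prop) _ _
  have i2 : IntervalIntegrable (fun x => (P (c * x) - T (c * x) / √(c * x)) * T x ^ 2) volume 1 R :=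
    contOn_of one_pos hR _ fun x hx => by
      have : √(c * x) ≠ 0 := by positivity
      fun_prop (disch := assumption)
  have i3 : ∀ a b m : ℝ, IntervalIntegrable (fun x => a * (Real.cos (m * x) / √x) +
      b * (Real.sin (m * x) / √x)) volume 1 R := fun a b m =>
    contOn_of one_pos hR _ fun x hx => by
      have h1 : √x ≠ 0 := by positivity
      fun_prop (disch := assumption)
  have t1 : |∫ x in (1:ℝ)..R, x * P (c * x) * P x ^ 2| ≤
      2 * (C * (C * (C + S))) * (1 / √c) + (8 * (S ^ 2 * C) * (1 / c) +
      1 / √c * (10 * D / √|c| + (10 * D / √|c + 2| + 10 * D / √|c - 2|))) := by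
    rw [intervalIntegral.integral_congr (g := fun x => _) (fun x hx => dec x (by
      rw [uIcc_of_le hR] at hx; linarith [hx.1]))]
    rw [intervalIntegral.integral_add i1 (i2.add (((i3 _ _ _).add ((i3 _ _ _).add (i3 _ _ _))).const_mul _)),
      intervalIntegral.integral_add i2 ((((i3 _ _ _).add ((i3 _ _ _).add (i3 _ _ _))).const_mul _)),
      intervalIntegral.integral_const_mul,
      intervalIntegral.integral_add (i3 _ _ _) ((i3 _ _ _).add (i3 _ _ _)),
      intervalIntegral.integral_add (i3 _ _ _) (i3 _ _ _)]
    refine (abs_add_le _ _).trans (add_le_add ?_ ((abs_add_le _ _).trans (add_le_add ?_ ?_)))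
    · refine (abs_int_le one_pos hR _ (fun x => C * (C * (C + S)) / √c * (1 / (x * √x))) ?_ ?_).trans ?_
      · intro x hx
        have h1 : x * √x ≠ 0 := by positivity
        fun_prop (disch := assumption)
      · intro x hx
        have hx0 : 0 < x := by linarith
        rw [abs_mul]
        calc |P (c * x)| * |x * P x ^ 2 - T x ^ 2| ≤ C / √(c * x) * (C * (C + S) / x) := by
              gcongr
              · exact hP1 (c * x) (by positivity)
              · exact he x hx0
          _ = _ := by
              rw [Real.sqrt_mul hc.le]
              have h1 : √x ≠ 0 := by positivity
              field_simp
      · rw [intervalIntegral.integral_const_mul, int_inv_32 one_pos hR]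
        have h2 : 0 ≤ 2 / √R := by positivity
        calc _ ≤ C * (C * (C + S)) / √c * 2 := by
              gcongr; simpa using h2
          _ = _ := by ring
    · refine (abs_int_le one_pos hR _ (fun x => S ^ 2 * (2 * C) * (1 / (√(c * x) * (1 + c * x)))) ?_ ?_).trans ?_
      · intro x hx
        have h1 : √(c * x) * (1 + c * x) ≠ 0 := by positivity
        fun_prop (disch := assumption)
      · intro x hx
        have hx0 : 0 < c * x := by positivity
        rw [abs_mul, abs_pow]
        calc _ ≤ 2 * C * (1 / (√(c * x) * (1 + c * x))) * S ^ 2 := by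
              gcongr
              · exact hrr (c * x) hx0
              · exact hTS x
          _ = _ := by ring
      · rw [intervalIntegral.integral_const_mul]
        calc _ ≤ S ^ 2 * (2 * C) * (4 / c) := by
              gcongr; exact int_arctan hc hR
          _ = _ := by ring
    · rw [abs_mul, abs_of_pos (by positivity : 0 < 1 / √c)]
      gcongr
      refine (abs_add_le _ _).trans (add_le_add (osc_comb D _ _ h1 h2 hc.ne' hR)
        ((abs_add_le _ _).trans (add_le_add (osc_comb D _ _ h3 h4 (by positivity) hR)
         (osc_comb D _ _ h5 h6 (sub_ne_zero.2 hc2) hR))))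
  refine (abs_add_le _ _).trans ((add_le_add t0 t1).trans ?_)
  rw [abs_of_pos hc, abs_of_pos (by positivity : 0 < c + 2)]
  have q1 : 0 ≤ 1 / √c := by positivity
  have q2 : 0 ≤ 1 / c := by positivity
  have q3 : 0 ≤ 1 / √c * (1 / √c + 1 / √(c + 2) + 1 / √|c - 2|) := by positivity
  have q4 : 1 / √c * (10 * D / √c + (10 * D / √(c + 2) + 10 * D / √|c - 2|)) =
    10 * D * (1 / √c * (1 / √c + 1 / √(c + 2) + 1 / √|c - 2|)) := by ring
  rw [q4]
  generalize 1 / √c * (1 / √c + 1 / √(c + 2) + 1 / √|c - 2|) = z3 at *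
  generalize 1 / √c = z1 at *
  generalize 1 / c = z2 at *
  have n1 : 0 ≤ C ^ 3 := by positivity
  have n2 : 0 ≤ 2 * (C * (C * (C + S))) := by positivity
  have n3 : 0 ≤ 8 * (S ^ 2 * C) := by positivity
  have n4 : 0 ≤ 10 * D := by positivity
  generalize C ^ 3 = k1 at *
  generalize 2 * (C * (C * (C + S))) = k2 at *
  generalize 8 * (S ^ 2 * C) = k3 at *
  generalize 10 * D = k4 at *
  have := mul_nonneg n1 q1
  have := mul_nonneg n1 q2
  have := mul_nonneg n1 q3
  have := mul_nonneg n2 q2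
  have := mul_nonneg n2 q3
  have := mul_nonneg n3 q1
  have := mul_nonneg n3 q3
  have := mul_nonneg n4 q1
  have := mul_nonneg n4 q2
  nlinarith

def Mw (y : ℝ) : ℝ := 1 + 1 / √y + 1 / √|y - 4|

lemma prod_le (y : ℝ) (hy : 0 < y) (hy4 : y ≠ 4) : 1 / √y * (1 / √|y - 4|) ≤ 1 / √y + 1 / √|y - 4| := by
  have h4 : 0 < |y - 4| := abs_pos.2 (sub_ne_zero.2 hy4)
  have p1 : 0 ≤ 1 / √y := by positivity
  have p2 : 0 ≤ 1 / √|y - 4| := by positivity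
  rcases le_total 1 y with h | h
  · have : 1 / √y ≤ 1 := (div_le_one (by positivity)).2 (Real.one_le_sqrt.2 h)
    nlinarith
  · have : 1 / √|y - 4| ≤ 1 := by
      apply (div_le_one (by positivity)).2 (Real.one_le_sqrt.2 _)
      rw [abs_of_neg (by linarith)]; linarith
    nlinarith

lemma kap_bound : ∃ C, 0 < C ∧ ∀ R y : ℝ, 1 ≤ R → 0 < y → y ≠ 4 → |kap R y| ≤ C * Mw y := by
  obtain ⟨C, hC, h⟩ := kap_bound_c
  refine ⟨C * 20, by positivity, fun R y hR hy hy4 => ?_⟩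
  set c := √y with hc
  have hc0 : 0 < c := by positivity
  have hyc : y = c ^ 2 := (Real.sq_sqrt hy.le).symm
  have hc2 : c ≠ 2 := by rintro h2; apply hy4; rw [hyc, h2]; norm_num
  have := h R c hR hc0 hc2
  rw [← hyc] at this
  refine this.trans ?_
  rw [mul_assoc]
  gcongr
  have hpr := prod_le y hy hy4
  unfold Mw
  rw [← hc] at hpr ⊢
  -- √c facts
  set d := √c with hd
  have hd0 : 0 < d := by positivity
  have hcd : c = d ^ 2 := (Real.sq_sqrt hc0.le).symm
  have habs : |y - 4| = |c - 2| * (c + 2) := by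
    rw [hyc, show c ^ 2 - 4 = (c - 2) * (c + 2) by ring, abs_mul,
      abs_of_pos (by positivity : 0 < c + 2)]
  have hsq : √|y - 4| = √|c - 2| * √(c + 2) := by
    rw [habs, Real.sqrt_mul (abs_nonneg _)]
  have hp : 0 < √|c - 2| := Real.sqrt_pos.2 (abs_pos.2 (sub_ne_zero.2 hc2))
  set p := √|c - 2|
  have hq2 : √(c + 2) ^ 2 = c + 2 := Real.sq_sqrt (by positivity)
  have hq : 0 < √(c + 2) := by positivity
  have hq1 : 1 ≤ √(c + 2) := Real.one_le_sqrt.2 (by linarith)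
  set q := √(c + 2)
  set t := 1 / √|y - 4| with ht
  have ht0 : 0 ≤ t := by positivity
  have htp : 1 / p = q * t := by rw [ht, hsq]; field_simp
  have hinv : 1 / d ≤ 1 + 1 / c := by
    rw [hcd, show 1 / d ^ 2 = (1 / d) ^ 2 by rw [div_pow, one_pow]]
    nlinarith [sq_nonneg (1 / d - 1), sq_nonneg (1 / d)]
  have hqd : 1 / d * q ≤ 3 + 2 * (1 / c) := by
    have : q ≤ d + 2 := by
      apply (abs_le_of_sq_le_sq' _ (by positivity)).2
      nlinarith
    calc 1 / d * q ≤ 1 / d * (d + 2) := by gcongr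
      _ = 1 + 2 * (1 / d) := by field_simp
      _ ≤ _ := by linarith
  have hdd : 1 / d * (1 / d) = 1 / c := by rw [hcd]; field_simp
  have hic : 0 ≤ 1 / c := by positivity
  have hid : 0 ≤ 1 / d := by positivity
  have e1 : 1 / d * (1 / q) ≤ 1 / d := by
    have : 1 / q ≤ 1 := (div_le_one hq).2 hq1
    nlinarith
  have e2 : 1 / d * (1 / p) ≤ (3 + 2 * (1 / c)) * t := by
    rw [htp, ← mul_assoc]; gcongr
  have e3 : 1 / d * (1 / d + 1 / q + 1 / p) = 1 / d * (1 / d) + 1 / d * (1 / q) + 1 / d * (1 / p) := by ring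
  rw [e3, hdd]
  nlinarith

end WS

namespace WS
open Filter Topology Set

lemma gc0 (ℓ : ℕ) : gc 0 ℓ = (-1) ^ ℓ / ((Nat.factorial ℓ : ℝ) * (Nat.factorial ℓ : ℝ)) := by
  simp [gc]

lemma int_pow_exp (p : ℝ) (hp : 0 < p) (ℓ : ℕ) :
    IntegrableOn (fun y : ℝ => Real.exp (-(p * y)) * y ^ ℓ) (Ioi 0) ∧
    ∫ y in Ioi (0:ℝ), Real.exp (-(p * y)) * y ^ ℓ = (Nat.factorial ℓ : ℝ) / p ^ (ℓ + 1) := by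
  have e : ∀ y ∈ Ioi (0:ℝ), y ^ ((ℓ:ℝ) + 1 - 1) * Real.exp (-(p * y)) =
      Real.exp (-(p * y)) * y ^ ℓ := by
    intro y hy
    rw [add_sub_cancel_right, Real.rpow_natCast, mul_comm]
  have h := Real.integral_rpow_mul_exp_neg_mul_Ioi (a := (ℓ:ℝ) + 1) (r := p) (by positivity) hp
  rw [setIntegral_congr_fun measurableSet_Ioi e, Real.Gamma_nat_eq_factorial,
    show (ℓ:ℝ) + 1 = ((ℓ + 1 : ℕ) : ℝ) by push_cast; ring, Real.rpow_natCast] at h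
  have h2 : ∫ y in Ioi (0:ℝ), Real.exp (-(p * y)) * y ^ ℓ = (Nat.factorial ℓ : ℝ) / p ^ (ℓ + 1) := by
    rw [h, div_pow, one_pow]; ring
  refine ⟨?_, h2⟩
  by_contra hn
  have := integral_undef hn
  rw [this] at h2
  have : (0:ℝ) < (Nat.factorial ℓ : ℝ) / p ^ (ℓ + 1) := by positivity
  linarith

lemma gauss (p : ℝ) (hp : 0 < p) (z : ℝ) :
    ∫ y in Ioi (0:ℝ), Real.exp (-(p * y)) * G 0 (y * z) = 1 / p * Real.exp (-(z / p)) := by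
  have e : ∀ (ℓ : ℕ) (y : ℝ), Real.exp (-(p * y)) * (gc 0 ℓ * (y * z) ^ ℓ) =
      (gc 0 ℓ * z ^ ℓ) * (Real.exp (-(p * y)) * y ^ ℓ) := by
    intro ℓ y; rw [mul_pow]; ring
  have h := hasSum_integral_of_summable_integral_norm (μ := volume.restrict (Ioi (0:ℝ)))
    (F := fun ℓ y => Real.exp (-(p * y)) * (gc 0 ℓ * (y * z) ^ ℓ)) ?_ ?_
  · simp only [tsum_mul_left] at h
    change HasSum _ (∫ y in Ioi (0:ℝ), Real.exp (-(p * y)) * G 0 (y * z)) at h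
    refine h.unique ?_
    simp only [e, integral_const_mul]
    have h1 : HasSum (fun ℓ : ℕ => (-(z / p)) ^ ℓ / (Nat.factorial ℓ : ℝ)) (Real.exp (-(z / p))) := by
      rw [Real.exp_eq_exp_ℝ]; exact NormedSpace.expSeries_div_hasSum_exp _
    refine (h1.mul_left (1 / p)).congr_fun ?_ |> fun h => h
    intro ℓ
    rw [(int_pow_exp p hp ℓ).2, gc0]
    have : (Nat.factorial ℓ : ℝ) ≠ 0 := by positivity
    rw [neg_pow (z / p), div_pow]
    field_simp
    try ring
  · intro ℓ
    simp only [e]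
    exact (int_pow_exp p hp ℓ).1.const_mul _
  · have e2 : ∀ ℓ : ℕ, ∫ y in Ioi (0:ℝ), ‖Real.exp (-(p * y)) * (gc 0 ℓ * (y * z) ^ ℓ)‖ =
        (|z| / p) ^ ℓ / (Nat.factorial ℓ : ℝ) * (1 / p) := by
      intro ℓ
      have : ∀ y ∈ Ioi (0:ℝ), ‖Real.exp (-(p * y)) * (gc 0 ℓ * (y * z) ^ ℓ)‖ =
          (|gc 0 ℓ| * |z| ^ ℓ) * (Real.exp (-(p * y)) * y ^ ℓ) := by
        intro y hy
        rw [e, norm_mul, norm_mul, norm_mul, norm_pow, norm_pow, Real.norm_eq_abs, Real.norm_eq_abs,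
          Real.norm_eq_abs, Real.norm_eq_abs, abs_of_pos (Real.exp_pos _), abs_of_pos (show (0:ℝ) < y from hy)]
      rw [setIntegral_congr_fun measurableSet_Ioi this, integral_const_mul, (int_pow_exp p hp ℓ).2, gc0,
        abs_div, abs_pow, abs_neg, abs_one, one_pow, abs_of_pos (by positivity)]
      have : (Nat.factorial ℓ : ℝ) ≠ 0 := by positivity
      rw [div_pow]
      field_simp
      try ring
    simp only [e2]
    exact (Real.summable_pow_div_factorial _).mul_right _

lemma beta_scaled (ν u : ℝ) (hν : 0 < ν) (hu : 0 < u) (ℓ : ℕ) :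
    ∫ y in (0:ℝ)..u, (u - y) ^ (ν - 1) * y ^ ℓ =
      u ^ (ν + ℓ) * ((Nat.factorial ℓ : ℝ) * Real.Gamma ν / Real.Gamma (ν + ℓ + 1)) := by
  have h := Complex.betaIntegral_scaled ((ℓ:ℂ) + 1) (ν:ℂ) hu
  rw [Complex.betaIntegral_eq_Gamma_mul_div _ _ (by simp; positivity) (by simpa using hν)] at h
  have e : ∫ x in (0:ℝ)..u, (x:ℂ) ^ ((ℓ:ℂ) + 1 - 1) * ((u:ℂ) - x) ^ ((ν:ℂ) - 1) =
      ((∫ y in (0:ℝ)..u, (u - y) ^ (ν - 1) * y ^ ℓ : ℝ) : ℂ) := by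
    rw [← intervalIntegral.integral_ofReal]
    apply intervalIntegral.integral_congr
    intro y hy
    rw [uIcc_of_le hu.le] at hy
    simp only
    rw [add_sub_cancel_right, Complex.cpow_natCast, Complex.ofReal_mul,
      Complex.ofReal_cpow (by linarith [hy.2])]
    push_cast; ring
  rw [e] at h
  have : ((ℓ:ℂ) + 1 + ν - 1) = ((ν + ℓ : ℝ) : ℂ) := by push_cast; ring
  rw [this, Complex.Gamma_nat_eq_factorial, Complex.Gamma_ofReal,
    show (ℓ:ℂ) + 1 + ν = ((ν + ℓ + 1 : ℝ) : ℂ) by push_cast; ring, Complex.Gamma_ofReal,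
    ← Complex.ofReal_cpow hu.le] at h
  exact_mod_cast h

lemma int_pow_sub (ν u : ℝ) (hν : 0 < ν) : 
    IntervalIntegrable (fun y => (u - y) ^ (ν - 1)) volume 0 u := by
  have := (intervalIntegral.intervalIntegrable_rpow' (a := 0) (b := u) (r := ν - 1) (by linarith)).comp_sub_left u
  simpa using this.symm

lemma sonine (ν u x : ℝ) (hν : 0 < ν) (hu : 0 < u) (hx : 0 < x) :
    besselJ ν (√u * x) = 2 ^ (-ν) * u ^ (-ν / 2) * x ^ ν / Real.Gamma ν *
      ∫ y in (0:ℝ)..u, (u - y) ^ (ν - 1) * G 0 (y * x ^ 2 / 4) := by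
  have hG := Real.Gamma_pos_of_pos hν
  have h := intervalIntegral.hasSum_integral_of_dominated_convergence (μ := volume) (a := 0) (b := u)
    (F := fun ℓ y => (u - y) ^ (ν - 1) * (gc 0 ℓ * (y * x ^ 2 / 4) ^ ℓ))
    (f := fun y => (u - y) ^ (ν - 1) * G 0 (y * x ^ 2 / 4))
    (fun ℓ y => (u - y) ^ (ν - 1) * ((u * x ^ 2 / 4) ^ ℓ / (Nat.factorial ℓ : ℝ)))
    ?_ ?_ ?_ ?_ ?_
  · rw [← h.tsum_eq, ← tsum_mul_left]
    unfold besselJ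
    congr 1; ext ℓ
    have e : ∀ y : ℝ, (u - y) ^ (ν - 1) * (gc 0 ℓ * (y * x ^ 2 / 4) ^ ℓ) =
        (gc 0 ℓ * (x ^ 2 / 4) ^ ℓ) * ((u - y) ^ (ν - 1) * y ^ ℓ) := by
      intro y; rw [mul_div_assoc, mul_pow]; ring
    simp only [e]
    rw [intervalIntegral.integral_const_mul, beta_scaled ν u hν hu, gc0]
    have hG2 : 0 < Real.Gamma (ν + ℓ + 1) := Real.Gamma_pos_of_pos (by positivity)
    have hp : (√u * x / 2) ^ (2 * (ℓ:ℝ) + ν) =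
        2 ^ (-ν) * u ^ (-ν / 2) * x ^ ν * ((x ^ 2 / 4) ^ ℓ * u ^ (ν + ℓ)) := by
      rw [Real.rpow_add (by positivity), Real.div_rpow (by positivity) (by norm_num),
        Real.mul_rpow (by positivity) hx.le, Real.div_rpow (by positivity) (by norm_num),
        Real.mul_rpow (by positivity) hx.le, Real.sqrt_eq_rpow, ← Real.rpow_mul hu.le,
        ← Real.rpow_mul hu.le, Real.rpow_neg (by norm_num), div_pow, ← pow_mul,
        show (4:ℝ) = 2 ^ 2 by norm_num, ← pow_mul,
        show 2 * (ℓ:ℝ) = ((2 * ℓ : ℕ) : ℝ) by push_cast; ring, Real.rpow_natCast, Real.rpow_natCast]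
      have : u ^ (1 / 2 * ((2 * ℓ : ℕ) : ℝ)) * u ^ (1 / 2 * ν) = u ^ (-ν / 2) * u ^ (ν + ℓ) := by
        rw [← Real.rpow_add hu, ← Real.rpow_add hu]
        congr 1; push_cast; ring
      have h2 : (0:ℝ) < 2 ^ ν := by positivity
      generalize u ^ (1 / 2 * ((2 * ℓ : ℕ) : ℝ)) = a1 at *
      generalize u ^ (1 / 2 * ν) = a2 at *
      generalize u ^ (-ν / 2) = a3 at *
      generalize u ^ (ν + ℓ) = a4 at *
      generalize (2:ℝ) ^ ν = b at *
      generalize x ^ (2 * ℓ) = c at *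
      generalize x ^ ν = d at *
      generalize hq : (2:ℝ) ^ (2 * ℓ) = q at *
      have hq0 : q ≠ 0 := by rw [← hq]; positivity
      field_simp
      linear_combination (c * d) * this
    rw [hp]
    have : (Nat.factorial ℓ : ℝ) ≠ 0 := by positivity
    field_simp
  · intro ℓ
    apply Measurable.aestronglyMeasurable
    fun_prop
  · intro ℓ
    refine Eventually.of_forall fun y hy => ?_
    rw [uIoc_of_le hu.le] at hy
    have h1 : 0 ≤ (u - y) ^ (ν - 1) := Real.rpow_nonneg (by linarith [hy.2]) _
    rw [norm_mul, Real.norm_eq_abs, abs_of_nonneg h1]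
    gcongr
    refine (gc_term_le _ _ _).trans ?_
    have := hy.1
    rw [abs_of_nonneg (by positivity)]
    gcongr; exact hy.2
  · exact Eventually.of_forall fun y hy => (Real.summable_pow_div_factorial _).mul_left _
  · simp only [tsum_mul_left]
    exact (int_pow_sub ν u hν).mul_const _
  · exact Eventually.of_forall fun y hy => (summable_G 0 _).hasSum.mul_left _

lemma sin_half_pow (ℓ : ℕ) : ∫ φ in (0:ℝ)..π, Real.sin (φ / 2) ^ (2 * ℓ) =
    π * ((Nat.centralBinom ℓ : ℝ) / 4 ^ ℓ) := by
  have h1 : ∫ φ in (0:ℝ)..π, Real.sin (φ / 2) ^ (2 * ℓ) = ∫ φ in (0:ℝ)..π, Real.cos (φ / 2) ^ (2 * ℓ) := by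
    have := intervalIntegral.integral_comp_sub_left (a := 0) (b := π)
      (fun φ : ℝ => Real.sin (φ / 2) ^ (2 * ℓ)) π
    simp only [sub_self, sub_zero] at this
    rw [← this]
    congr 1; ext φ
    rw [sub_div, Real.sin_pi_div_two_sub]
  have h2 := intervalIntegral.integral_comp_div (a := 0) (b := π)
      (fun φ : ℝ => Real.cos φ ^ (2 * ℓ)) (c := 2) (by norm_num)
  rw [h1, h2, zero_div, EulerSine.integral_cos_pow_eq, integral_sin_pow_even, smul_eq_mul,
    ← mul_assoc, mul_one_div_cancel (by norm_num), one_mul]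
  congr 1
  induction ℓ with
  | zero => simp
  | succ k ih =>
    have h1 : ∫ φ in (0:ℝ)..π, Real.sin (φ / 2) ^ (2 * k) = ∫ φ in (0:ℝ)..π, Real.cos (φ / 2) ^ (2 * k) := by
      have := intervalIntegral.integral_comp_sub_left (a := 0) (b := π)
        (fun φ : ℝ => Real.sin (φ / 2) ^ (2 * k)) π
      simp only [sub_self, sub_zero] at this
      rw [← this]
      congr 1; ext φ
      rw [sub_div, Real.sin_pi_div_two_sub]
    have h2 := intervalIntegral.integral_comp_div (a := 0) (b := π)
      (fun φ : ℝ => Real.cos φ ^ (2 * k)) (c := 2) (by norm_num)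
    rw [Finset.prod_range_succ, ih h1 h2]
    have h3 : ((k:ℝ) + 1) * (Nat.centralBinom (k + 1) : ℝ) = 2 * (2 * k + 1) * Nat.centralBinom k := by
      exact_mod_cast Nat.succ_mul_centralBinom_succ k
    have h4 : (Nat.centralBinom (k + 1) : ℝ) = 2 * (2 * k + 1) * Nat.centralBinom k / (k + 1) := by
      rw [eq_div_iff (by positivity)]; linarith
    rw [h4, pow_succ]
    field_simp
    ring

lemma gc_conv (n : ℕ) : ∑ kl ∈ Finset.HasAntidiagonal.antidiagonal n, gc 0 kl.1 * gc 0 kl.2 =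
    gc 0 n * (Nat.centralBinom n : ℝ) := by
  have h : (Nat.centralBinom n : ℝ) = ∑ kl ∈ Finset.HasAntidiagonal.antidiagonal n, ((n.choose kl.1 : ℝ) * (n.choose kl.2 : ℝ)) := by
    rw [Nat.centralBinom, two_mul, Nat.add_choose_eq]; push_cast; rfl
  rw [h, Finset.mul_sum]
  apply Finset.sum_congr rfl
  rintro ⟨i, j⟩ hij
  rw [Finset.HasAntidiagonal.mem_antidiagonal] at hij
  simp only at hij ⊢
  subst hij
  have a1 : (((i + j).choose i : ℕ) : ℝ) = (Nat.factorial (i + j) : ℝ) / ((Nat.factorial i : ℝ) * Nat.factorial j) := by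
    rw [eq_div_iff (by positivity), ← mul_assoc]
    rw [Nat.choose_symm_add]
    exact_mod_cast Nat.add_choose_mul_factorial_mul_factorial i j
  have a2 : (((i + j).choose j : ℕ) : ℝ) = (Nat.factorial (i + j) : ℝ) / ((Nat.factorial i : ℝ) * Nat.factorial j) := by
    rw [← a1, Nat.choose_symm_add]
  rw [a1, a2, gc0, gc0, gc0]
  have : (Nat.factorial (i + j) : ℝ) ≠ 0 := by positivity
  field_simp
  ring

lemma P_sq (x : ℝ) : P x ^ 2 = 1 / π * ∫ φ in (0:ℝ)..π, G 0 (4 * Real.sin (φ / 2) ^ 2 * x ^ 2 / 4) := by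
  have hπ := Real.pi_pos
  have h := intervalIntegral.hasSum_integral_of_dominated_convergence (μ := volume) (a := 0) (b := π)
    (F := fun ℓ φ => gc 0 ℓ * (4 * Real.sin (φ / 2) ^ 2 * x ^ 2 / 4) ^ ℓ)
    (f := fun φ => G 0 (4 * Real.sin (φ / 2) ^ 2 * x ^ 2 / 4))
    (fun ℓ y => ((x ^ 2) ^ ℓ / (Nat.factorial ℓ : ℝ)))
    ?_ ?_ ?_ ?_ ?_
  · rw [← h.tsum_eq, ← tsum_mul_left, sq]
    unfold P G
    rw [tsum_mul_tsum_eq_tsum_sum_antidiagonal_of_summable_norm (summable_G_norm 0 _) (summable_G_norm 0 _)]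
    congr 1; ext ℓ
    have e : ∀ φ : ℝ, gc 0 ℓ * (4 * Real.sin (φ / 2) ^ 2 * x ^ 2 / 4) ^ ℓ =
        gc 0 ℓ * (x ^ 2) ^ ℓ * Real.sin (φ / 2) ^ (2 * ℓ) := by
      intro φ
      rw [show 4 * Real.sin (φ / 2) ^ 2 * x ^ 2 / 4 = x ^ 2 * Real.sin (φ / 2) ^ 2 by ring, mul_pow, pow_mul]
      ring
    simp only [e]
    rw [intervalIntegral.integral_const_mul, sin_half_pow]
    have e2 : ∑ kl ∈ Finset.HasAntidiagonal.antidiagonal ℓ, gc 0 kl.1 * (x ^ 2 / 4) ^ kl.1 * (gc 0 kl.2 * (x ^ 2 / 4) ^ kl.2) =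
        (∑ kl ∈ Finset.HasAntidiagonal.antidiagonal ℓ, gc 0 kl.1 * gc 0 kl.2) * (x ^ 2 / 4) ^ ℓ := by
      rw [Finset.sum_mul]
      apply Finset.sum_congr rfl
      rintro ⟨i, j⟩ hij
      rw [Finset.HasAntidiagonal.mem_antidiagonal] at hij
      simp only at hij ⊢
      rw [← hij, pow_add]; ring
    rw [e2, gc_conv, div_pow]
    field_simp
  · intro ℓ
    apply Measurable.aestronglyMeasurable
    fun_prop
  · intro ℓ
    refine Eventually.of_forall fun φ hφ => (gc_term_le _ _ _).trans ?_
    rw [abs_of_nonneg (by positivity)]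
    gcongr
    nlinarith [Real.sin_sq_le_one (φ / 2), sq_nonneg x]
  · exact Eventually.of_forall fun y hy => (Real.summable_pow_div_factorial _)
  · exact continuous_const.intervalIntegrable _ _
  · exact Eventually.of_forall fun y hy => (summable_G 0 _).hasSum

end WS

namespace WS
open Filter Topology Set

lemma int_abs0 (c : ℝ) : IntervalIntegrable (fun y : ℝ => 1 / √|y|) volume 0 c := by
  have key : ∀ c : ℝ, 0 ≤ c → IntervalIntegrable (fun y : ℝ => 1 / √|y|) volume 0 c := by
    intro c hc
    refine (intervalIntegral.intervalIntegrable_rpow' (a := 0) (b := c) (r := -(1/2)) (by norm_num)).congr ?_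
    intro y hy
    rw [uIoc_of_le hc] at hy
    simp only
    rw [Real.rpow_neg hy.1.le, abs_of_pos hy.1, Real.sqrt_eq_rpow]
    norm_num
  rcases le_total 0 c with h | h
  · exact key c h
  · have := (key (-c) (by linarith)).comp_sub_left 0
    simpa using this

lemma int_abs (a b c : ℝ) : IntervalIntegrable (fun y : ℝ => 1 / √|y - a|) volume b c := by
  have := ((int_abs0 (b - a)).symm.trans (int_abs0 (c - a))).comp_sub_right a
  simpa using this

lemma Mw_pos (y : ℝ) : 1 ≤ Mw y := by
  unfold Mw
  have : 0 ≤ 1 / √y := by positivity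
  have : 0 ≤ 1 / √|y - 4| := by positivity
  linarith

lemma Mw_meas : Measurable Mw := by
  unfold Mw; fun_prop

lemma int_exp_abs (a p : ℝ) (ha : 0 ≤ a) (hp : 0 < p) : IntegrableOn (fun y : ℝ => Real.exp (-(p * y)) * (1 / √|y - a|)) (Ioi 0) := by
  have h0 : (0:ℝ) ≤ a + 1 := by linarith
  have he : IntegrableOn (fun y : ℝ => Real.exp (-(p * y))) (Ioi 0) := by
    simpa using (int_pow_exp p hp 0).1
  rw [← Ioc_union_Ioi_eq_Ioi h0]
  refine IntegrableOn.union ?_ ?_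
  · have h := (intervalIntegrable_iff_integrableOn_Ioc_of_le h0).1 (int_abs a 0 (a + 1))
    refine Integrable.mono' h (by fun_prop) ?_
    filter_upwards [ae_restrict_mem measurableSet_Ioc] with y hy
    rw [norm_mul, Real.norm_eq_abs, Real.norm_eq_abs, abs_of_pos (Real.exp_pos _),
      abs_of_nonneg (by positivity : 0 ≤ 1 / √|y - a|)]
    have h1 : Real.exp (-(p * y)) ≤ 1 := by
      apply Real.exp_le_one_iff.2
      have := mul_pos hp hy.1
      linarith
    have h2 : 0 ≤ 1 / √|y - a| := by positivity
    nlinarith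
  · refine Integrable.mono' (he.mono_set (Ioi_subset_Ioi h0)) (by fun_prop) ?_
    filter_upwards [ae_restrict_mem measurableSet_Ioi] with y hy
    have hy : a + 1 < y := hy
    rw [norm_mul, Real.norm_eq_abs, Real.norm_eq_abs, abs_of_pos (Real.exp_pos _),
      abs_of_nonneg (by positivity : 0 ≤ 1 / √|y - a|)]
    have h1 : 1 ≤ √|y - a| := by
      rw [Real.one_le_sqrt, abs_of_pos (by linarith)]; linarith
    have h2 : 1 / √|y - a| ≤ 1 := by
      rw [div_le_one (by linarith)]; exact h1
    have := Real.exp_pos (-(p * y))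
    nlinarith

lemma int_exp_Mw (p : ℝ) (hp : 0 < p) : IntegrableOn (fun y : ℝ => Real.exp (-(p * y)) * Mw y) (Ioi 0) := by
  have he : IntegrableOn (fun y : ℝ => Real.exp (-(p * y))) (Ioi 0) := by
    simpa using (int_pow_exp p hp 0).1
  have h0 := int_exp_abs 0 p le_rfl hp
  have h4 := int_exp_abs 4 p (by norm_num) hp
  refine ((he.add h0).add h4).congr ?_
  filter_upwards [ae_restrict_mem measurableSet_Ioi] with y hy
  have hy : 0 < y := hy
  simp only [Pi.add_apply, Mw, sub_zero, abs_of_pos hy]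
  ring

lemma dense_exp (g : ℝ → ℝ) (hgm : Measurable g) (hg : IntegrableOn (fun y => g y * Mw y) (Ioi 0))
    (ε : ℝ) (hε : 0 < ε) : ∃ p : Polynomial ℝ,
    ∫ y in Ioi (0:ℝ), |g y - Real.exp (-y) * p.eval (Real.exp (-y))| * Mw y ≤ ε := by
  have hMm := Mw_meas
  set w : ℝ → ℝ := fun y => Real.exp (-y) * Mw y with hw
  have hwpos : ∀ y, 0 < w y := fun y => mul_pos (Real.exp_pos _) (by linarith [Mw_pos y])
  have hwm : Measurable w := by fun_prop
  have hwi : IntegrableOn w (Ioi 0) := by simpa using int_exp_Mw 1 one_pos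
  set lam : Measure ℝ := (volume.restrict (Ioi (0:ℝ))).withDensity (fun y => ENNReal.ofReal (w y)) with hlam
  have hfin : IsFiniteMeasure lam := isFiniteMeasure_withDensity_ofReal hwi.2
  have hint : ∀ f : ℝ → ℝ, ∫ y, f y ∂lam = ∫ y in Ioi (0:ℝ), w y * f y := by
    intro f
    rw [hlam, integral_withDensity_eq_integral_toReal_smul (by fun_prop) (by simp)]
    simp only [ENNReal.toReal_ofReal (hwpos _).le, smul_eq_mul]
  have hinte : ∀ f : ℝ → ℝ, Integrable f lam ↔ IntegrableOn (fun y => w y * f y) (Ioi 0) := by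
    intro f
    rw [hlam, integrable_withDensity_iff_integrable_smul' (by fun_prop) (by simp)]
    simp only [ENNReal.toReal_ofReal (hwpos _).le, smul_eq_mul]
    rfl
  set E : ℝ → ℝ := fun y => Real.exp (-y) with hE
  have hEm : Measurable E := by fun_prop
  set m := lam.map E with hm
  have hfm : IsFiniteMeasure m := Measure.isFiniteMeasure_map lam E
  set h : ℝ → ℝ := fun y => g y * Real.exp y with hh
  set k : ℝ → ℝ := fun t => h (-Real.log t) with hk
  have hkm : Measurable k := by fun_prop
  have hkE : ∀ y, k (E y) = h y := by intro y; simp [hk, hE]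
  have hhl : Integrable h lam := by
    rw [hinte]
    refine hg.congr (Eventually.of_forall fun y => ?_)
    simp only [hw, hh]
    have : Real.exp (-y) * Real.exp y = 1 := by rw [← Real.exp_add]; simp
    linear_combination (-(g y * Mw y)) * this
  have hkmi : Integrable k m := by
    rw [hm, integrable_map_measure hkm.aestronglyMeasurable hEm.aemeasurable]
    refine hhl.congr (Eventually.of_forall fun y => (hkE y).symm)
  have hL : 0 ≤ lam.real univ := measureReal_nonneg
  set δ := ε / (1 + lam.real univ) with hδ
  have hδ0 : 0 < δ := by positivity
  obtain ⟨f, hf, hfi⟩ := hkmi.exists_boundedContinuous_integral_sub_le hδ0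
  obtain ⟨p, hp⟩ := exists_polynomial_near_of_continuousOn 0 1 f f.continuous.continuousOn δ hδ0
  refine ⟨p, ?_⟩
  have hlin : ∀ᵐ y ∂lam, y ∈ Ioi (0:ℝ) :=
    (withDensity_absolutelyContinuous _ _).ae_le (ae_restrict_mem measurableSet_Ioi)
  have hfE : Integrable (fun y => f (E y)) lam := 
    (integrable_map_measure f.continuous.measurable.aestronglyMeasurable hEm.aemeasurable).1 hfi
  have hpE : Integrable (fun y => p.eval (E y)) lam := by
    have hc : Integrable (fun y => ‖f (E y)‖ + δ) lam := hfE.norm.add (integrable_const _)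
    refine hc.mono' (p.continuous.measurable.comp hEm).aestronglyMeasurable ?_
    filter_upwards [hlin] with y hy
    have hy : 0 < y := hy
    have := hp (E y) ⟨(Real.exp_pos _).le, Real.exp_le_one_iff.2 (by linarith)⟩
    have h2 := abs_sub_abs_le_abs_sub (p.eval (E y)) (f (E y))
    rw [Real.norm_eq_abs, Real.norm_eq_abs]
    linarith
  calc ∫ y in Ioi (0:ℝ), |g y - Real.exp (-y) * p.eval (Real.exp (-y))| * Mw y
      = ∫ y, |h y - p.eval (E y)| ∂lam := by
        rw [hint]
        congr 1; ext y
        have : Real.exp (-y) * Real.exp y = 1 := by rw [← Real.exp_add]; simp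
        have h3 : g y - Real.exp (-y) * p.eval (Real.exp (-y)) = Real.exp (-y) * (h y - p.eval (E y)) := by
          simp only [hh, hE]; linear_combination (-(g y)) * this
        rw [h3, abs_mul, abs_of_pos (Real.exp_pos _)]
        simp only [hw]; ring
    _ ≤ ∫ y, (|h y - f (E y)| + δ) ∂lam := by
        refine integral_mono_ae (hhl.sub hpE).abs ((hhl.sub hfE).abs.add (integrable_const _)) ?_
        filter_upwards [hlin] with y hy
        have hy : 0 < y := hy
        have := hp (E y) ⟨(Real.exp_pos _).le, Real.exp_le_one_iff.2 (by linarith)⟩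
        have h2 := abs_sub_le (h y) (f (E y)) (p.eval (E y))
        rw [abs_sub_comm] at this
        linarith
    _ = ∫ y, |h y - f (E y)| ∂lam + lam.real univ * δ := by
        have hab : Integrable (fun y => |h y - f (E y)|) lam := (hhl.sub hfE).abs
        rw [integral_add hab (integrable_const _), integral_const, smul_eq_mul]
    _ ≤ δ + lam.real univ * δ := by
        gcongr
        refine le_trans (le_of_eq ?_) hf
        rw [hm, integral_map hEm.aemeasurable]
        · congr 1; ext y; rw [hkE, Real.norm_eq_abs]
        · exact ((hkm.sub f.continuous.measurable).norm).aestronglyMeasurable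
    _ = ε := by rw [hδ]; field_simp

lemma density (D : ℝ → ℝ → ℝ) (C : ℝ) (hC : 0 < C) 
    (hb : ∀ R y, 1 ≤ R → 0 < y → y ≠ 4 → |D R y| ≤ C * Mw y)
    (hm : ∀ R, 1 ≤ R → AEStronglyMeasurable (D R) (volume.restrict (Ioi 0)))
    (ht : ∀ n : ℕ, 1 ≤ n → Tendsto (fun R => ∫ y in Ioi (0:ℝ), Real.exp (-(n * y)) * D R y) atTop (𝓝 0))
    (g : ℝ → ℝ) (hgm : Measurable g) (hg : IntegrableOn (fun y => g y * Mw y) (Ioi 0)) :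
    Tendsto (fun R => ∫ y in Ioi (0:ℝ), g y * D R y) atTop (𝓝 0) := by
  have hMm := Mw_meas
  have h4 : ∀ᵐ y ∂(volume.restrict (Ioi (0:ℝ))), y ≠ 4 := by
    apply ae_restrict_of_ae
    exact Measure.ae_ne volume 4
  have hbae : ∀ R, 1 ≤ R → ∀ᵐ y ∂(volume.restrict (Ioi (0:ℝ))), |D R y| ≤ C * Mw y := by
    intro R hR
    filter_upwards [ae_restrict_mem measurableSet_Ioi, h4] with y hy h4 using hb R y hR hy h4
  have hI : ∀ R, 1 ≤ R → ∀ f : ℝ → ℝ, Measurable f → IntegrableOn (fun y => f y * Mw y) (Ioi 0) →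
      IntegrableOn (fun y => f y * D R y) (Ioi 0) := by
    intro R hR f hf hfi
    refine (hfi.norm.const_mul C).mono' (hf.aestronglyMeasurable.mul (hm R hR)) ?_
    filter_upwards [hbae R hR] with y hy
    rw [norm_mul, norm_mul, Real.norm_eq_abs, Real.norm_eq_abs, Real.norm_eq_abs,
      abs_of_pos (by linarith [Mw_pos y] : 0 < Mw y)]
    have := abs_nonneg (f y)
    nlinarith
  have hexp : ∀ n : ℕ, IntegrableOn (fun y => Real.exp (-((n + 1 : ℕ) * y)) * Mw y) (Ioi 0) := by
    intro n; exact int_exp_Mw _ (by positivity)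
  have hpe : ∀ (p : Polynomial ℝ) (y : ℝ), Real.exp (-y) * p.eval (Real.exp (-y)) =
      ∑ i ∈ Finset.range (p.natDegree + 1), p.coeff i * Real.exp (-((i + 1 : ℕ) * y)) := by
    intro p y
    rw [Polynomial.eval_eq_sum_range, Finset.mul_sum]
    apply Finset.sum_congr rfl
    intro i _
    have : Real.exp (-((i + 1 : ℕ) * y)) = Real.exp (-y) ^ (i + 1) := by
      rw [← Real.exp_nat_mul]; congr 1; ring
    rw [this, pow_succ]; ring
  have hpt : ∀ p : Polynomial ℝ, Tendsto (fun R => ∫ y in Ioi (0:ℝ), 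
      (Real.exp (-y) * p.eval (Real.exp (-y))) * D R y) atTop (𝓝 0) := by
    intro p
    have h1 : Tendsto (fun R => ∑ i ∈ Finset.range (p.natDegree + 1), p.coeff i * 
        ∫ y in Ioi (0:ℝ), Real.exp (-((i + 1 : ℕ) * y)) * D R y) atTop (𝓝 0) := by
      have := tendsto_finsetSum (Finset.range (p.natDegree + 1)) 
        (fun i _ => (ht (i + 1) (by omega)).const_mul (p.coeff i))
      simpa using this
    refine h1.congr' ?_
    filter_upwards [eventually_ge_atTop 1] with R hR
    simp only [hpe, Finset.sum_mul]
    rw [integral_finsetSum]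
    · apply Finset.sum_congr rfl
      intro i _
      rw [← integral_const_mul]
      congr 1; ext y; ring
    · intro i _
      have := (hI R hR _ (by fun_prop) (hexp i)).const_mul (p.coeff i)
      refine this.congr (Eventually.of_forall fun y => ?_)
      simp only; ring
  rw [Metric.tendsto_atTop']
  intro ε hε
  obtain ⟨p, hp⟩ := dense_exp g hgm hg (ε / (2 * C)) (by positivity)
  have h2 := (Metric.tendsto_atTop'.1 (hpt p)) (ε / 2) (by positivity)
  obtain ⟨N, hN⟩ := h2
  refine ⟨max N 1, fun R hR => ?_⟩
  have hR1 : 1 ≤ R := (le_max_right _ _).trans hR.le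
  have hRN := hN R ((le_max_left _ _).trans_lt hR)
  rw [dist_zero_right, Real.norm_eq_abs] at hRN ⊢
  have hpm : Measurable (fun y => Real.exp (-y) * p.eval (Real.exp (-y))) := by
    have : Measurable (fun y => p.eval (Real.exp (-y))) := p.continuous.measurable.comp (by fun_prop)
    fun_prop
  have hpi : IntegrableOn (fun y => (Real.exp (-y) * p.eval (Real.exp (-y))) * Mw y) (Ioi 0) := by
    simp only [hpe, Finset.sum_mul]
    apply integrable_finsetSum
    intro i _
    refine ((hexp i).const_mul (p.coeff i)).congr (Eventually.of_forall fun y => ?_)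
    simp only; ring
  have hi1 := hI R hR1 g hgm hg
  have hi2 := hI R hR1 _ hpm hpi
  have hdi : IntegrableOn (fun y => |g y - Real.exp (-y) * p.eval (Real.exp (-y))| * Mw y) (Ioi 0) := by
    refine ((hg.sub hpi).abs).congr (Eventually.of_forall fun y => ?_)
    simp only [Pi.sub_apply]
    rw [← sub_mul, abs_mul, abs_of_pos (by linarith [Mw_pos y] : 0 < Mw y)]
  have h3 : |∫ y in Ioi (0:ℝ), (g y - Real.exp (-y) * p.eval (Real.exp (-y))) * D R y| ≤
      ∫ y in Ioi (0:ℝ), C * (|g y - Real.exp (-y) * p.eval (Real.exp (-y))| * Mw y) := by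
    rw [← Real.norm_eq_abs]
    refine norm_integral_le_of_norm_le (hdi.const_mul C) ?_
    filter_upwards [hbae R hR1] with y hy
    rw [norm_mul, Real.norm_eq_abs, Real.norm_eq_abs]
    have := abs_nonneg (g y - Real.exp (-y) * p.eval (Real.exp (-y)))
    nlinarith
  rw [integral_const_mul] at h3
  have h4 : ∫ y in Ioi (0:ℝ), (g y - Real.exp (-y) * p.eval (Real.exp (-y))) * D R y =
      (∫ y in Ioi (0:ℝ), g y * D R y) - ∫ y in Ioi (0:ℝ), (Real.exp (-y) * p.eval (Real.exp (-y))) * D R y := by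
    rw [← integral_sub hi1 hi2]
    congr 1; ext y; ring
  have h5 : C * (ε / (2 * C)) = ε / 2 := by field_simp
  have h6 := mul_le_mul_of_nonneg_left hp hC.le
  rw [h4] at h3
  have h7 := abs_sub_abs_le_abs_sub (∫ y in Ioi (0:ℝ), g y * D R y) (∫ y in Ioi (0:ℝ), (Real.exp (-y) * p.eval (Real.exp (-y))) * D R y)
  linarith

end WS

namespace WS
open Filter Topology Set

lemma G_bound : ∃ C, 0 < C ∧ (∀ z, 0 ≤ z → |G 0 z| ≤ C) ∧ ∀ x, |P x| ≤ C := by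
  obtain ⟨A, B, C, hC, h, -⟩ := P_asymp
  have h1 : ∀ z, 0 ≤ z → |G 0 z| ≤ C := by
    intro z hz
    have := h (2 * √z) (by positivity)
    have e : P (2 * √z) = G 0 z := by
      unfold P; congr 1; rw [mul_pow, Real.sq_sqrt hz]; ring
    rwa [e] at this
  refine ⟨C, hC, h1, fun x => h1 _ (by positivity)⟩

lemma G0_meas : Measurable (G 0) := (G_continuous 0).measurable
lemma P_meas : Measurable P := P_continuous.measurable

lemma kap_meas (R : ℝ) (hR : 0 ≤ R) : AEStronglyMeasurable (kap R) (volume.restrict (Ioi 0)) := by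
  have hG := G0_meas
  have hP := P_meas
  have : kap R = fun y => ∫ x in Ioc (0:ℝ) R, x * G 0 (y * x ^ 2 / 4) * P x ^ 2 := by
    ext y; unfold kap; rw [intervalIntegral.integral_of_le hR]
  rw [this]
  apply AEStronglyMeasurable.integral_prod_right' (f := fun q : ℝ × ℝ => q.2 * G 0 (q.1 * q.2 ^ 2 / 4) * P q.2 ^ 2)
  apply Measurable.aestronglyMeasurable
  fun_prop

/-- Fubini against `kap`. -/
lemma swap_kap (S : Set ℝ) (hS : MeasurableSet S) (hS0 : ∀ y ∈ S, 0 ≤ y) (h : ℝ → ℝ) (hm : Measurable h)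
    (hi : IntegrableOn h S) (R : ℝ) (hR : 0 ≤ R) :
    ∫ y in S, h y * kap R y = ∫ x in (0:ℝ)..R, x * P x ^ 2 * ∫ y in S, h y * G 0 (y * x ^ 2 / 4) := by
  have hG := G0_meas
  have hP := P_meas
  obtain ⟨C, hC, hGb, hPb⟩ := G_bound
  have e1 : ∀ y, h y * kap R y = ∫ x in Ioc (0:ℝ) R, x * P x ^ 2 * (h y * G 0 (y * x ^ 2 / 4)) := by
    intro y; unfold kap
    rw [intervalIntegral.integral_of_le hR, ← integral_const_mul]
    congr 1; ext x; ring
  simp only [e1]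
  rw [intervalIntegral.integral_of_le hR]
  simp only [← integral_const_mul]
  rw [integral_integral_swap]
  have hd : Integrable (fun q : ℝ × ℝ => |h q.1| * (R * C ^ 2 * C)) 
      ((volume.restrict S).prod (volume.restrict (Ioc (0:ℝ) R))) := by
    exact Integrable.mul_prod (f := fun y => |h y|) (g := fun _ => R * C ^ 2 * C) hi.abs (integrable_const _)
  refine hd.mono' ?_ ?_
  · apply Measurable.aestronglyMeasurable
    simp only [Function.uncurry_def]
    fun_prop
  · rw [Measure.prod_restrict]
    filter_upwards [ae_restrict_mem (hS.prod measurableSet_Ioc)] with q hq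
    obtain ⟨h1, h2, h3⟩ := hq
    simp only [Function.uncurry_def]
    rw [norm_mul, norm_mul, norm_mul, norm_pow]
    simp only [Real.norm_eq_abs]
    rw [abs_of_pos h2]
    have b1 := hGb (q.1 * q.2 ^ 2 / 4) (by have := hS0 _ h1; positivity)
    have b2 := hPb q.2
    calc q.2 * |P q.2| ^ 2 * (|h q.1| * |G 0 (q.1 * q.2 ^ 2 / 4)|)
        ≤ R * C ^ 2 * (|h q.1| * C) := by gcongr
      _ = _ := by ring

lemma inner_gauss (p S : ℝ) (hp : 0 < p) :
    ∫ x in Ioi (0:ℝ), x * Real.exp (-(x ^ 2 / 4 / p)) * G 0 (S * x ^ 2 / 4) = 2 * p * Real.exp (-(p * S)) := by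
  have h := integral_comp_rpow_Ioi (fun v : ℝ => Real.exp (-(1 / (4 * p) * v)) * G 0 (v * (S / 4))) (p := 2) (by norm_num)
  rw [gauss _ (by positivity)] at h
  have e : ∀ x ∈ Ioi (0:ℝ), (|(2:ℝ)| * x ^ ((2:ℝ) - 1)) • (Real.exp (-(1 / (4 * p) * x ^ (2:ℝ))) * G 0 (x ^ (2:ℝ) * (S / 4)))
      = 2 * (x * Real.exp (-(x ^ 2 / 4 / p)) * G 0 (S * x ^ 2 / 4)) := by
    intro x hx
    have e1 : x ^ (2:ℝ) = x ^ 2 := by exact_mod_cast Real.rpow_natCast x 2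
    have e2 : x ^ ((2:ℝ) - 1) = x := by norm_num
    rw [e1, e2, smul_eq_mul, abs_of_pos (by norm_num : (0:ℝ) < 2),
      show x ^ 2 * (S / 4) = S * x ^ 2 / 4 by ring, show 1 / (4 * p) * x ^ 2 = x ^ 2 / 4 / p by field_simp]
    ring
  rw [setIntegral_congr_fun measurableSet_Ioi e, integral_const_mul] at h
  have e3 : S / 4 / (1 / (4 * p)) = p * S := by field_simp
  rw [e3] at h
  have e4 : 1 / (1 / (4 * p)) = 4 * p := by field_simp
  rw [e4] at h
  linarith

lemma int_xexp (p : ℝ) (hp : 0 < p) : Integrable (fun x : ℝ => x * Real.exp (-(x ^ 2 / 4 / p))) := by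
  refine (integrable_mul_exp_neg_mul_sq (b := 1 / (4 * p)) (by positivity)).congr (Eventually.of_forall fun x => ?_)
  simp only
  congr 2; field_simp

lemma test (p : ℝ) (hp : 0 < p) : Tendsto (fun R => ∫ y in Ioi (0:ℝ), Real.exp (-(p * y)) * kap R y) atTop
    (𝓝 (2 / π * ∫ φ in (0:ℝ)..π, Real.exp (-(p * (4 * Real.sin (φ / 2) ^ 2))))) := by
  have hG := G0_meas
  have hP := P_meas
  have hπ := Real.pi_pos
  obtain ⟨C, hC, hGb, hPb⟩ := G_bound
  have hxi := int_xexp p hp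
  have hlim : ∫ x in Ioi (0:ℝ), x * P x ^ 2 * (1 / p * Real.exp (-(x ^ 2 / 4 / p))) = 
      2 / π * ∫ φ in (0:ℝ)..π, Real.exp (-(p * (4 * Real.sin (φ / 2) ^ 2))) := by
    have e1 : ∀ x : ℝ, x * P x ^ 2 * (1 / p * Real.exp (-(x ^ 2 / 4 / p))) =
        ∫ φ in Ioc (0:ℝ) π, 1 / (p * π) * (x * Real.exp (-(x ^ 2 / 4 / p)) * G 0 (4 * Real.sin (φ / 2) ^ 2 * x ^ 2 / 4)) := by
      intro x
      rw [P_sq, intervalIntegral.integral_of_le hπ.le, integral_const_mul, integral_const_mul]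
      field_simp
    simp only [e1]
    rw [integral_integral_swap]
    · simp only [integral_const_mul, inner_gauss p _ hp]
      rw [intervalIntegral.integral_of_le hπ.le]
      field_simp
    · have hd : Integrable (fun q : ℝ × ℝ => |q.1 * Real.exp (-(q.1 ^ 2 / 4 / p))| * (1 / (p * π) * C)) 
          ((volume.restrict (Ioi (0:ℝ))).prod (volume.restrict (Ioc (0:ℝ) π))) := by
        exact Integrable.mul_prod (f := fun x : ℝ => |x * Real.exp (-(x ^ 2 / 4 / p))|) 
          (g := fun _ => 1 / (p * π) * C) hxi.integrableOn.abs (integrable_const _)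
      refine hd.mono' ?_ (Eventually.of_forall fun q => ?_)
      · apply Measurable.aestronglyMeasurable
        simp only [Function.uncurry_def]
        fun_prop
      · simp only [Function.uncurry_def]
        rw [norm_mul, norm_mul (q.1 * Real.exp (-(q.1 ^ 2 / 4 / p)))]
        simp only [Real.norm_eq_abs]
        rw [abs_of_pos (by positivity : 0 < 1 / (p * π))]
        have b1 := hGb (4 * Real.sin (q.2 / 2) ^ 2 * q.1 ^ 2 / 4) (by positivity)
        calc 1 / (p * π) * (|q.1 * Real.exp (-(q.1 ^ 2 / 4 / p))| * |G 0 (4 * Real.sin (q.2 / 2) ^ 2 * q.1 ^ 2 / 4)|)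
            ≤ 1 / (p * π) * (|q.1 * Real.exp (-(q.1 ^ 2 / 4 / p))| * C) := by gcongr
          _ = _ := by ring
  rw [← hlim]
  have hI : IntegrableOn (fun x => x * P x ^ 2 * (1 / p * Real.exp (-(x ^ 2 / 4 / p)))) (Ioi 0) := by
    refine (hxi.integrableOn.abs.mul_const (C ^ 2 * (1 / p))).mono' ?_ (Eventually.of_forall fun x => ?_)
    · apply Measurable.aestronglyMeasurable; fun_prop
    · have e : x * P x ^ 2 * (1 / p * Real.exp (-(x ^ 2 / 4 / p))) = 
          (x * Real.exp (-(x ^ 2 / 4 / p))) * (P x ^ 2 * (1 / p)) := by ring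
      rw [e, norm_mul, norm_mul (P x ^ 2), norm_pow]
      simp only [Real.norm_eq_abs]
      rw [abs_of_pos (by positivity : 0 < 1 / p)]
      have := hPb x
      gcongr
  refine (intervalIntegral_tendsto_integral_Ioi 0 hI tendsto_id).congr' ?_
  filter_upwards [eventually_ge_atTop 0] with R hR
  have he : IntegrableOn (fun y : ℝ => Real.exp (-(p * y))) (Ioi 0) := by
    simpa using (int_pow_exp p hp 0).1
  rw [swap_kap (Ioi 0) measurableSet_Ioi (fun y hy => le_of_lt hy) _ (by fun_prop) he R hR]
  simp only [mul_div_assoc, gauss p hp, id]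

def kinf : ℝ → ℝ := (Ioo (0:ℝ) 4).indicator (fun y => 2 / π * (1 / √(y * (4 - y))))

lemma kinf_meas : Measurable kinf := by
  unfold kinf
  apply Measurable.indicator _ measurableSet_Ioo
  fun_prop

lemma kinf_bound (y : ℝ) (hy : 0 < y) (h4 : y ≠ 4) : |kinf y| ≤ Mw y := by
  unfold kinf
  have hM := Mw_pos y
  by_cases h : y ∈ Ioo (0:ℝ) 4
  · rw [indicator_of_mem h]
    have h1 := prod_le y hy h4
    rw [Real.sqrt_mul hy.le, show 4 - y = |y - 4| by rw [abs_of_neg (by linarith [h.2])]; ring,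
      abs_of_nonneg (by positivity)]
    have e : 1 / (√y * √|y - 4|) = 1 / √y * (1 / √|y - 4|) := by rw [one_div_mul_one_div]
    rw [e]
    have h2 : 2 / π ≤ 1 := by rw [div_le_one Real.pi_pos]; exact Real.two_le_pi
    have h3 : 0 ≤ 1 / √y * (1 / √|y - 4|) := by positivity
    unfold Mw
    nlinarith
  · rw [indicator_of_notMem h, abs_zero]; linarith

lemma cov (g : ℝ → ℝ) : ∫ y in Ioi (0:ℝ), g y * kinf y = 2 / π * ∫ φ in (0:ℝ)..π, g (4 * Real.sin (φ / 2) ^ 2) := by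
  have hπ := Real.pi_pos
  have hpos : ∀ φ ∈ Ioo (0:ℝ) π, 0 < Real.sin (φ / 2) ∧ 0 < Real.cos (φ / 2) := by
    intro φ hφ
    exact ⟨Real.sin_pos_of_pos_of_lt_pi (by linarith [hφ.1]) (by linarith [hφ.2]),
      Real.cos_pos_of_mem_Ioo ⟨by linarith [hφ.1], by linarith [hφ.2]⟩⟩
  have himg : (fun φ : ℝ => 4 * Real.sin (φ / 2) ^ 2) '' (Ioo 0 π) = Ioo 0 4 := by
    ext y
    constructor
    · rintro ⟨φ, hφ, rfl⟩
      obtain ⟨h1, h2⟩ := hpos φ hφ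
      have := Real.sin_sq_add_cos_sq (φ / 2)
      simp only [mem_Ioo]
      constructor
      · positivity
      · nlinarith
    · rintro ⟨h1, h2⟩
      have h3 : √y / 2 < 1 := by
        have : √y < 2 := by rw [Real.sqrt_lt' (by norm_num)]; linarith
        linarith
      have h4 : 0 < √y / 2 := by positivity
      refine ⟨2 * Real.arcsin (√y / 2), ⟨?_, ?_⟩, ?_⟩
      · have := Real.arcsin_pos.2 h4; linarith
      · have := Real.arcsin_lt_pi_div_two.2 h3; linarith
      · simp only
        rw [mul_div_cancel_left₀ _ (by norm_num), Real.sin_arcsin (by linarith) h3.le, div_pow, Real.sq_sqrt h1.le]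
        ring
  have hinj : InjOn (fun φ : ℝ => 4 * Real.sin (φ / 2) ^ 2) (Ioo 0 π) := by
    intro a ha b hb hab
    simp only at hab
    have h1 := (hpos a ha).1
    have h2 := (hpos b hb).1
    have h3 : Real.sin (a / 2) = Real.sin (b / 2) := by
      apply (sq_eq_sq₀ h1.le h2.le).1; linarith
    have := Real.injOn_sin (x₁ := a / 2) (x₂ := b / 2) ⟨by linarith [ha.1], by linarith [ha.2]⟩ 
      ⟨by linarith [hb.1], by linarith [hb.2]⟩ h3
    linarith
  have hder : ∀ φ ∈ Ioo (0:ℝ) π, HasDerivWithinAt (fun φ : ℝ => 4 * Real.sin (φ / 2) ^ 2) 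
      (4 * Real.sin (φ / 2) * Real.cos (φ / 2)) (Ioo 0 π) φ := by
    intro φ hφ
    refine HasDerivAt.hasDerivWithinAt ?_
    refine ((((hasDerivAt_id φ).div_const 2).sin.pow 2).const_mul 4).congr_deriv ?_
    simp; ring
  have h := integral_image_eq_integral_abs_deriv_smul measurableSet_Ioo hder hinj (fun y => g y * kinf y)
  rw [himg] at h
  have h0 : ∫ y in Ioi (0:ℝ), g y * kinf y = ∫ y in Ioo (0:ℝ) 4, g y * kinf y := by
    apply setIntegral_eq_of_subset_of_forall_sdiff_eq_zero measurableSet_Ioi Ioo_subset_Ioi_self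
    intro y hy
    unfold kinf
    rw [indicator_of_notMem hy.2, mul_zero]
  rw [h0, h, intervalIntegral.integral_of_le hπ.le, ← integral_const_mul, integral_Ioc_eq_integral_Ioo]
  apply setIntegral_congr_fun measurableSet_Ioo
  intro φ hφ
  obtain ⟨h1, h2⟩ := hpos φ hφ
  have hm : 4 * Real.sin (φ / 2) ^ 2 ∈ Ioo (0:ℝ) 4 := by rw [← himg]; exact ⟨φ, hφ, rfl⟩
  have e : √(4 * Real.sin (φ / 2) ^ 2 * (4 - 4 * Real.sin (φ / 2) ^ 2)) = 4 * Real.sin (φ / 2) * Real.cos (φ / 2) := by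
    rw [show 4 * Real.sin (φ / 2) ^ 2 * (4 - 4 * Real.sin (φ / 2) ^ 2) = (4 * Real.sin (φ / 2) * Real.cos (φ / 2)) ^ 2 by
      have := Real.sin_sq_add_cos_sq (φ / 2)
      linear_combination (-16 * Real.sin (φ / 2) ^ 2) * this]
    exact Real.sqrt_sq (by positivity)
  simp only [smul_eq_mul]
  unfold kinf
  rw [indicator_of_mem hm, e, abs_of_pos (by positivity)]
  field_simp

end WS

namespace WS
open Filter Topology Set

lemma sep (ν u a : ℝ) (hν : 0 < ν) (hu : 0 < u) (ha : u ≠ a) :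
    IntervalIntegrable (fun y => (u - y) ^ (ν - 1) * (1 / √|y - a|)) volume 0 u := by
  have hd : 0 < |u - a| := abs_pos.2 (sub_ne_zero.2 ha)
  set d := |u - a| / 2 with hdd
  have hd0 : 0 < d := by positivity
  rw [intervalIntegrable_iff_integrableOn_Ioc_of_le hu.le]
  have i1 := ((intervalIntegrable_iff_integrableOn_Ioc_of_le hu.le).1 (int_pow_sub ν u hν)).const_mul (1 / √d)
  have i2 := ((intervalIntegrable_iff_integrableOn_Ioc_of_le hu.le).1 (int_abs a 0 u)).const_mul (d ^ (ν - 1) + u ^ (ν - 1))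
  refine (i1.add i2).mono' (by apply Measurable.aestronglyMeasurable; fun_prop) ?_
  filter_upwards [ae_restrict_mem measurableSet_Ioc] with y hy
  have hy1 := hy.1
  have hy2 := hy.2
  have p1 : 0 ≤ (u - y) ^ (ν - 1) := Real.rpow_nonneg (by linarith) _
  have p2 : 0 ≤ 1 / √|y - a| := by positivity
  have p3 : 0 ≤ d ^ (ν - 1) := by positivity
  have p4 : 0 ≤ u ^ (ν - 1) := by positivity
  rw [Real.norm_eq_abs, abs_of_nonneg (by positivity)]
  simp only [Pi.add_apply]
  by_cases h : d ≤ |y - a|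
  · have : 1 / √|y - a| ≤ 1 / √d := by gcongr
    have h2 : 0 ≤ (d ^ (ν - 1) + u ^ (ν - 1)) * (1 / √|y - a|) := by positivity
    nlinarith
  · push Not at h
    have h1 : d ≤ u - y := by
      have := abs_sub_le u y a
      rw [abs_of_nonneg (by linarith : 0 ≤ u - y)] at this
      linarith
    have h2 : (u - y) ^ (ν - 1) ≤ d ^ (ν - 1) + u ^ (ν - 1) := by
      rcases le_total 0 (ν - 1) with hn | hn
      · have := Real.rpow_le_rpow (by linarith) (by linarith : u - y ≤ u) hn
        linarith
      · have := Real.rpow_le_rpow_of_nonpos hd0 h1 hn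
        linarith
    have h3 : 0 ≤ 1 / √d * (u - y) ^ (ν - 1) := by positivity
    nlinarith

def gt (ν u : ℝ) : ℝ → ℝ := (Ioo (0:ℝ) u).indicator (fun y => (u - y) ^ (ν - 1))

lemma gt_meas (ν u : ℝ) : Measurable (gt ν u) := by
  unfold gt
  apply Measurable.indicator _ measurableSet_Ioo
  fun_prop

lemma gt_set (ν u : ℝ) (F : ℝ → ℝ) : 
    (fun y => gt ν u y * F y) = (Ioo (0:ℝ) u).indicator (fun y => (u - y) ^ (ν - 1) * F y) := by
  ext y
  unfold gt
  by_cases h : y ∈ Ioo 0 u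
  · rw [indicator_of_mem h, indicator_of_mem h]
  · rw [indicator_of_notMem h, indicator_of_notMem h, zero_mul]

lemma gt_int (ν u : ℝ) (hν : 0 < ν) (hu : 0 < u) (hu4 : u ≠ 4) :
    IntegrableOn (fun y => gt ν u y * Mw y) (Ioi 0) := by
  rw [gt_set]
  refine IntegrableOn.mono_set ?_ (subset_univ _)
  rw [integrableOn_univ, integrable_indicator_iff measurableSet_Ioo]
  have h := ((int_pow_sub ν u hν).add (sep ν u 0 hν hu hu.ne')).add (sep ν u 4 hν hu hu4)
  rw [intervalIntegrable_iff_integrableOn_Ioo_of_le hu.le] at h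
  refine h.congr ?_
  filter_upwards [ae_restrict_mem measurableSet_Ioo] with y hy
  simp only [Pi.add_apply, Mw, sub_zero, abs_of_pos hy.1]
  ring

lemma gt_int1 (ν u : ℝ) (hν : 0 < ν) (hu : 0 < u) : IntegrableOn (gt ν u) (Ioi 0) := by
  refine IntegrableOn.mono_set ?_ (subset_univ _)
  unfold gt
  rw [integrableOn_univ, integrable_indicator_iff measurableSet_Ioo]
  exact (intervalIntegrable_iff_integrableOn_Ioo_of_le hu.le).1 (int_pow_sub ν u hν)

lemma gt_integral (ν u : ℝ) (hu : 0 < u) (F : ℝ → ℝ) : ∫ y in Ioi (0:ℝ), gt ν u y * F y =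
    ∫ y in (0:ℝ)..u, (u - y) ^ (ν - 1) * F y := by
  rw [gt_set, setIntegral_indicator measurableSet_Ioo, intervalIntegral.integral_of_le hu.le,
    integral_Ioc_eq_integral_Ioo, inter_eq_self_of_subset_right Ioo_subset_Ioi_self]

lemma kap_lim (ν u : ℝ) (hν : 0 < ν) (hu : 0 < u) (hu4 : u ≠ 4) :
    Tendsto (fun R => ∫ y in Ioi (0:ℝ), gt ν u y * kap R y) atTop
      (𝓝 (2 / π * ∫ φ in (0:ℝ)..π, gt ν u (4 * Real.sin (φ / 2) ^ 2))) := by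
  obtain ⟨C, hC, hb⟩ := kap_bound
  have hMm := Mw_meas
  have hkm := kinf_meas
  have h4 : ∀ᵐ y ∂(volume.restrict (Ioi (0:ℝ))), y ≠ 4 := by
    apply ae_restrict_of_ae
    exact Measure.ae_ne volume 4
  have hI1 : ∀ R, 1 ≤ R → ∀ f : ℝ → ℝ, Measurable f → IntegrableOn (fun y => f y * Mw y) (Ioi 0) →
      IntegrableOn (fun y => f y * kap R y) (Ioi 0) := by
    intro R hR f hf hfi
    refine (hfi.norm.const_mul C).mono' (hf.aestronglyMeasurable.mul (kap_meas R (by linarith))) ?_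
    filter_upwards [ae_restrict_mem measurableSet_Ioi, h4] with y hy h4
    have hy := hb R y hR hy h4
    rw [norm_mul, norm_mul, Real.norm_eq_abs, Real.norm_eq_abs, Real.norm_eq_abs,
      abs_of_pos (by linarith [Mw_pos y] : 0 < Mw y)]
    have := abs_nonneg (f y)
    nlinarith
  have hI2 : ∀ f : ℝ → ℝ, Measurable f → IntegrableOn (fun y => f y * Mw y) (Ioi 0) →
      IntegrableOn (fun y => f y * kinf y) (Ioi 0) := by
    intro f hf hfi
    refine hfi.norm.mono' (hf.mul hkm).aestronglyMeasurable ?_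
    filter_upwards [ae_restrict_mem measurableSet_Ioi, h4] with y hy h4
    have hy := kinf_bound y hy h4
    rw [norm_mul, norm_mul, Real.norm_eq_abs, Real.norm_eq_abs, Real.norm_eq_abs,
      abs_of_pos (by linarith [Mw_pos y] : 0 < Mw y)]
    have := abs_nonneg (f y)
    nlinarith
  have hsub : ∀ R, 1 ≤ R → ∀ f : ℝ → ℝ, Measurable f → IntegrableOn (fun y => f y * Mw y) (Ioi 0) →
      ∫ y in Ioi (0:ℝ), f y * (kap R y - kinf y) = (∫ y in Ioi (0:ℝ), f y * kap R y) -
        2 / π * ∫ φ in (0:ℝ)..π, f (4 * Real.sin (φ / 2) ^ 2) := by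
    intro R hR f hf hfi
    rw [← cov, ← integral_sub (hI1 R hR f hf hfi) (hI2 f hf hfi)]
    congr 1; ext y; ring
  have key := density (fun R y => kap R y - kinf y) (C + 1) (by linarith) ?_ ?_ ?_ (gt ν u) (gt_meas ν u)
    (gt_int ν u hν hu hu4)
  · rw [← tendsto_sub_nhds_zero_iff]
    refine key.congr' ?_
    filter_upwards [eventually_ge_atTop 1] with R hR
    exact hsub R hR _ (gt_meas ν u) (gt_int ν u hν hu hu4)
  · intro R y hR hy h4
    have h1 := hb R y hR hy h4
    have h2 := kinf_bound y hy h4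
    have h3 := abs_sub (kap R y) (kinf y)
    linarith
  · intro R hR
    exact (kap_meas R (by linarith)).sub hkm.aestronglyMeasurable
  · intro n hn
    have hn' : (0:ℝ) < n := by exact_mod_cast hn
    have ht := tendsto_sub_nhds_zero_iff.2 (test n hn')
    refine ht.congr' ?_
    filter_upwards [eventually_ge_atTop 1] with R hR
    exact (hsub R hR (fun y => Real.exp (-(n * y))) (by fun_prop) (int_exp_Mw n hn')).symm

lemma bessel_int (s u : ℝ) (hs : -2 < s) (hu : 0 < u) (R : ℝ) (hR : 0 ≤ R) :
    ∫ x in (0 : ℝ)..R, besselJ (1 + s / 2) (Real.sqrt u * x) * besselJ0 x ^ 2 * x ^ (-s / 2) =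
    2 ^ (-(1 + s / 2)) * u ^ (-(1 + s / 2) / 2) / Real.Gamma (1 + s / 2) *
      ∫ y in Ioi (0:ℝ), gt (1 + s / 2) u y * kap R y := by
  have hν : 0 < 1 + s / 2 := by linarith
  rw [swap_kap (Ioi 0) measurableSet_Ioi (fun y hy => le_of_lt hy) _ (gt_meas _ u) (gt_int1 _ u hν hu) R hR,
    ← intervalIntegral.integral_const_mul]
  apply intervalIntegral.integral_congr_ae
  refine Eventually.of_forall fun x hx => ?_
  rw [uIoc_of_le hR] at hx
  have hx0 := hx.1
  rw [gt_integral _ u hu, sonine _ u x hν hu hx0, besselJ0_eq]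
  have e : x ^ (1 + s / 2) * x ^ (-s / 2) = x := by
    rw [← Real.rpow_add hx0]
    rw [show 1 + s / 2 + -s / 2 = 1 by ring, Real.rpow_one]
  have eP : G 0 (x ^ 2 / 4) = P x := rfl
  rw [eP]
  generalize (∫ y in (0:ℝ)..u, (u - y) ^ (1 + s / 2 - 1) * G 0 (y * x ^ 2 / 4)) = I
  linear_combination (2 ^ (-(1 + s / 2)) * u ^ (-(1 + s / 2) / 2) / Real.Gamma (1 + s / 2) * I * P x ^ 2) * e

lemma const_eq (s u : ℝ) (hu : 0 < u) (hs : -2 < s) (X : ℝ) :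
    2 ^ (-(1 + s / 2)) * u ^ (-(1 + s / 2) / 2) / Real.Gamma (1 + s / 2) * (2 / π * X) =
    X / ((2 : ℝ) ^ (s / 2) * π * u ^ ((2 + s) / 4) * Real.Gamma (1 + s / 2)) := by
  have hG : 0 < Real.Gamma (1 + s / 2) := Real.Gamma_pos_of_pos (by linarith)
  have hπ := Real.pi_pos
  rw [show -(1 + s / 2) / 2 = -((2 + s) / 4) by ring, Real.rpow_neg hu.le, Real.rpow_neg (by norm_num),
    Real.rpow_add (by norm_num), Real.rpow_one]
  have h1 : (0:ℝ) < 2 ^ (s / 2) := by positivity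
  have h2 : (0:ℝ) < u ^ ((2 + s) / 4) := by positivity
  field_simp

lemma lim_gt4 (s u : ℝ) (hu : 4 < u) : ∫ φ in (0:ℝ)..π, gt (1 + s / 2) u (4 * Real.sin (φ / 2) ^ 2) =
    ∫ φ in (0:ℝ)..π, (u - 4 * Real.sin (φ / 2) ^ 2) ^ (s / 2) := by
  have hπ := Real.pi_pos
  apply intervalIntegral.integral_congr_ae
  refine Eventually.of_forall fun φ hφ => ?_
  rw [uIoc_of_le hπ.le] at hφ
  have h1 : 0 < Real.sin (φ / 2) := Real.sin_pos_of_pos_of_lt_pi (by linarith [hφ.1]) (by linarith [hφ.2])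
  have h2 := Real.sin_sq_le_one (φ / 2)
  unfold gt
  have hm : 4 * Real.sin (φ / 2) ^ 2 ∈ Ioo (0:ℝ) u := ⟨by positivity, by linarith⟩
  rw [indicator_of_mem hm, add_sub_cancel_left]

lemma lim_lt4 (s u : ℝ) (hu : 0 < u) (hu4 : u < 4) : ∫ φ in (0:ℝ)..π, gt (1 + s / 2) u (4 * Real.sin (φ / 2) ^ 2) =
    ∫ φ in (0:ℝ)..(2 * Real.arcsin (√u / 2)), (u - 4 * Real.sin (φ / 2) ^ 2) ^ (s / 2) := by
  have hπ := Real.pi_pos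
  have h3 : √u / 2 < 1 := by
    have : √u < 2 := by rw [Real.sqrt_lt' (by norm_num)]; linarith
    linarith
  have h4 : 0 < √u / 2 := by positivity
  have ha0 := Real.arcsin_pos.2 h4
  have ha1 := Real.arcsin_lt_pi_div_two.2 h3
  have hsa := Real.sin_arcsin (by linarith) h3.le
  set a := Real.arcsin (√u / 2) with ha
  have hua : u = 4 * Real.sin a ^ 2 := by
    rw [hsa, div_pow, Real.sq_sqrt hu.le]; ring
  rw [intervalIntegral.integral_of_le hπ.le, intervalIntegral.integral_of_le (by linarith),
    integral_Ioc_eq_integral_Ioo, integral_Ioc_eq_integral_Ioo]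
  rw [setIntegral_eq_of_subset_of_forall_sdiff_eq_zero (s := Ioo 0 (2 * a)) measurableSet_Ioo
    (Ioo_subset_Ioo_right (by linarith))]
  · apply setIntegral_congr_fun measurableSet_Ioo
    intro φ hφ
    have h1 : 0 < Real.sin (φ / 2) := Real.sin_pos_of_pos_of_lt_pi (by linarith [hφ.1]) (by linarith [hφ.2])
    have h2 : Real.sin (φ / 2) < Real.sin a := 
      Real.sin_lt_sin_of_lt_of_le_pi_div_two (by linarith [hφ.1]) (by linarith) (by linarith [hφ.2])
    simp only
    unfold gt
    have hm : 4 * Real.sin (φ / 2) ^ 2 ∈ Ioo (0:ℝ) u := ⟨by positivity, by rw [hua]; gcongr⟩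
    rw [indicator_of_mem hm, add_sub_cancel_left]
  · intro φ hφ
    obtain ⟨h1, h2⟩ := hφ
    have h5 : 2 * a ≤ φ := by
      by_contra hc
      exact h2 ⟨h1.1, not_le.1 hc⟩
    have h6 : Real.sin a ≤ Real.sin (φ / 2) := 
      Real.sin_le_sin_of_le_of_le_pi_div_two (by linarith) (by linarith [h1.2]) (by linarith)
    unfold gt
    rw [indicator_of_notMem]
    intro hm
    have h7 := hm.2
    have h8 : 0 < Real.sin a := by rw [hsa]; exact h4
    nlinarith

end WS

theorem weber_schafheitlin_squared (s : ℝ) (hs₁ : -2 < s) (hs₂ : s < 2)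
    (u : ℝ) (hu : 0 < u) (hu' : u ≠ 4) :
    Filter.Tendsto
      (fun R : ℝ => ∫ x in (0 : ℝ)..R,
        besselJ (1 + s / 2) (Real.sqrt u * x) * besselJ0 x ^ 2 * x ^ (-s / 2))
      Filter.atTop
      (nhds (if u < 4 then
          ∫ φ in (0 : ℝ)..(2 * Real.arcsin (Real.sqrt u / 2)),
            (u - 4 * Real.sin (φ / 2) ^ 2) ^ (s / 2) /
              ((2 : ℝ) ^ (s / 2) * Real.pi * u ^ ((2 + s) / 4) * Real.Gamma (1 + s / 2))
        else
          ∫ φ in (0 : ℝ)..Real.pi,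
            (u - 4 * Real.sin (φ / 2) ^ 2) ^ (s / 2) /
              ((2 : ℝ) ^ (s / 2) * Real.pi * u ^ ((2 + s) / 4) * Real.Gamma (1 + s / 2)))) := by
  have h := (WS.kap_lim (1 + s / 2) u (by linarith) hu hu').const_mul
    (2 ^ (-(1 + s / 2)) * u ^ (-(1 + s / 2) / 2) / Real.Gamma (1 + s / 2))
  rw [WS.const_eq s u hu hs₁] at h
  have h2 := h.congr' (f₂ := fun R : ℝ => ∫ x in (0 : ℝ)..R,
        besselJ (1 + s / 2) (Real.sqrt u * x) * besselJ0 x ^ 2 * x ^ (-s / 2)) (by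
    filter_upwards [Filter.eventually_ge_atTop 0] with R hR
    exact (WS.bessel_int s u hs₁ hu R hR).symm)
  convert h2 using 2
  split_ifs with h4
  · rw [intervalIntegral.integral_div, WS.lim_lt4 s u hu h4]
  · rw [intervalIntegral.integral_div, WS.lim_gt4 s u (lt_of_le_of_ne (not_lt.1 h4) hu'.symm)]
end
end
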